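/- arXiv:1411.3366 — 4 statements merged into one kernel-verified Lean document; each statement's English description precedes it below -/
import Mathlib

section
/- A Banach space X is not superreflexive if and only if the infinite binary tree T_∞ admits a bilipschitz embedding into X. -/
noncomputable section

/-- `X` is finitely representable in `Y`. -/
def FinitelyRepresentable (X Y : Type) [NormedAddCommGroup X] [NormedSpace ℝ X]
    [NormedAddCommGroup Y] [NormedSpace ℝ Y] : Prop :=
  ∀ ε : ℝ, 0 < ε → ∀ F : Submodule ℝ X, FiniteDimensional ℝ F →
    ∃ G : Submodule ℝ Y, FiniteDimensional ℝ G ∧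
      ∃ T : F ≃L[ℝ] G, ‖(T : F →L[ℝ] G)‖ * ‖(T.symm : G →L[ℝ] F)‖ ≤ 1 + ε

/-- A Banach space is reflexive if the canonical embedding into the double dual is
surjective. -/
def IsReflexiveBanach (X : Type) [NormedAddCommGroup X] [NormedSpace ℝ X] : Prop :=
  Function.Surjective (NormedSpace.inclusionInDoubleDual ℝ X)

/-- `Y` is superreflexive: every Banach space finitely representable in `Y` is reflexive. -/
def SuperReflexive (Y : Type) [NormedAddCommGroup Y] [NormedSpace ℝ Y] : Prop :=
  ∀ (X : Type) [NormedAddCommGroup X] [NormedSpace ℝ X] [CompleteSpace X],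
    FinitelyRepresentable X Y → IsReflexiveBanach X

/-- The length of the longest common initial segment of two `{0,1}`-sequences. -/
def lcp : List Bool → List Bool → ℕ
  | a :: s, b :: t => if a = b then lcp s t + 1 else 0
  | _, _ => 0

/-- The tree distance `d(s,t) = |s| + |t| − 2ℓ(s,t)` on finite `{0,1}`-sequences; the set
of all finite `{0,1}`-sequences with this distance is the infinite binary tree `T_∞`. -/
def treeDist (s t : List Bool) : ℝ :=
  (s.length : ℝ) + (t.length : ℝ) - 2 * (lcp s t : ℝ)

open Filter Topology
open scoped BoundedContinuousFunction

/-- In a reflexive space every bounded sequence converges weakly along the hyperfilter. -/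
theorem exists_weak_limit_of_reflexive {Y : Type*} [NormedAddCommGroup Y] [NormedSpace ℝ Y]
    (hY : Function.Surjective (NormedSpace.inclusionInDoubleDual ℝ Y))
    (z : ℕ → Y) (R : ℝ) (hz : ∀ n, ‖z n‖ ≤ R) :
    ∃ y : Y, ∀ f : StrongDual ℝ Y, Tendsto (fun n => f (z n)) (hyperfilter ℕ) (𝓝 (f y)) := by
  have hb : ∀ (f : StrongDual ℝ Y) n, ‖f (z n)‖ ≤ R * ‖f‖ := fun f n =>
    (f.le_opNorm _).trans (by rw [mul_comm]; gcongr; exact hz n)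
  have hlim : ∀ f : StrongDual ℝ Y, ∃ l : ℝ, ‖l‖ ≤ R * ‖f‖ ∧
      Tendsto (fun n => f (z n)) (hyperfilter ℕ) (𝓝 l) := by
    intro f
    obtain ⟨l, hl, h⟩ := (isCompact_closedBall (0 : ℝ) (R * ‖f‖)).ultrafilter_le_nhds'
      ((hyperfilter ℕ).map fun n => f (z n))
      (by
        rw [Ultrafilter.mem_map]
        exact univ_mem' fun n => by simpa using hb f n)
    exact ⟨l, by simpa using hl, h⟩
  choose l hl hlt using hlim
  let L : StrongDual ℝ Y →ₗ[ℝ] ℝ :=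
    { toFun := l
      map_add' := fun f g => tendsto_nhds_unique (hlt (f + g))
        (by simpa using (hlt f).add (hlt g))
      map_smul' := fun c f => tendsto_nhds_unique (hlt (c • f))
        (by simpa using (hlt f).const_mul c) }
  obtain ⟨y, hy⟩ := hY (L.mkContinuous R hl)
  refine ⟨y, fun f => ?_⟩
  have : f y = l f := by
    rw [← NormedSpace.dual_def ℝ Y, hy]
    rfl
  rw [this]
  exact hlt f

/-- If no slice of a bounded set `K` lies in a ball of radius `2r`, then every slice
of `K` contains another one which avoids a prescribed ball of radius `r`. -/
theorem exists_slice_avoiding_ball {Y : Type*} [NormedAddCommGroup Y] [NormedSpace ℝ Y]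
    {K : Set Y} {R r : ℝ} (hr : 0 < r) (hR : ∀ z ∈ K, ‖z‖ ≤ R)
    (hslice : ∀ (φ : StrongDual ℝ Y) (α : ℝ) (y : Y), (∃ p ∈ K, α < φ p) →
      ∃ q ∈ K, α < φ q ∧ 2 * r ≤ ‖q - y‖)
    (φ : StrongDual ℝ Y) (α : ℝ) (y : Y) (hp : ∃ p ∈ K, α < φ p) :
    ∃ (ψ : StrongDual ℝ Y) (β : ℝ), (∃ q ∈ K, β < ψ q) ∧
      ∀ z ∈ K, β ≤ ψ z → α < φ z ∧ r ≤ ‖z - y‖ := by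
  set C : Set Y := closure (convexHull ℝ ((K ∩ {z | φ z ≤ α}) ∪ (K ∩ Metric.ball y r))) with hC
  by_cases hKC : K ⊆ C
  · exfalso
    obtain ⟨p, hpK, hpα⟩ := hp
    have hbdd : BddAbove (φ '' K) := by
      refine ⟨‖φ‖ * R, ?_⟩
      rintro _ ⟨z, hz, rfl⟩
      exact (le_abs_self _).trans ((φ.le_opNorm z).trans (by gcongr; exact hR z hz))
    set M := sSup (φ '' K) with hM
    have hleM : ∀ z ∈ K, φ z ≤ M := fun z hz => le_csSup hbdd ⟨z, hz, rfl⟩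
    have hαM : α < M := hpα.trans_le (hleM p hpK)
    set ρ := R + ‖y‖ with hρ
    have hzy : ∀ z ∈ K, ‖z - y‖ ≤ ρ := fun z hz =>
      (norm_sub_le _ _).trans (by rw [hρ]; gcongr; exact hR z hz)
    have hρ0 : 0 ≤ ρ := (norm_nonneg _).trans (hzy p hpK)
    have hd : 0 < M - α := sub_pos.2 hαM
    set κ := ρ / (M - α) with hκ
    have hκ0 : 0 ≤ κ := div_nonneg hρ0 hd.le
    have hκd : κ * (M - α) = ρ := by rw [hκ]; field_simp
    have hsub : C ⊆ {z | ‖z - y‖ + κ * φ z ≤ r + κ * M} := by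
      refine closure_minimal (convexHull_min ?_ ?_) ?_
      · rintro z (⟨hz, hzα⟩ | ⟨hz, hzy'⟩)
        · have h1 := hzy z hz
          have h2 : φ z ≤ α := hzα
          have := mul_le_mul_of_nonneg_left h2 hκ0
          simp only [Set.mem_ofPred_eq]
          nlinarith
        · have := mul_le_mul_of_nonneg_left (hleM z hz) hκ0
          rw [mem_ball_iff_norm] at hzy'
          simp only [Set.mem_ofPred_eq]
          linarith
      · intro u hu v hv a b ha hb hab
        simp only [Set.mem_ofPred_eq] at *
        have : a • u + b • v - y = a • (u - y) + b • (v - y) := by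
          rw [smul_sub, smul_sub, sub_add_sub_comm, ← add_smul, hab, one_smul]
        rw [this]
        have h1 : ‖a • (u - y) + b • (v - y)‖ ≤ a * ‖u - y‖ + b * ‖v - y‖ := by
          refine (norm_add_le _ _).trans ?_
          rw [norm_smul, norm_smul, Real.norm_of_nonneg ha, Real.norm_of_nonneg hb]
        simp only [map_add, map_smul, smul_eq_mul]
        have h2 := mul_le_mul_of_nonneg_left hu ha
        have h3 := mul_le_mul_of_nonneg_left hv hb
        have h4 : a * (r + κ * M) + b * (r + κ * M) = r + κ * M := by rw [← add_mul, hab, one_mul]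
        nlinarith
      · exact isClosed_le (by fun_prop) (by fun_prop)
    have hη : 0 < r / (κ + 1) := by positivity
    obtain ⟨q, hq, hqM, hqy⟩ := hslice φ (M - r / (κ + 1)) y (by
      obtain ⟨_, ⟨z, hz, rfl⟩, hz'⟩ :=
        exists_lt_of_lt_csSup (⟨φ p, p, hpK, rfl⟩ : (φ '' K).Nonempty)
        (show M - r / (κ + 1) < sSup (φ '' K) by rw [← hM]; linarith)
      exact ⟨z, hz, hz'⟩)
    have h1 : ‖q - y‖ + κ * φ q ≤ r + κ * M := hsub (hKC hq)
    have h2 : κ * (M - φ q) ≤ κ * (r / (κ + 1)) := by gcongr; linarith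
    have h3 : κ * (r / (κ + 1)) < r := by
      rw [mul_div_assoc', div_lt_iff₀ (by positivity)]
      nlinarith
    linarith
  · obtain ⟨q, hq, hqC⟩ := Set.not_subset.1 hKC
    obtain ⟨f, u, hfu, huq⟩ := geometric_hahn_banach_closed_point
      ((convex_convexHull ℝ _).closure) isClosed_closure hqC
    refine ⟨f, u, ⟨q, hq, huq⟩, fun z hz hzu => ?_⟩
    have hzC : z ∉ C := fun h => (hfu z h).not_ge hzu
    have hsub := (subset_convexHull ℝ ((K ∩ {z | φ z ≤ α}) ∪ (K ∩ Metric.ball y r))).trans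
      subset_closure
    constructor
    · by_contra h
      exact hzC (hsub (Or.inl ⟨hz, not_lt.1 h⟩))
    · by_contra h
      exact hzC (hsub (Or.inr ⟨hz, mem_ball_iff_norm.2 (not_le.1 h)⟩))

/-- A space containing a nonempty bounded separable convex set all of whose slices are large
is not reflexive. -/
theorem not_reflexive_of_large_slices {Y : Type*} [NormedAddCommGroup Y] [NormedSpace ℝ Y]
    {K : Set Y} (hK : Convex ℝ K) (hne : K.Nonempty) (hsepK : TopologicalSpace.IsSeparable K)
    {R r : ℝ} (hr : 0 < r) (hR : ∀ z ∈ K, ‖z‖ ≤ R)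
    (hslice : ∀ (φ : StrongDual ℝ Y) (α : ℝ) (y : Y), (∃ p ∈ K, α < φ p) →
      ∃ q ∈ K, α < φ q ∧ 2 * r ≤ ‖q - y‖) :
    ¬ Function.Surjective (NormedSpace.inclusionInDoubleDual ℝ Y) := by
  intro hY
  obtain ⟨c, hc, hKc⟩ := hsepK
  have hcne : c.Nonempty := closure_nonempty_iff.1 (hne.mono hKc)
  obtain ⟨y, rfl⟩ := hc.exists_eq_range hcne
  let S := {p : StrongDual ℝ Y × ℝ // ∃ q ∈ K, p.2 < p.1 q}
  have hstep : ∀ (n : ℕ) (p : S), ∃ p' : S, ∀ z ∈ K, p'.1.2 ≤ p'.1.1 z →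
      p.1.2 < p.1.1 z ∧ r ≤ ‖z - y n‖ := by
    rintro n ⟨⟨φ, α⟩, hp⟩
    obtain ⟨ψ, β, hne', h⟩ := exists_slice_avoiding_ball hr hR hslice φ α (y n) hp
    exact ⟨⟨⟨ψ, β⟩, hne'⟩, h⟩
  choose next hnext using hstep
  let p0 : S := ⟨(0, -1), by obtain ⟨q, hq⟩ := hne; exact ⟨q, hq, by simp⟩⟩
  let p : ℕ → S := fun n => Nat.rec p0 next n
  have hp : ∀ n, ∀ z ∈ K, (p (n + 1)).1.2 ≤ (p (n + 1)).1.1 z →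
      (p n).1.2 < (p n).1.1 z ∧ r ≤ ‖z - y n‖ := fun n => hnext n (p n)
  choose z hzK hz using fun n => (p n).2
  have hmono : ∀ n m, n ≤ m → ∀ w ∈ K, (p m).1.2 < (p m).1.1 w → (p n).1.2 < (p n).1.1 w := by
    intro n m hnm w hw
    induction m, hnm using Nat.le_induction with
    | base => exact id
    | succ m _ ih => exact fun h => ih (hp m w hw h.le).1
  obtain ⟨w, hw⟩ := exists_weak_limit_of_reflexive hY z R fun n => hR _ (hzK n)
  have hmem : ∀ n, w ∈ closure (K ∩ {v | (p n).1.2 ≤ (p n).1.1 v}) := by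
    intro n
    by_contra hwn
    obtain ⟨f, u, hfu, huw⟩ := geometric_hahn_banach_closed_point
      ((hK.inter (convex_halfSpace_ge (p n).1.1.isLinear _)).closure) isClosed_closure hwn
    refine (le_of_tendsto (hw f) ?_).not_gt huw
    refine Filter.Eventually.filter_mono (Nat.hyperfilter_le_atTop) ?_
    filter_upwards [eventually_ge_atTop n] with m hm
    exact (hfu _ (subset_closure ⟨hzK m, (hmono n m hm _ (hzK m) (hz m)).le⟩)).le
  have hfar : ∀ n, r ≤ ‖w - y n‖ := by
    intro n
    have : closure (K ∩ {v | (p (n + 1)).1.2 ≤ (p (n + 1)).1.1 v}) ⊆ {v | r ≤ ‖v - y n‖} :=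
      closure_minimal (fun v hv => (hp n v hv.1 hv.2).2)
        (isClosed_le (by fun_prop) (by fun_prop))
    exact this (hmem (n + 1))
  have hwc : w ∈ closure (Set.range y) := by
    refine closure_minimal hKc isClosed_closure ?_
    exact closure_mono Set.inter_subset_left (hmem 0)
  obtain ⟨_, ⟨n, rfl⟩, hn⟩ := Metric.mem_closure_iff.1 hwc r hr
  rw [dist_eq_norm] at hn
  exact (hfar n).not_gt hn

/-- A space containing a bounded separated infinite dyadic martingale is not reflexive. -/
theorem not_reflexive_of_dyadic_tree {Y : Type*} [NormedAddCommGroup Y] [NormedSpace ℝ Y]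
    (x : List Bool → Y) {R ε : ℝ} (hε : 0 < ε) (hR : ∀ s, ‖x s‖ ≤ R)
    (hmid : ∀ s, x s = (2⁻¹ : ℝ) • (x (s ++ [false]) + x (s ++ [true])))
    (hsep : ∀ s, ε ≤ ‖x (s ++ [false]) - x (s ++ [true])‖) :
    ¬ Function.Surjective (NormedSpace.inclusionInDoubleDual ℝ Y) := by
  have hsub : ∀ s, x s ∈ convexHull ℝ (Set.range x) := fun s =>
    subset_convexHull ℝ _ ⟨s, rfl⟩
  have hRhull : ∀ z ∈ convexHull ℝ (Set.range x), ‖z‖ ≤ R := by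
    intro z hz
    have : convexHull ℝ (Set.range x) ⊆ Metric.closedBall 0 R :=
      convexHull_min (by rintro _ ⟨s, rfl⟩; simpa using hR s) (convex_closedBall 0 R)
    simpa using this hz
  refine not_reflexive_of_large_slices (convex_convexHull ℝ (Set.range x)) ⟨_, hsub []⟩ ?_
    (show 0 < ε / 8 by positivity) hRhull ?_
  · exact ((Set.countable_range x).isSeparable.span (R := ℝ)).mono
      (convexHull_min Submodule.subset_span (Submodule.span ℝ (Set.range x)).convex)
  · rintro φ α y ⟨p, hp, hpα⟩
    obtain ⟨s, hs⟩ : ∃ s, α < φ (x s) := by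
      by_contra! h
      have : convexHull ℝ (Set.range x) ⊆ {z | φ z ≤ α} :=
        convexHull_min (by rintro _ ⟨s, rfl⟩; exact h s) (convex_halfSpace_le φ.isLinear _)
      exact (this hp).not_gt hpα
    obtain ⟨b, hb, hbs⟩ : ∃ b, α < φ (x (s ++ [b])) ∧ ε / 2 ≤ ‖x (s ++ [b]) - x s‖ := by
      have h1 : φ (x s) = 2⁻¹ * (φ (x (s ++ [false])) + φ (x (s ++ [true]))) := by
        conv_lhs => rw [hmid s]
        rw [map_smul, map_add, smul_eq_mul]
      have hf : x (s ++ [false]) - x s = (2⁻¹ : ℝ) • (x (s ++ [false]) - x (s ++ [true])) := by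
        rw [hmid s]; module
      have ht : x (s ++ [true]) - x s = (-2⁻¹ : ℝ) • (x (s ++ [false]) - x (s ++ [true])) := by
        rw [hmid s]; module
      have := hsep s
      by_cases h : α < φ (x (s ++ [false]))
      · refine ⟨false, h, ?_⟩
        rw [hf, norm_smul]; norm_num; linarith
      · refine ⟨true, by linarith, ?_⟩
        rw [ht, norm_smul]; norm_num; linarith
    by_cases h : 2 * (ε / 8) ≤ ‖x s - y‖
    · exact ⟨_, hsub s, hs, h⟩
    · refine ⟨_, hsub _, hb, ?_⟩
      have := norm_sub_le_norm_sub_add_norm_sub (x (s ++ [b])) y (x s)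
      rw [norm_sub_rev y] at this
      linarith
/-- The bounded sequences in `X` converging to zero along the hyperfilter on `ℕ`. -/
def ultraNull (X : Type*) [NormedAddCommGroup X] [NormedSpace ℝ X] : Submodule ℝ (ℕ →ᵇ X) where
  carrier := {x | ∀ ε > 0, ∀ᶠ n in (hyperfilter ℕ : Filter ℕ), ‖x n‖ < ε}
  zero_mem' := fun ε hε => Eventually.of_forall fun n => by simpa using hε
  add_mem' := by
    intro x y hx hy ε hε
    filter_upwards [hx (ε / 2) (by positivity), hy (ε / 2) (by positivity)] with n h1 h2
    exact (norm_add_le _ _).trans_lt (by linarith)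
  smul_mem' := by
    intro c x hx ε hε
    filter_upwards [hx (ε / (‖c‖ + 1)) (by positivity)] with n hn
    rw [BoundedContinuousFunction.coe_smul, norm_smul]
    rw [lt_div_iff₀ (by positivity)] at hn
    nlinarith [norm_nonneg (x n), norm_nonneg c]

instance isClosed_ultraNull (X : Type*) [NormedAddCommGroup X] [NormedSpace ℝ X] :
    IsClosed (ultraNull X : Set (ℕ →ᵇ X)) := by
  refine isClosed_of_closure_subset fun x hx ε hε => ?_
  obtain ⟨y, hy, hxy⟩ := Metric.mem_closure_iff.1 hx (ε / 2) (by positivity)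
  filter_upwards [hy (ε / 2) (by positivity)] with n hn
  rw [dist_eq_norm] at hxy
  have h1 : ‖x n - y n‖ ≤ ‖x - y‖ := (x - y).norm_coe_le_norm n
  have h2 : ‖x n‖ ≤ ‖x n - y n‖ + ‖y n‖ := by simpa using norm_add_le (x n - y n) (y n)
  linarith

/-- The ultrapower of `X` along the hyperfilter on `ℕ`. -/
abbrev Ultrapower (X : Type*) [NormedAddCommGroup X] [NormedSpace ℝ X] : Type _ :=
  (ℕ →ᵇ X) ⧸ ultraNull X

/-- The norm of the class of a sequence is the limit of the norms. -/
theorem tendsto_norm_ultrapower {X : Type*} [NormedAddCommGroup X] [NormedSpace ℝ X]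
    (x : ℕ →ᵇ X) :
    Tendsto (fun n => ‖x n‖) (hyperfilter ℕ) (𝓝 ‖(ultraNull X).mkQ x‖) := by
  rw [tendsto_order]
  constructor
  · intro a ha
    by_contra h
    rw [← Ultrafilter.eventually_not] at h
    have ha0 : 0 ≤ a := by
      obtain ⟨n, hn⟩ := h.exists
      exact (norm_nonneg _).trans (not_lt.1 hn)
    let y : ℕ →ᵇ X := BoundedContinuousFunction.ofNormedAddCommGroupDiscrete
      (fun n => if ‖x n‖ ≤ a then x n else 0) a (fun n => by
        split_ifs with h
        · exact h
        · simpa using ha0)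
    have hxy : (ultraNull X).mkQ x = (ultraNull X).mkQ y := by
      rw [← sub_eq_zero, ← map_sub]
      refine (Submodule.Quotient.mk_eq_zero _).2 fun ε hε => ?_
      filter_upwards [h] with n hn
      have : y n = x n := if_pos (not_lt.1 hn)
      simpa [this] using hε
    have hy : ‖y‖ ≤ a := BoundedContinuousFunction.norm_ofNormedAddCommGroup_le _ ha0 _
    rw [hxy] at ha
    exact ((Submodule.Quotient.norm_mk_le _ y).trans hy).not_gt ha
  · intro a ha
    obtain ⟨y, hy, hya⟩ := Submodule.Quotient.norm_mk_lt ((ultraNull X).mkQ x) (sub_pos.2 ha)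
    have hxy : x - y ∈ ultraNull X :=
      (Submodule.Quotient.eq (ultraNull X)).1 hy.symm
    rw [add_sub_cancel] at hya
    filter_upwards [hxy (a - ‖y‖) (sub_pos.2 hya)] with n hn
    have h1 : ‖y n‖ ≤ ‖y‖ := y.norm_coe_le_norm n
    have h2 : ‖x n‖ ≤ ‖x n - y n‖ + ‖y n‖ := by simpa using norm_add_le (x n - y n) (y n)
    have h3 : ‖x n - y n‖ < a - ‖y‖ := hn
    linarith

/-- An almost isometric linear map on a finite-dimensional space gives an isomorphism onto a
finite-dimensional subspace with distortion close to one. -/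
theorem exists_equiv_range_of_almost_isometry {F X : Type*} [NormedAddCommGroup F]
    [NormedSpace ℝ F] [FiniteDimensional ℝ F] [NormedAddCommGroup X] [NormedSpace ℝ X]
    (S : F →ₗ[ℝ] X) {δ : ℝ} (hδ0 : 0 ≤ δ) (hδ1 : δ < 1)
    (hl : ∀ y, (1 - δ) * ‖y‖ ≤ ‖S y‖) (hu : ∀ y, ‖S y‖ ≤ (1 + δ) * ‖y‖) :
    ∃ G : Submodule ℝ X, FiniteDimensional ℝ G ∧ ∃ T : F ≃L[ℝ] G,
      ‖(T : F →L[ℝ] G)‖ * ‖(T.symm : G →L[ℝ] F)‖ ≤ (1 + δ) * (1 - δ)⁻¹ := by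
  have hδ : 0 < 1 - δ := sub_pos.2 hδ1
  have hinj : Function.Injective S := by
    rw [injective_iff_map_eq_zero]
    intro y hy
    have := hl y
    rw [hy, norm_zero] at this
    exact norm_le_zero_iff.1 (nonpos_of_mul_nonpos_right this hδ)
  let e : F ≃L[ℝ] LinearMap.range S := (LinearEquiv.ofInjective S hinj).toContinuousLinearEquiv
  have he : ∀ y, ((e y : LinearMap.range S) : X) = S y := fun y => rfl
  refine ⟨LinearMap.range S, inferInstance, e, ?_⟩
  gcongr
  · exact ContinuousLinearMap.opNorm_le_bound _ (by positivity) fun y => hu y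
  · refine ContinuousLinearMap.opNorm_le_bound _ (by positivity) fun z => ?_
    have h1 := hl (e.symm z)
    rw [← he, e.apply_symm_apply] at h1
    rw [inv_mul_eq_div, le_div_iff₀ hδ, mul_comm]
    exact h1

/-- The ultrapower of `X` is finitely representable in `X`. -/
theorem finitelyRepresentable_ultrapower (X : Type) [NormedAddCommGroup X] [NormedSpace ℝ X] :
    FinitelyRepresentable (Ultrapower X) X := by
  intro ε hε F hF
  obtain ⟨σ, hσ⟩ := (ultraNull X).mkQ.exists_rightInverse_of_surjective
    (LinearMap.range_eq_top.2 (Submodule.mkQ_surjective _))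
  let L : F →L[ℝ] (ℕ →ᵇ X) := LinearMap.toContinuousLinearMap (σ ∘ₗ F.subtype)
  have hL : ∀ y : F, (ultraNull X).mkQ (L y) = y := fun y =>
    LinearMap.congr_fun hσ (y : Ultrapower X)
  have hLn : ∀ (y : F) n, ‖L y n‖ ≤ ‖L‖ * ‖y‖ := fun y n =>
    ((L y).norm_coe_le_norm n).trans (L.le_opNorm y)
  have hlim : ∀ y : F, Tendsto (fun n => ‖L y n‖) (hyperfilter ℕ) (𝓝 ‖y‖) := fun y => by
    have := tendsto_norm_ultrapower (L y)
    rwa [hL] at this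
  set δ : ℝ := ε / (ε + 2) with hδ
  have hδ0 : 0 < δ := by positivity
  have hδ1 : δ < 1 := by rw [hδ, div_lt_one (by positivity)]; linarith
  set ρ : ℝ := δ / (2 * (‖L‖ + 1)) with hρ
  have hρ0 : 0 < ρ := by positivity
  have hρL : (‖L‖ + 1) * ρ = δ / 2 := by rw [hρ]; field_simp
  obtain ⟨t, ht, htf, hcov⟩ := (isCompact_sphere (0 : F) 1).finite_cover_balls hρ0
  have hev : ∀ᶠ n in (hyperfilter ℕ : Filter ℕ), ∀ y ∈ t, |‖L y n‖ - ‖y‖| < δ / 2 := by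
    rw [eventually_all_finite htf]
    intro y _
    have := (hlim y).eventually (Metric.ball_mem_nhds _ (half_pos hδ0))
    simpa [Real.dist_eq] using this
  obtain ⟨n, hn⟩ := hev.exists
  let S : F →ₗ[ℝ] X :=
    { toFun := fun y => L y n
      map_add' := by simp
      map_smul' := by simp }
  have hsphere : ∀ y : F, ‖y‖ = 1 → |‖S y‖ - 1| ≤ δ := by
    intro y hy
    obtain ⟨z, hz, hyz⟩ := Set.mem_iUnion₂.1 (hcov (by simpa using hy))
    rw [mem_ball_iff_norm] at hyz
    have hz1 : ‖z‖ = 1 := by simpa using ht hz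
    have h1 := hn z hz
    rw [hz1] at h1
    have h2 : |‖S y‖ - ‖S z‖| ≤ ‖L‖ * ρ := by
      refine (abs_norm_sub_norm_le _ _).trans ?_
      rw [← map_sub]
      exact (hLn _ n).trans (by gcongr)
    have h3 : |‖S z‖ - 1| < δ / 2 := h1
    have h4 := abs_sub_le ‖S y‖ ‖S z‖ 1
    nlinarith
  have hall : ∀ y : F, |‖S y‖ - ‖y‖| ≤ δ * ‖y‖ := by
    intro y
    rcases eq_or_ne y 0 with rfl | hy
    · simp
    · have hy' : 0 < ‖y‖ := norm_pos_iff.2 hy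
      have h := hsphere (‖y‖⁻¹ • y) (by
        rw [norm_smul, norm_inv, norm_norm, inv_mul_cancel₀ hy'.ne'])
      rw [map_smul, norm_smul, norm_inv, norm_norm] at h
      have h5 : ‖S y‖ - ‖y‖ = (‖y‖⁻¹ * ‖S y‖ - 1) * ‖y‖ := by field_simp
      rw [h5, abs_mul, abs_of_pos hy']
      gcongr
  obtain ⟨G, hG, T, hT⟩ := exists_equiv_range_of_almost_isometry S hδ0.le hδ1
    (fun y => by have := (abs_le.1 (hall y)).1; linarith)
    (fun y => by have := (abs_le.1 (hall y)).2; linarith)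
  refine ⟨G, hG, T, hT.trans ?_⟩
  rw [← div_eq_mul_inv, div_le_iff₀ (sub_pos.2 hδ1)]
  have : δ * (ε + 2) = ε := by rw [hδ]; field_simp
  nlinarith

theorem lcp_append (s a b : List Bool) : lcp (s ++ a) (s ++ b) = s.length + lcp a b := by
  induction s with
  | nil => simp
  | cons c s ih => simp [lcp, ih]; ring

theorem treeDist_append (s a b : List Bool) : treeDist (s ++ a) (s ++ b) = treeDist a b := by
  simp only [treeDist, lcp_append, List.length_append]
  push_cast
  ring

theorem treeDist_append_self (s a : List Bool) : treeDist (s ++ a) s = a.length := by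
  have := treeDist_append s a []
  rw [List.append_nil] at this
  rw [this]
  cases a <;> simp [treeDist, lcp]

/-- The binary tree of vectors with root `x` and the two given subtrees. -/
def joinTrees {X : Type*} (x : X) (u v : List Bool → X) : List Bool → X
  | [] => x
  | false :: q => u q
  | true :: q => v q

/-- A bilipschitz copy of the infinite binary tree yields separated bounded dyadic martingales of
every finite length. -/
theorem exists_dyadic_tree_of_embedding {X : Type*} [NormedAddCommGroup X] [NormedSpace ℝ X]
    {r R : ℝ} (f : List Bool → X) (hl : ∀ s t, r * treeDist s t ≤ ‖f s - f t‖)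
    (hu : ∀ s t, ‖f s - f t‖ ≤ R * treeDist s t) (j : ℕ) :
    ∀ (s : List Bool) (b : Bool), ∃ p : List Bool, p.length + 1 = 2 ^ j ∧
      ∃ g : List Bool → X, g [] = ((2 : ℝ) ^ j)⁻¹ • (f (s ++ b :: p) - f s) ∧
        (∀ q, ‖g q‖ ≤ R) ∧
        ∀ q : List Bool, q.length < j →
          g q = (2⁻¹ : ℝ) • (g (q ++ [false]) + g (q ++ [true])) ∧
          r ≤ ‖g (q ++ [false]) - g (q ++ [true])‖ := by
  induction j with
  | zero =>
    intro s b
    refine ⟨[], by simp, fun _ => f (s ++ [b]) - f s, by simp, fun _ => ?_, by simp⟩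
    have := hu (s ++ [b]) s
    simpa [treeDist_append_self] using this
  | succ j ih =>
    intro s b
    obtain ⟨p, hp, g, hg0, hgR, hg⟩ := ih s b
    set t := s ++ b :: p with ht
    have hpow : (0 : ℝ) < 2 ^ j := by positivity
    obtain ⟨i, p', hp', g', hg0', hgR', hg', hsep⟩ : ∃ (i : Bool) (p' : List Bool),
        p'.length + 1 = 2 ^ j ∧ ∃ g' : List Bool → X,
          g' [] = ((2 : ℝ) ^ j)⁻¹ • (f (t ++ i :: p') - f t) ∧ (∀ q, ‖g' q‖ ≤ R) ∧
          (∀ q : List Bool, q.length < j →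
            g' q = (2⁻¹ : ℝ) • (g' (q ++ [false]) + g' (q ++ [true])) ∧
            r ≤ ‖g' (q ++ [false]) - g' (q ++ [true])‖) ∧ r ≤ ‖g [] - g' []‖ := by
      obtain ⟨p₀, hp₀, g₀, hg₀, hR₀, hgg₀⟩ := ih t false
      obtain ⟨p₁, hp₁, g₁, hg₁, hR₁, hgg₁⟩ := ih t true
      have hdist : treeDist (t ++ false :: p₀) (t ++ true :: p₁) = 2 * 2 ^ j := by
        rw [treeDist_append]
        have h0 : (p₀.length : ℝ) + 1 = 2 ^ j := by exact_mod_cast hp₀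
        have h1 : (p₁.length : ℝ) + 1 = 2 ^ j := by exact_mod_cast hp₁
        simp only [treeDist, lcp, List.length_cons]
        push_cast
        simp
        linarith
      have h01 : 2 * r ≤ ‖g₀ [] - g₁ []‖ := by
        have := hl (t ++ false :: p₀) (t ++ true :: p₁)
        rw [hdist] at this
        rw [hg₀, hg₁, ← smul_sub, sub_sub_sub_cancel_right, norm_smul, norm_inv,
          Real.norm_of_nonneg hpow.le, inv_mul_eq_div, le_div_iff₀ hpow]
        linarith
      by_cases h : r ≤ ‖g [] - g₀ []‖
      · exact ⟨false, p₀, hp₀, g₀, hg₀, hR₀, hgg₀, h⟩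
      · refine ⟨true, p₁, hp₁, g₁, hg₁, hR₁, hgg₁, ?_⟩
        have := norm_sub_le_norm_sub_add_norm_sub (g₀ []) (g []) (g₁ [])
        rw [norm_sub_rev (g₀ []) (g [])] at this
        linarith
    have hlen : (p ++ i :: p').length + 1 = 2 ^ (j + 1) := by
      rw [List.length_append, List.length_cons, pow_succ]
      omega
    have hroot : ((2 : ℝ) ^ (j + 1))⁻¹ • (f (s ++ b :: (p ++ i :: p')) - f s) =
        (2⁻¹ : ℝ) • (g [] + g' []) := by
      have : s ++ b :: (p ++ i :: p') = t ++ i :: p' := by simp [ht]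
      rw [this, hg0, hg0', ← smul_add, smul_smul, pow_succ, mul_inv_rev]
      congr 1
      abel
    refine ⟨p ++ i :: p', hlen, joinTrees ((2⁻¹ : ℝ) • (g [] + g' [])) g g', hroot.symm, ?_, ?_⟩
    · rintro (_ | ⟨_ | _, q⟩)
      · have h1 : ‖g [] + g' []‖ ≤ R + R := norm_add_le_of_le (hgR _) (hgR' _)
        simp only [joinTrees, norm_smul]
        norm_num
        linarith
      · exact hgR q
      · exact hgR' q
    · rintro (_ | ⟨_ | _, q⟩) hq
      · exact ⟨rfl, hsep⟩
      · exact hg q (by simpa using hq)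
      · exact hg' q (by simpa using hq)

/-- A space into which the infinite binary tree embeds is not superreflexive. -/
theorem not_superReflexive_of_embedding {X : Type} [NormedAddCommGroup X] [NormedSpace ℝ X]
    [CompleteSpace X] {r R : ℝ} (hr : 0 < r) (f : List Bool → X)
    (hl : ∀ s t, r * treeDist s t ≤ ‖f s - f t‖)
    (hu : ∀ s t, ‖f s - f t‖ ≤ R * treeDist s t) : ¬ SuperReflexive X := by
  intro hX
  have htree := fun j => exists_dyadic_tree_of_embedding f hl hu j [] false
  choose p _ g _ hgR hg using htree
  let x : List Bool → (ℕ →ᵇ X) := fun s =>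
    BoundedContinuousFunction.ofNormedAddCommGroupDiscrete (fun n => g n s) R fun n => hgR n s
  have hx : ∀ s n, x s n = g n s := fun s n => rfl
  have hev : ∀ k : ℕ, ∀ᶠ n in (hyperfilter ℕ : Filter ℕ), k < n := fun k =>
    Eventually.filter_mono Nat.hyperfilter_le_atTop (eventually_gt_atTop k)
  have hmk : ∀ y : ℕ →ᵇ X, ∀ c : ℝ, (∀ᶠ n in (hyperfilter ℕ : Filter ℕ), c ≤ ‖y n‖) →
      c ≤ ‖(ultraNull X).mkQ y‖ := fun y c h => ge_of_tendsto (tendsto_norm_ultrapower y) h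
  refine not_reflexive_of_dyadic_tree (fun s => (ultraNull X).mkQ (x s)) (R := R) hr ?_ ?_ ?_
    (hX (Ultrapower X) (finitelyRepresentable_ultrapower X))
  · intro s
    exact le_of_tendsto (tendsto_norm_ultrapower (x s)) (Eventually.of_forall fun n => hgR n s)
  · intro s
    rw [← map_add, ← map_smul, ← sub_eq_zero, ← map_sub]
    refine (Submodule.Quotient.mk_eq_zero _).2 fun ε hε => ?_
    filter_upwards [hev s.length] with n hn
    have : (x s - (2⁻¹ : ℝ) • (x (s ++ [false]) + x (s ++ [true]))) n = 0 := by
      simp only [BoundedContinuousFunction.coe_sub, BoundedContinuousFunction.coe_smul,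
        BoundedContinuousFunction.coe_add, Pi.sub_apply, Pi.add_apply, hx]
      rw [sub_eq_zero]
      exact (hg n s hn).1
    rw [this, norm_zero]
    exact hε
  · intro s
    rw [← map_sub]
    refine hmk _ _ ?_
    filter_upwards [hev s.length] with n hn
    exact (hg n s hn).2

theorem finiteDimensional_quotient_ker {E ι : Type*} [Finite ι] [NormedAddCommGroup E]
    [NormedSpace ℝ E] (f : E →L[ℝ] (ι → ℝ)) :
    FiniteDimensional ℝ (E ⧸ LinearMap.ker f.toLinearMap) :=
  (LinearMap.quotKerEquivRange f.toLinearMap).symm.finiteDimensional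

/-- Helly's lemma: finitely many values of an element of the double dual are attained at a vector
of nearly the same norm. -/
theorem exists_eq_doubleDual {E ι : Type*} [Finite ι] [NormedAddCommGroup E] [NormedSpace ℝ E]
    (G : StrongDual ℝ (StrongDual ℝ E)) (f : ι → StrongDual ℝ E) {ε : ℝ} (hε : 0 < ε) :
    ∃ e : E, ‖e‖ ≤ ‖G‖ + ε ∧ ∀ i, f i e = G (f i) := by
  set N := LinearMap.ker (ContinuousLinearMap.pi f).toLinearMap with hN
  have : IsClosed (N : Set E) := (ContinuousLinearMap.pi f).isClosed_ker
  have : FiniteDimensional ℝ (E ⧸ N) := finiteDimensional_quotient_ker _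
  let q : E →L[ℝ] E ⧸ N := N.mkQ.mkContinuous 1 fun e => by
    simpa using Submodule.Quotient.norm_mk_le N e
  have hq : ‖q‖ ≤ 1 := LinearMap.mkContinuous_norm_le _ zero_le_one _
  let G' : Module.Dual ℝ (Module.Dual ℝ (E ⧸ N)) :=
    { toFun := fun g => G ((LinearMap.toContinuousLinearMap g).comp q)
      map_add' := fun g h => by
        rw [map_add, ContinuousLinearMap.add_comp, map_add]
      map_smul' := fun c g => by
        rw [map_smul, ContinuousLinearMap.smul_comp, map_smul, RingHom.id_apply] }
  obtain ⟨v, hv⟩ := (Module.evalEquiv ℝ (E ⧸ N)).surjective G'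
  have hv' : ∀ g : StrongDual ℝ (E ⧸ N), g v = G (g.comp q) := fun g =>
    LinearMap.congr_fun hv g.toLinearMap
  have hvn : ‖v‖ ≤ ‖G‖ := by
    obtain ⟨g, hg, hgv⟩ := exists_dual_vector'' ℝ v
    have h1 : ‖v‖ = G (g.comp q) := by rw [← hv', hgv]; rfl
    rw [h1]
    calc G (g.comp q) ≤ ‖G‖ * ‖g.comp q‖ := (le_abs_self _).trans (G.le_opNorm _)
      _ ≤ ‖G‖ * (1 * 1) := by
        gcongr
        exact (ContinuousLinearMap.opNorm_comp_le _ _).trans (by gcongr)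
      _ = ‖G‖ := by ring
  obtain ⟨e, he, hev⟩ := Submodule.Quotient.norm_mk_lt v hε
  refine ⟨e, by linarith, fun i => ?_⟩
  have hker : N ≤ LinearMap.ker (f i).toLinearMap := fun x hx => congr_fun hx i
  have hfi : (LinearMap.toContinuousLinearMap (N.liftQ (f i).toLinearMap hker)).comp q = f i := by
    ext x
    rfl
  rw [← hfi, ← hv', hfi, ← he]
  rfl

theorem exists_dual_eq_one_of_notMem {E : Type*} [NormedAddCommGroup E] [NormedSpace ℝ E]
    (M : Submodule ℝ E) (hM : IsClosed (M : Set E)) {x : E} (hx : x ∉ M) :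
    ∃ g : StrongDual ℝ E, g x = 1 ∧ ∀ y ∈ M, g y = 0 := by
  have hne : M.mkQL x ≠ 0 := fun h0 => hx ((Submodule.Quotient.mk_eq_zero M).1 h0)
  obtain ⟨g, hg⟩ := SeparatingDual.exists_eq_one (R := ℝ) hne
  refine ⟨g.comp M.mkQL, hg, fun y hy => ?_⟩
  have : M.mkQL y = 0 := (Submodule.Quotient.mk_eq_zero M).2 hy
  rw [ContinuousLinearMap.comp_apply, this, map_zero]

/-- A dual vector outside a closed subspace `M` is separated from any finite part of `M` by vectors
of bounded norm. -/
theorem exists_forall_eq_one_of_notMem {E : Type*} [NormedAddCommGroup E] [NormedSpace ℝ E]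
    (M : Submodule ℝ (StrongDual ℝ E)) (hM : IsClosed (M : Set (StrongDual ℝ E)))
    {F : StrongDual ℝ E} (hF : F ∉ M) :
    ∃ c : ℝ, ∀ {n : ℕ} (f : Fin n → StrongDual ℝ E), (∀ i, f i ∈ M) →
      ∃ e : E, ‖e‖ ≤ c ∧ F e = 1 ∧ ∀ i, f i e = 0 := by
  obtain ⟨g, hgF, hgM⟩ := exists_dual_eq_one_of_notMem M hM hF
  refine ⟨‖g‖ + 1, fun {n} f hf => ?_⟩
  obtain ⟨e, he, hev⟩ := exists_eq_doubleDual g (fun o : Option (Fin n) => o.elim F f) one_pos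
  exact ⟨e, he, (hev none).trans hgF, fun i => (hev (some i)).trans (hgM _ (hf i))⟩

/-- Vectors and functionals, bounded by `B`, whose first `n` mutual values form, up to `δ`, the
triangular matrix of ones. -/
def AlmostTriangular {X : Type*} [NormedAddCommGroup X] [NormedSpace ℝ X] (B δ : ℝ) (n : ℕ)
    (y : ℕ → X) (φ : ℕ → StrongDual ℝ X) : Prop :=
  (∀ i, ‖y i‖ ≤ B) ∧ (∀ m, ‖φ m‖ ≤ B) ∧
    ∀ i < n, ∀ m < n, |φ m (y i) - if m ≤ i then 1 else 0| ≤ δ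

/-- James: nonreflexive spaces contain arbitrarily long triangular systems. -/
theorem exists_almostTriangular_of_not_reflexive {Z : Type*} [NormedAddCommGroup Z]
    [NormedSpace ℝ Z] [CompleteSpace Z]
    (hZ : ¬ Function.Surjective (NormedSpace.inclusionInDoubleDual ℝ Z)) :
    ∃ B : ℝ, ∀ n, ∃ (z : ℕ → Z) (φ : ℕ → StrongDual ℝ Z), AlmostTriangular B 0 n z φ := by
  simp only [Function.Surjective, not_forall] at hZ
  obtain ⟨F, hF⟩ := hZ
  set J := NormedSpace.inclusionInDoubleDual ℝ Z with hJ
  have hclosed :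
      IsClosed (LinearMap.range J.toLinearMap : Set (StrongDual ℝ (StrongDual ℝ Z))) := by
    have h := (NormedSpace.inclusionInDoubleDualLi (E := Z) ℝ).isometry.isUniformInducing
    exact h.isComplete_range.isClosed
  obtain ⟨c, hc⟩ := exists_forall_eq_one_of_notMem _ hclosed hF
  set B := max (‖F‖ + 1) c with hB
  have hB0 : 0 ≤ B := (by positivity : (0 : ℝ) ≤ ‖F‖ + 1).trans (le_max_left _ _)
  refine ⟨B, fun n => ?_⟩
  suffices h : ∃ (z : ℕ → Z) (φ : ℕ → StrongDual ℝ Z), (∀ i, ‖z i‖ ≤ B) ∧ (∀ m, ‖φ m‖ ≤ B) ∧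
      (∀ m < n, F (φ m) = 1) ∧ ∀ i < n, ∀ m < n, φ m (z i) = if m ≤ i then 1 else 0 by
    obtain ⟨z, φ, h1, h2, -, h3⟩ := h
    exact ⟨z, φ, h1, h2, fun i hi m hm => by rw [h3 i hi m hm]; simp⟩
  induction n with
  | zero => exact ⟨0, 0, by simpa using hB0, by simpa using hB0, by simp, by simp⟩
  | succ n ih =>
    obtain ⟨z, φ, hz, hφ, hF1, hzφ⟩ := ih
    obtain ⟨ψ, hψ, hψF, hψv⟩ := hc (fun i : Fin n => J (z i)) fun i => ⟨z i, rfl⟩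
    have hψz : ∀ i < n, ψ (z i) = 0 := fun i hi => hψv ⟨i, hi⟩
    obtain ⟨u, hu, huv⟩ := exists_eq_doubleDual F
      (fun o : Option (Fin n) => o.elim ψ fun i => φ i) one_pos
    have huψ : ψ u = 1 := by rw [← hψF]; exact huv none
    have huφ : ∀ m < n, φ m u = 1 := fun m hm => (huv (some ⟨m, hm⟩)).trans (hF1 m hm)
    refine ⟨Function.update z n u, Function.update φ n ψ, fun i => ?_, fun m => ?_, fun m hm => ?_,
      fun i hi m hm => ?_⟩
    · rcases eq_or_ne i n with h | h
      · rw [h, Function.update_self]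
        exact hu.trans (le_max_left _ _)
      · simpa [h] using hz i
    · rcases eq_or_ne m n with h | h
      · rw [h, Function.update_self]
        exact hψ.trans (le_max_right _ _)
      · simpa [h] using hφ m
    · rcases eq_or_ne m n with h | h
      · simpa [h] using hψF
      · simpa [h] using hF1 m (by omega)
    · rcases eq_or_ne m n with h | h <;> rcases eq_or_ne i n with h' | h'
      · simpa [h, h'] using huψ
      · simp [h, h', hψz i (by omega), show ¬ n ≤ i by omega]
      · simp [h, h', huφ m (by omega), show m ≤ n by omega]
      · simpa [h, h'] using hzφ i (by omega) m (by omega)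

/-- Triangular systems pass to spaces in which the given one is finitely representable. -/
theorem exists_almostTriangular_of_finitelyRepresentable {Z X : Type} [NormedAddCommGroup Z]
    [NormedSpace ℝ Z] [NormedAddCommGroup X] [NormedSpace ℝ X] (h : FinitelyRepresentable Z X)
    {B : ℝ} {n : ℕ} {z : ℕ → Z} {φ : ℕ → StrongDual ℝ Z} (hz : AlmostTriangular B 0 n z φ) :
    ∃ (y : ℕ → X) (ψ : ℕ → StrongDual ℝ X), AlmostTriangular (2 * B) 0 n y ψ := by
  obtain ⟨hzB, hφB, hval⟩ := hz
  have hB : 0 ≤ B := (norm_nonneg _).trans (hzB 0)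
  rcases Nat.eq_zero_or_pos n with rfl | hn
  · exact ⟨0, 0, by simpa using hB, by simpa using hB, by simp⟩
  let F := Submodule.span ℝ (z '' Set.Iio n)
  have hF : FiniteDimensional ℝ F := FiniteDimensional.span_of_finite ℝ ((Set.finite_Iio n).image z)
  have hzF : ∀ i < n, z i ∈ F := fun i hi => Submodule.subset_span ⟨i, hi, rfl⟩
  obtain ⟨G, hG, T, hT⟩ := h 1 one_pos F hF
  set τ := ‖(T.symm : G →L[ℝ] F)‖ with hτ
  have hτ0 : 0 < τ := by
    refine (norm_nonneg (T.symm : G →L[ℝ] F)).lt_of_ne fun h0 => ?_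
    have h1 : (T.symm : G →L[ℝ] F) = 0 :=
      (norm_eq_zero (a := (T.symm : G →L[ℝ] F))).1 h0.symm
    have h2 : (⟨z 0, hzF 0 hn⟩ : F) = 0 := by
      rw [← T.symm_apply_apply ⟨z 0, hzF 0 hn⟩]
      exact DFunLike.congr_fun h1 _
    have h3 : z 0 = 0 := congrArg Subtype.val h2
    have := hval 0 hn 0 hn
    rw [h3] at this
    norm_num at this
  have hext : ∀ m, ∃ g : StrongDual ℝ X, (∀ x : G, g x = φ m (T.symm x : F)) ∧ ‖g‖ ≤ B * τ := by
    intro m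
    obtain ⟨g, hg, hgn⟩ := exists_extension_norm_eq G
      (((φ m).comp F.subtypeL).comp (T.symm : G →L[ℝ] F))
    refine ⟨g, hg, hgn.le.trans (ContinuousLinearMap.opNorm_le_bound _ (by positivity) fun x => ?_)⟩
    calc ‖φ m (T.symm x : F)‖ ≤ ‖φ m‖ * ‖(T.symm x : F)‖ := (φ m).le_opNorm _
      _ ≤ B * (τ * ‖x‖) := by
        gcongr
        · exact hφB m
        · exact (T.symm : G →L[ℝ] F).le_opNorm x
      _ = B * τ * ‖x‖ := by ring
  choose g hg hgn using hext
  refine ⟨fun i => if h : i < n then τ • (T ⟨z i, hzF i h⟩ : X) else 0, fun m => τ⁻¹ • g m,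
    fun i => ?_, fun m => ?_, fun i hi m hm => ?_⟩
  · dsimp only
    split_ifs with h
    · have h1 : ‖T ⟨z i, hzF i h⟩‖ ≤ ‖(T : F →L[ℝ] G)‖ * B :=
        ((T : F →L[ℝ] G).le_opNorm _).trans (by gcongr; exact hzB i)
      have h2 : ‖(T ⟨z i, hzF i h⟩ : X)‖ = ‖T ⟨z i, hzF i h⟩‖ := rfl
      rw [norm_smul, Real.norm_of_nonneg hτ0.le, h2]
      calc τ * ‖T ⟨z i, hzF i h⟩‖ ≤ τ * (‖(T : F →L[ℝ] G)‖ * B) := by gcongr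
        _ = ‖(T : F →L[ℝ] G)‖ * τ * B := by ring
        _ ≤ 2 * B := by gcongr; linarith
    · simpa using hB
  · rw [norm_smul, norm_inv, Real.norm_of_nonneg hτ0.le, inv_mul_eq_div, div_le_iff₀ hτ0]
    have := hgn m
    nlinarith [mul_nonneg hB hτ0.le]
  · have : (τ⁻¹ • g m) (τ • (T ⟨z i, hzF i hi⟩ : X)) = φ m (z i) := by
      rw [map_smul, smul_apply, hg, T.symm_apply_apply, smul_smul,
        mul_inv_cancel₀ hτ0.ne', one_smul]
    simp only [hi, dif_pos, this]
    exact hval i hi m hm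

/-- Long triangular systems have long almost triangular subsystems of differences in every
subspace of finite codimension. -/
theorem exists_almostTriangular_of_annihilating {X : Type*} [NormedAddCommGroup X] [NormedSpace ℝ X]
    {B δ : ℝ} (h : ∀ n, ∃ (z : ℕ → X) (φ : ℕ → StrongDual ℝ X), AlmostTriangular B 0 n z φ)
    (hδ : 0 < δ) (Ψ : Finset (StrongDual ℝ X)) (n : ℕ) :
    ∃ (y : ℕ → X) (φ : ℕ → StrongDual ℝ X), AlmostTriangular (2 * B + 1) δ n y φ ∧
      ∀ i, ∀ ψ ∈ Ψ, ψ (y i) = 0 := by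
  have hB : 0 ≤ B := by
    obtain ⟨z, φ, hz, -⟩ := h 0
    exact (norm_nonneg _).trans (hz 0)
  set f : X →L[ℝ] (Ψ → ℝ) := ContinuousLinearMap.pi fun ψ : Ψ => (ψ : StrongDual ℝ X) with hf
  set N := LinearMap.ker f.toLinearMap with hN
  have : IsClosed (N : Set X) := f.isClosed_ker
  have : FiniteDimensional ℝ (X ⧸ N) := finiteDimensional_quotient_ker f
  set η : ℝ := min 1 (δ / (B + 1)) with hη
  have hη0 : 0 < η := lt_min one_pos (by positivity)
  have hηB : B * η ≤ δ := by
    have : η * (B + 1) ≤ δ := (le_div_iff₀ (by positivity)).1 (min_le_right _ _)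
    nlinarith
  have : ProperSpace (X ⧸ N) := FiniteDimensional.proper ℝ _
  obtain ⟨t, -, htf, hcov⟩ :=
    (isCompact_closedBall (0 : X ⧸ N) B).finite_cover_balls (half_pos hη0)
  obtain ⟨z, φ, hzB, hφB, hval⟩ := h (htf.toFinset.card * n + 1)
  set M := htf.toFinset.card * n + 1 with hM
  have hcen : ∀ i, ∃ c ∈ t, ‖N.mkQ (z i) - c‖ < η / 2 := by
    intro i
    have : N.mkQ (z i) ∈ Metric.closedBall (0 : X ⧸ N) B := by
      rw [mem_closedBall_zero_iff]
      exact (Submodule.Quotient.norm_mk_le N (z i)).trans (hzB i)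
    obtain ⟨c, hc, hc'⟩ := Set.mem_iUnion₂.1 (hcov this)
    exact ⟨c, hc, mem_ball_iff_norm.1 hc'⟩
  choose c hct hcz using hcen
  classical
  obtain ⟨c₀, -, hcard⟩ := Finset.exists_lt_card_fiber_of_mul_lt_card_of_maps_to
    (s := Finset.range M) (t := htf.toFinset) (f := c) (n := n)
    (fun i _ => htf.mem_toFinset.2 (hct i)) (by rw [Finset.card_range]; omega)
  obtain ⟨S, hS, hScard⟩ := Finset.exists_subset_card_eq (Nat.succ_le_of_lt hcard)
  let σ := S.orderEmbOfFin hScard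
  have hσ : ∀ k, σ k < M ∧ c (σ k) = c₀ := fun k => by
    simpa using hS (S.orderEmbOfFin_mem hScard k)
  have hexists : ∀ k, ∃ v : X, (∀ ψ ∈ Ψ, ψ v = 0) ∧ ‖v‖ ≤ 2 * B + 1 ∧
      (k < n → ∀ m : Fin n, |φ (σ m.succ) v - if (m : ℕ) ≤ k then 1 else 0| ≤ δ) := by
    intro k
    by_cases hk : k < n
    swap
    · exact ⟨0, by simp, by simp; positivity, fun h => absurd h hk⟩
    set i := σ (Fin.succ ⟨k, hk⟩) with hi
    have hclose : ‖N.mkQ (z i - z (σ 0))‖ < η := by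
      have h1 := hcz i
      have h2 := hcz (σ 0)
      rw [(hσ _).2] at h1 h2
      rw [map_sub]
      have := norm_sub_le_norm_sub_add_norm_sub (N.mkQ (z i)) c₀ (N.mkQ (z (σ 0)))
      rw [norm_sub_rev c₀] at this
      linarith
    obtain ⟨x, hx, hxn⟩ := Submodule.Quotient.norm_mk_lt (N.mkQ (z i - z (σ 0)))
      (sub_pos.2 hclose)
    rw [add_sub_cancel] at hxn
    refine ⟨z i - z (σ 0) - x, fun ψ hψ => ?_, ?_, fun _ m => ?_⟩
    · have : z i - z (σ 0) - x ∈ N := (Submodule.Quotient.eq N).1 hx.symm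
      exact congr_fun this ⟨ψ, hψ⟩
    · have h1 := norm_sub_le (z i - z (σ 0)) x
      have h2 := norm_sub_le (z i) (z (σ 0))
      have h3 : η ≤ 1 := min_le_left _ _
      linarith [hzB i, hzB (σ 0)]
    · have h1 := hval i (hσ _).1 (σ m.succ) (hσ _).1
      have h2 := hval (σ 0) (hσ _).1 (σ m.succ) (hσ _).1
      rw [abs_nonpos_iff, sub_eq_zero] at h1 h2
      have h3 : ¬ σ m.succ ≤ σ 0 := by
        rw [σ.le_iff_le]
        exact not_le.2 (Fin.succ_pos m)
      have h4 : σ m.succ ≤ i ↔ (m : ℕ) ≤ k := by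
        rw [hi, σ.le_iff_le, Fin.succ_le_succ_iff]
        rfl
      rw [if_neg h3] at h2
      simp only [h4] at h1
      rw [map_sub, map_sub, h1, h2, sub_zero, sub_sub_cancel_left, abs_neg]
      calc |φ (σ m.succ) x| ≤ ‖φ (σ m.succ)‖ * ‖x‖ := (φ (σ m.succ)).le_opNorm x
        _ ≤ B * η := by gcongr; exact hφB _
        _ ≤ δ := hηB
  choose y hyΨ hyB hy using hexists
  refine ⟨y, fun m => if hm : m < n then φ (σ (Fin.succ ⟨m, hm⟩)) else 0, ⟨hyB, fun m => ?_,
    fun i hi m hm => ?_⟩, hyΨ⟩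
  · dsimp only
    split_ifs with hm
    · exact (hφB _).trans (by linarith)
    · rw [norm_zero]
      positivity
  · simpa [hm] using hy i hi ⟨m, hm⟩

/-- Mazur's lemma: the vectors annihilated by suitable finitely many functionals are almost
orthogonal to a given finite-dimensional subspace. -/
theorem exists_finset_annihilator_norm_le {X : Type*} [NormedAddCommGroup X] [NormedSpace ℝ X]
    (E : Submodule ℝ X) [FiniteDimensional ℝ E] :
    ∃ Ψ : Finset (StrongDual ℝ X), ∀ e ∈ E, ∀ v, (∀ ψ ∈ Ψ, ψ v = 0) → ‖e‖ ≤ 2 * ‖e + v‖ := by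
  have : ProperSpace E := FiniteDimensional.proper ℝ _
  choose g hg1 hg using fun e : X => exists_dual_vector'' ℝ e
  obtain ⟨t, ht, hcov⟩ := (isCompact_sphere (0 : E) 1).elim_nhds_subcover
    (fun e => {e' : E | 1 / 2 < g e e'}) (fun e he => by
      refine (isOpen_lt continuous_const (by fun_prop)).mem_nhds ?_
      have h1 : ‖(e : X)‖ = 1 := by simpa using he
      have h2 := hg (e : X)
      rw [h1] at h2
      simp only [Set.mem_ofPred_eq, h2]
      norm_num)
  classical
  refine ⟨t.image fun e : E => g (e : X), fun e he v hv => ?_⟩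
  rcases eq_or_ne e 0 with rfl | hne
  · simp
  have hpos : 0 < ‖e‖ := norm_pos_iff.2 hne
  have hmem : ‖e‖⁻¹ • (⟨e, he⟩ : E) ∈ Metric.sphere (0 : E) 1 := by
    have : ‖(⟨e, he⟩ : E)‖ = ‖e‖ := rfl
    rw [mem_sphere_zero_iff_norm, norm_smul, norm_inv, norm_norm, this, inv_mul_cancel₀ hpos.ne']
  obtain ⟨a, ha, hae⟩ := Set.mem_iUnion₂.1 (hcov hmem)
  have h1 : 1 / 2 < ‖e‖⁻¹ * g a e := by simpa using hae
  rw [inv_mul_eq_div, lt_div_iff₀ hpos] at h1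
  have h2 : g a (e + v) = g a e := by
    rw [map_add, hv _ (Finset.mem_image_of_mem _ ha), add_zero]
  have h3 : g a (e + v) ≤ ‖e + v‖ :=
    (le_abs_self _).trans (((g a).le_opNorm _).trans
      (mul_le_of_le_one_left (norm_nonneg _) (hg1 a)))
  linarith

/-- Triangular systems of prescribed lengths can be arranged so that the partial sums of vectors
from their successive spans are controlled by the total sum. -/
theorem exists_almostTriangular_blocks {X : Type*} [NormedAddCommGroup X] [NormedSpace ℝ X]
    {B δ : ℝ} (h : ∀ n, ∃ (z : ℕ → X) (φ : ℕ → StrongDual ℝ X), AlmostTriangular B 0 n z φ)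
    (hδ : 0 < δ) (N : ℕ → ℕ) :
    ∃ (y : ℕ → ℕ → X) (φ : ℕ → ℕ → StrongDual ℝ X),
      (∀ k, AlmostTriangular (2 * B + 1) δ (N k) (y k) (φ k)) ∧
      ∀ w : ℕ → X, (∀ k, w k ∈ Submodule.span ℝ (y k '' Set.Iio (N k))) →
        ∀ K, ∀ k < K, ‖w k‖ ≤ 4 * ‖∑ j ∈ Finset.range K, w j‖ := by
  classical
  let State := {p : Submodule ℝ X × Finset (StrongDual ℝ X) // FiniteDimensional ℝ p.1 ∧
    ∀ e ∈ p.1, ∀ v, (∀ ψ ∈ p.2, ψ v = 0) → ‖e‖ ≤ 2 * ‖e + v‖}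
  have hstep : ∀ (k : ℕ) (s : State), ∃ (y : ℕ → X) (φ : ℕ → StrongDual ℝ X) (s' : State),
      AlmostTriangular (2 * B + 1) δ (N k) y φ ∧ (∀ i, ∀ ψ ∈ s.1.2, ψ (y i) = 0) ∧
      s.1.1 ≤ s'.1.1 ∧ s.1.2 ⊆ s'.1.2 ∧ Submodule.span ℝ (y '' Set.Iio (N k)) ≤ s'.1.1 := by
    rintro k ⟨⟨E, Ψ⟩, hE, -⟩
    obtain ⟨y, φ, hy, hyΨ⟩ := exists_almostTriangular_of_annihilating h hδ Ψ (N k)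
    have hE₀ : FiniteDimensional ℝ E := hE
    have hE₁ : FiniteDimensional ℝ (Submodule.span ℝ (y '' Set.Iio (N k))) :=
      FiniteDimensional.span_of_finite ℝ ((Set.finite_Iio (N k)).image y)
    obtain ⟨Ψ', hΨ'⟩ :=
      exists_finset_annihilator_norm_le (E ⊔ Submodule.span ℝ (y '' Set.Iio (N k)))
    exact ⟨y, φ, ⟨(E ⊔ Submodule.span ℝ (y '' Set.Iio (N k)), Ψ ∪ Ψ'), inferInstance,
      fun e he v hv => hΨ' e he v fun ψ hψ => hv ψ (Finset.mem_union_right _ hψ)⟩,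
      hy, hyΨ, le_sup_left, Finset.subset_union_left, le_sup_right⟩
  choose Y Φ next hY hann hE hΨ hspan using hstep
  let s : ℕ → State := Nat.rec ⟨(⊥, ∅), (inferInstance : FiniteDimensional ℝ (⊥ : Submodule ℝ X)),
    fun e he v _ => by rw [(Submodule.mem_bot ℝ).1 he]; simp⟩ fun k p => next k p
  have hEmono : Monotone fun k => (s k).1.1 := monotone_nat_of_le_succ fun k => hE k (s k)
  have hΨmono : Monotone fun k => (s k).1.2 := monotone_nat_of_le_succ fun k => hΨ k (s k)
  refine ⟨fun k => Y k (s k), fun k => Φ k (s k), fun k => hY k (s k), fun w hw K k hk => ?_⟩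
  have hzero : ∀ k j, k ≤ j → ∀ ψ ∈ (s k).1.2, ψ (w j) = 0 := by
    intro k j hkj ψ hψ
    have : Submodule.span ℝ (Y j (s j) '' Set.Iio (N j)) ≤ LinearMap.ker ψ.toLinearMap := by
      rw [Submodule.span_le]
      rintro _ ⟨i, -, rfl⟩
      exact hann j (s j) i ψ (hΨmono hkj hψ)
    exact this (hw j)
  have hpart : ∀ k ≤ K, ‖∑ j ∈ Finset.range k, w j‖ ≤ 2 * ‖∑ j ∈ Finset.range K, w j‖ := by
    intro k hk
    have := (s k).2.2 (∑ j ∈ Finset.range k, w j)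
      (Submodule.sum_mem _ fun j hj => hEmono (Nat.succ_le_of_lt (Finset.mem_range.1 hj))
        (hspan j (s j) (hw j)))
      (∑ j ∈ Finset.Ico k K, w j) fun ψ hψ => by
        rw [map_sum]
        exact Finset.sum_eq_zero fun j hj => hzero k j (Finset.mem_Ico.1 hj).1 ψ hψ
    rwa [Finset.sum_range_add_sum_Ico _ hk] at this
  have h1 := hpart k hk.le
  have h2 := hpart (k + 1) hk
  have h3 : w k = ∑ j ∈ Finset.range (k + 1), w j - ∑ j ∈ Finset.range k, w j := by
    rw [Finset.sum_range_succ, add_sub_cancel_left]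
  rw [h3]
  linarith [norm_sub_le (∑ j ∈ Finset.range (k + 1), w j) (∑ j ∈ Finset.range k, w j)]

theorem AlmostTriangular.card_le_norm_sub {X ι : Type*} [NormedAddCommGroup X] [NormedSpace ℝ X]
    {B : ℝ} {n m : ℕ} {y : ℕ → X} {φ : ℕ → StrongDual ℝ X}
    (h : AlmostTriangular B (1 / 10) n y φ) (hm : m < n) {S T : Finset ι} {g g' : ι → ℕ}
    (hg : ∀ i ∈ S, g i < m) (hg' : ∀ i ∈ T, m ≤ g' i ∧ g' i < n) :
    (S.card + T.card : ℝ) / 5 ≤ B * ‖∑ i ∈ S, y (g i) - ∑ i ∈ T, y (g' i)‖ := by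
  obtain ⟨-, hφ, hval⟩ := h
  set d := ∑ i ∈ S, y (g i) - ∑ i ∈ T, y (g' i) with hd
  have hbound : ∀ k, |φ k d| ≤ B * ‖d‖ := fun k =>
    ((φ k).le_opNorm d).trans (by gcongr; exact hφ k)
  have hS₀ : (S.card : ℝ) * (9 / 10) ≤ ∑ i ∈ S, φ 0 (y (g i)) := by
    rw [← nsmul_eq_mul]
    refine Finset.card_nsmul_le_sum _ _ _ fun i hi => ?_
    have := abs_le.1 (hval (g i) ((hg i hi).trans hm) 0 (by omega))
    rw [if_pos (Nat.zero_le _)] at this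
    linarith [this.1]
  have hT₀ : ∑ i ∈ T, φ 0 (y (g' i)) ≤ (T.card : ℝ) * (11 / 10) := by
    rw [← nsmul_eq_mul]
    refine Finset.sum_le_card_nsmul _ _ _ fun i hi => ?_
    have := abs_le.1 (hval (g' i) (hg' i hi).2 0 (by omega))
    rw [if_pos (Nat.zero_le _)] at this
    linarith [this.2]
  have hSm : ∑ i ∈ S, φ m (y (g i)) ≤ (S.card : ℝ) * (1 / 10) := by
    rw [← nsmul_eq_mul]
    refine Finset.sum_le_card_nsmul _ _ _ fun i hi => ?_
    have := abs_le.1 (hval (g i) ((hg i hi).trans hm) m hm)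
    rw [if_neg (not_le.2 (hg i hi))] at this
    linarith [this.2]
  have hTm : (T.card : ℝ) * (9 / 10) ≤ ∑ i ∈ T, φ m (y (g' i)) := by
    rw [← nsmul_eq_mul]
    refine Finset.card_nsmul_le_sum _ _ _ fun i hi => ?_
    have := abs_le.1 (hval (g' i) (hg' i hi).2 m hm)
    rw [if_pos (hg' i hi).1] at this
    linarith [this.1]
  have h₀ := (abs_le.1 (hbound 0)).2
  have hm' := (abs_le.1 (hbound m)).1
  have hexp : ∀ k, φ k d = ∑ i ∈ S, φ k (y (g i)) - ∑ i ∈ T, φ k (y (g' i)) := fun k => by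
    rw [hd, map_sub, map_sum, map_sum]
  rw [hexp] at h₀ hm'
  linarith [(Nat.cast_nonneg S.card : (0 : ℝ) ≤ _), (Nat.cast_nonneg T.card : (0 : ℝ) ≤ _)]

/-- The position of a node in the inorder traversal of the binary tree of depth `D`. -/
def inorder : ℕ → List Bool → ℕ
  | 0, _ => 0
  | D + 1, [] => 2 ^ D
  | D + 1, false :: p => inorder D p
  | D + 1, true :: p => 2 ^ D + inorder D p

theorem inorder_lt (D : ℕ) (p : List Bool) : inorder D p < 2 ^ D := by
  induction D generalizing p with
  | zero => simp [inorder]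
  | succ D ih =>
    rw [pow_succ]
    rcases p with _ | ⟨_ | _, p⟩ <;> simp only [inorder]
    · have := Nat.two_pow_pos D
      omega
    · have := ih p
      omega
    · have := ih p
      omega

theorem inorder_append_false_lt {D : ℕ} {w : List Bool} (h : w.length < D) (p : List Bool) :
    inorder D (w ++ false :: p) < inorder D w := by
  induction D generalizing w with
  | zero => omega
  | succ D ih =>
    rcases w with _ | ⟨_ | _, w⟩
    · exact inorder_lt D p
    · exact ih (by simpa using h)
    · exact Nat.add_lt_add_left (ih (by simpa using h)) _

theorem le_inorder_append_true {D : ℕ} {w : List Bool} (h : w.length < D) (p : List Bool) :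
    inorder D w ≤ inorder D (w ++ true :: p) := by
  induction D generalizing w with
  | zero => omega
  | succ D ih =>
    rcases w with _ | ⟨_ | _, w⟩
    · exact Nat.le_add_right _ _
    · exact ih (by simpa using h)
    · exact Nat.add_le_add_left (ih (by simpa using h)) _

/-- The steps `i < n` of a branch starting at level `L` that end in the `k`-th dyadic layer of
levels. -/
def layer (L n k : ℕ) : Finset ℕ := {i ∈ Finset.range n | Nat.log 2 (L + i + 1) = k}

theorem sub_le_card_layer {L n k lo hi : ℕ} (hn : hi ≤ n) (hlo : 2 ^ k ≤ L + lo + 1)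
    (hhi : L + hi < 2 ^ (k + 1)) : hi - lo ≤ (layer L n k).card := by
  rw [← Nat.card_Ico]
  refine Finset.card_le_card fun i hi' => ?_
  rw [Finset.mem_Ico] at hi'
  rw [layer, Finset.mem_filter, Finset.mem_range]
  exact ⟨by omega, Nat.log_eq_of_pow_le_of_lt_pow (by omega) (by omega)⟩

/-- A quarter of an interval of levels lies in a single dyadic layer. -/
theorem exists_le_four_mul_card_layer (L n : ℕ) : ∃ k, n ≤ 4 * (layer L n k).card := by
  rcases Nat.eq_zero_or_pos n with rfl | hn
  · exact ⟨0, Nat.zero_le _⟩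
  obtain ⟨K, hK⟩ : ∃ K, K = Nat.log 2 (L + n) := ⟨_, rfl⟩
  have h1 : 2 ^ K ≤ L + n := hK ▸ Nat.pow_log_le_self 2 (by omega)
  have h2 : L + n < 2 ^ (K + 1) := hK ▸ Nat.lt_pow_succ_log_self one_lt_two _
  rcases Nat.lt_or_ge (L + 1) (2 ^ K) with h3 | h3
  · rcases Nat.lt_or_ge (4 * (L + n + 1 - 2 ^ K)) n with h4 | h4
    · obtain _ | K := K
      · simp at h3
      · refine ⟨K, ?_⟩
        have := sub_le_card_layer (L := L) (n := n) (k := K) (lo := 2 ^ K - 1 - L)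
          (hi := 2 ^ (K + 1) - 1 - L) (by omega) (by omega) (by omega)
        rw [pow_succ] at *
        rw [pow_succ] at *
        omega
    · refine ⟨K, ?_⟩
      have := sub_le_card_layer (L := L) (n := n) (k := K) (lo := 2 ^ K - 1 - L) (hi := n) le_rfl
        (by omega) h2
      omega
  · refine ⟨K, ?_⟩
    have := sub_le_card_layer (L := L) (n := n) (k := K) (lo := 0) (hi := n) le_rfl h3 h2
    omega

section TreeMap

variable {X : Type*} [NormedAddCommGroup X]

/-- The vector of the node `p`, taken from the block of its dyadic layer according to inorder. -/
def nodeVector (y : ℕ → ℕ → X) (p : List Bool) : X :=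
  y (Nat.log 2 p.length) (inorder (2 ^ (Nat.log 2 p.length + 1)) p)

/-- The sum of the vectors of the nodes on the branch from the root to `s`. -/
def treeMap (y : ℕ → ℕ → X) (s : List Bool) : X :=
  ∑ i ∈ Finset.range s.length, nodeVector y (s.take (i + 1))

/-- The part in the `k`-th layer of the sum over the branch from `w` to `w ++ a`. -/
def layerSum (y : ℕ → ℕ → X) (w a : List Bool) (k : ℕ) : X :=
  ∑ i ∈ layer w.length a.length k, y k (inorder (2 ^ (k + 1)) (w ++ a.take (i + 1)))

theorem treeMap_append (y : ℕ → ℕ → X) (w a : List Bool) :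
    treeMap y (w ++ a) =
      treeMap y w + ∑ i ∈ Finset.range a.length, nodeVector y (w ++ a.take (i + 1)) := by
  simp only [treeMap, List.length_append, Finset.sum_range_add]
  congr 1
  · refine Finset.sum_congr rfl fun i hi => ?_
    rw [List.take_append_of_le_length (Finset.mem_range.1 hi)]
  · refine Finset.sum_congr rfl fun i _ => ?_
    rw [add_assoc, List.take_length_add_append]

theorem sum_layerSum (y : ℕ → ℕ → X) {w a : List Bool} {K : ℕ} (hK : w.length + a.length < K) :
    ∑ k ∈ Finset.range K, layerSum y w a k =
      ∑ i ∈ Finset.range a.length, nodeVector y (w ++ a.take (i + 1)) := by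
  rw [← Finset.sum_fiberwise_of_maps_to (s := Finset.range a.length) (t := Finset.range K)
    (g := fun i => Nat.log 2 (w.length + i + 1)) fun i hi => ?_]
  · refine Finset.sum_congr rfl fun k _ => Finset.sum_congr rfl fun i hi => ?_
    obtain ⟨hi, hk⟩ := Finset.mem_filter.1 hi
    have hlen : (w ++ a.take (i + 1)).length = w.length + i + 1 := by
      rw [List.length_append, List.length_take, min_eq_left (Finset.mem_range.1 hi), add_assoc]
    rw [nodeVector, hlen, hk]
  · have := Nat.log_le_self 2 (w.length + i + 1)
    have := Finset.mem_range.1 hi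
    exact Finset.mem_range.2 (by omega)

variable [NormedSpace ℝ X]

theorem layerSum_mem_span (y : ℕ → ℕ → X) (w a : List Bool) (k : ℕ) :
    layerSum y w a k ∈ Submodule.span ℝ (y k '' Set.Iio (2 ^ 2 ^ (k + 1))) :=
  Submodule.sum_mem _ fun _ _ => Submodule.subset_span ⟨_, inorder_lt _ _, rfl⟩

theorem card_layer_le_norm_layerSum_sub {y : ℕ → ℕ → X} {φ : ℕ → ℕ → StrongDual ℝ X} {B : ℝ}
    {k : ℕ} (h : AlmostTriangular B (1 / 10) (2 ^ 2 ^ (k + 1)) (y k) (φ k)) (w : List Bool)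
    {a b : List Bool} (hab : lcp a b = 0) :
    ((layer w.length a.length k).card + (layer w.length b.length k).card : ℝ) / 5 ≤
      B * ‖layerSum y w a k - layerSum y w b k‖ := by
  have hempty : ∀ a b : List Bool, layer w.length a.length k = ∅ →
      ((layer w.length a.length k).card + (layer w.length b.length k).card : ℝ) / 5 ≤
        B * ‖layerSum y w a k - layerSum y w b k‖ := fun a b ha =>
    h.card_le_norm_sub (m := 0) (by positivity) (by simp [ha])
      fun i _ => ⟨Nat.zero_le _, inorder_lt _ _⟩
  have hsplit : ∀ a b : List Bool,
      ((layer w.length (false :: a).length k).card +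
        (layer w.length (true :: b).length k).card : ℝ) / 5 ≤
        B * ‖layerSum y w (false :: a) k - layerSum y w (true :: b) k‖ := by
    intro a b
    rcases Nat.lt_or_ge w.length (2 ^ (k + 1)) with hw | hw
    · exact h.card_le_norm_sub (inorder_lt _ w)
        (fun i _ => inorder_append_false_lt hw _)
        (fun i _ => ⟨le_inorder_append_true hw _, inorder_lt _ _⟩)
    · refine hempty _ _ (Finset.filter_eq_empty_iff.2 fun i _ hi => ?_)
      have := Nat.lt_pow_succ_log_self one_lt_two (w.length + i + 1)
      rw [hi] at this
      omega
  rcases a with _ | ⟨_ | _, a⟩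
  · exact hempty _ _ rfl
  · rcases b with _ | ⟨_ | _, b⟩
    · rw [add_comm, norm_sub_rev]
      exact hempty _ _ rfl
    · simp [lcp] at hab
    · exact hsplit a b
  · rcases b with _ | ⟨_ | _, b⟩
    · rw [add_comm, norm_sub_rev]
      exact hempty _ _ rfl
    · rw [add_comm, norm_sub_rev]
      exact hsplit b a
    · simp [lcp] at hab

end TreeMap

theorem exists_append_lcp_eq_zero (s t : List Bool) :
    ∃ w a b, s = w ++ a ∧ t = w ++ b ∧ lcp a b = 0 := by
  induction s generalizing t with
  | nil => exact ⟨[], [], t, rfl, rfl, rfl⟩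
  | cons c s ih =>
    rcases t with _ | ⟨d, t⟩
    · exact ⟨[], c :: s, [], rfl, rfl, rfl⟩
    · rcases eq_or_ne c d with rfl | hcd
      · obtain ⟨w, a, b, rfl, rfl, hab⟩ := ih t
        exact ⟨c :: w, a, b, rfl, rfl, hab⟩
      · exact ⟨[], c :: s, d :: t, rfl, rfl, by simp [lcp, hcd]⟩

/-- Spaces with arbitrarily long triangular systems contain the infinite binary tree. -/
theorem exists_embedding_of_almostTriangular {X : Type*} [NormedAddCommGroup X] [NormedSpace ℝ X]
    {B : ℝ} (h : ∀ n, ∃ (z : ℕ → X) (φ : ℕ → StrongDual ℝ X), AlmostTriangular B 0 n z φ) :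
    ∃ f : List Bool → X, ∀ s t, treeDist s t ≤ 160 * (2 * B + 1) * ‖f s - f t‖ ∧
      ‖f s - f t‖ ≤ (2 * B + 1) * treeDist s t := by
  obtain ⟨y, φ, hy, hw⟩ := exists_almostTriangular_blocks h (by norm_num : (0 : ℝ) < 1 / 10)
    fun k => 2 ^ 2 ^ (k + 1)
  have hB : 0 ≤ 2 * B + 1 := (norm_nonneg _).trans ((hy 0).1 0)
  refine ⟨treeMap y, fun s t => ?_⟩
  obtain ⟨w, a, b, rfl, rfl, hab⟩ := exists_append_lcp_eq_zero s t
  have hdist : treeDist (w ++ a) (w ++ b) = a.length + b.length := by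
    rw [treeDist_append, treeDist, hab]
    simp
  have hsum : ∀ c : List Bool,
      ‖∑ i ∈ Finset.range c.length, nodeVector y (w ++ c.take (i + 1))‖ ≤
        (2 * B + 1) * c.length := by
    intro c
    refine (norm_sum_le_of_le _ fun i _ => (hy _).1 _).trans (le_of_eq ?_)
    rw [Finset.sum_const, Finset.card_range, nsmul_eq_mul, mul_comm]
  have hlayer : ∀ k, ((layer w.length a.length k).card + (layer w.length b.length k).card : ℝ) ≤
      20 * (2 * B + 1) * ‖treeMap y (w ++ a) - treeMap y (w ++ b)‖ := by
    intro k
    have h1 := card_layer_le_norm_layerSum_sub (hy k) w hab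
    have h2 := hw (fun j => layerSum y w a j - layerSum y w b j)
      (fun j => Submodule.sub_mem _ (layerSum_mem_span y w a j) (layerSum_mem_span y w b j))
      (w.length + a.length + b.length + k + 1) k (by omega)
    rw [Finset.sum_sub_distrib, sum_layerSum y (by omega), sum_layerSum y (by omega)] at h2
    rw [treeMap_append, treeMap_append, add_sub_add_left_eq_sub]
    have h3 := mul_le_mul_of_nonneg_left h2 hB
    linarith
  rw [hdist]
  constructor
  · obtain ⟨k, hk⟩ := exists_le_four_mul_card_layer w.length a.length
    obtain ⟨l, hl⟩ := exists_le_four_mul_card_layer w.length b.length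
    have hk' : (a.length : ℝ) ≤ 4 * (layer w.length a.length k).card := by exact_mod_cast hk
    have hl' : (b.length : ℝ) ≤ 4 * (layer w.length b.length l).card := by exact_mod_cast hl
    have h1 := hlayer k
    have h2 := hlayer l
    have h3 : (0 : ℝ) ≤ (layer w.length b.length k).card := Nat.cast_nonneg _
    have h4 : (0 : ℝ) ≤ (layer w.length a.length l).card := Nat.cast_nonneg _
    linarith
  · rw [treeMap_append, treeMap_append, add_sub_add_left_eq_sub]
    refine (norm_sub_le _ _).trans ?_
    linarith [hsum a, hsum b]

/-- Baudier's theorem: a Banach space is nonsuperreflexive iff the infinite binary tree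
admits a bilipschitz embedding into it. -/
theorem baudier_infinite_tree_characterization
    (X : Type) [NormedAddCommGroup X] [NormedSpace ℝ X] [CompleteSpace X] :
    ¬ SuperReflexive X ↔
      ∃ r C : ℝ, 0 < r ∧ 1 ≤ C ∧ ∃ f : List Bool → X,
        ∀ s t : List Bool,
          r * treeDist s t ≤ ‖f s - f t‖ ∧ ‖f s - f t‖ ≤ r * C * treeDist s t := by
  constructor
  · intro h
    simp only [SuperReflexive, not_forall] at h
    obtain ⟨Z, _, _, _, hZX, hZ⟩ := h
    obtain ⟨B, hB⟩ := exists_almostTriangular_of_not_reflexive hZ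
    have hB₀ : 0 ≤ B := by
      obtain ⟨z, φ, hz, -⟩ := hB 0
      exact (norm_nonneg _).trans (hz 0)
    obtain ⟨f, hf⟩ := exists_embedding_of_almostTriangular fun n => by
      obtain ⟨z, φ, hz⟩ := hB n
      exact exists_almostTriangular_of_finitelyRepresentable hZX hz
    set A := 2 * (2 * B) + 1 with hA
    have hA1 : 1 ≤ A := by linarith
    refine ⟨(160 * A)⁻¹, 160 * A * A, by positivity, by nlinarith, f, fun s t => ⟨?_, ?_⟩⟩
    · rw [inv_mul_le_iff₀ (by positivity)]
      exact (hf s t).1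
    · rw [← mul_assoc, inv_mul_cancel₀ (by positivity), one_mul]
      exact (hf s t).2
  · rintro ⟨r, C, hr, -, f, hf⟩
    exact not_superReflexive_of_embedding hr f (fun s t => (hf s t).1) fun s t => (hf s t).2
end
end

section
/- Let A be a locally finite metric space and X a (infinite-dimensional) Banach space. If there exists a constant 1 ≤ C < ∞ such that every finite subset of A (with the induced metric) admits a bilipschitz embedding into X with distortion at most C, then A admits a bilipschitz embedding into X. -/
noncomputable section

open Filter Set

/-- Let `x` be a family of vectors with norms in `[d, C * d]`. Along an ultrafilter, convex
combinations of two successively chosen members of the family stay away from zero. -/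
theorem eventually_eventually_le_norm_convex_combination {ι X : Type*} [NormedAddCommGroup X]
    [NormedSpace ℝ X] (U : Ultrafilter ι) {x : ι → X} {C d : ℝ} (hC : 1 ≤ C) (hd : 0 ≤ d)
    (hx : ∀ᶠ n in (U : Filter ι), d ≤ ‖x n‖ ∧ ‖x n‖ ≤ C * d) :
    ∀ᶠ n in (U : Filter ι), ∀ᶠ m in (U : Filter ι), ∀ t ∈ Icc (0 : ℝ) 1,
      d / (5 * C) ≤ ‖(1 - t) • x n + t • x m‖ := by
  have hC0 : 0 < C := by linarith
  set e := d / (5 * C) with he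
  have hed : e * C = d / 5 := by rw [he]; field_simp
  have he0 : 0 ≤ e := by positivity
  have hle : ∀ (φ : StrongDual ℝ X), ‖φ‖ ≤ 1 → ∀ y, φ y ≤ ‖y‖ := fun φ hφ y =>
    (le_abs_self _).trans ((φ.le_opNorm y).trans
      (mul_le_of_le_one_left (norm_nonneg _) hφ))
  by_cases h : ∃ φ : StrongDual ℝ X, ‖φ‖ ≤ 1 ∧ ∀ᶠ n in (U : Filter ι), e ≤ φ (x n)
  · obtain ⟨φ, hφ, hφx⟩ := h
    filter_upwards [hφx] with n hn
    filter_upwards [hφx] with m hm t ht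
    refine le_trans ?_ (hle φ hφ _)
    simp only [map_add, map_smul, smul_eq_mul]
    nlinarith [mul_le_mul_of_nonneg_left hn (sub_nonneg.2 ht.2),
      mul_le_mul_of_nonneg_left hm ht.1]
  · push Not at h
    filter_upwards [hx] with n hn
    obtain ⟨ψ, hψ, hψn⟩ := exists_dual_vector'' ℝ (x n)
    have hψx : ∀ᶠ m in (U : Filter ι), ¬ e ≤ (-ψ) (x m) :=
      by
      simpa only [not_le] using h (-ψ) (by rwa [norm_neg])
    filter_upwards [hx, hψx] with m hm hψm t ht
    have hs : 0 ≤ 1 - t := sub_nonneg.2 ht.2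
    by_cases hsC : 2 / 5 ≤ (1 - t) * C
    · refine le_trans ?_ (hle ψ hψ _)
      simp only [map_add, map_smul, smul_eq_mul, hψn, RCLike.ofReal_real_eq_id, id]
      simp only [neg_apply, not_le] at hψm
      have h1 : (1 - t) * d ≤ (1 - t) * ‖x n‖ := mul_le_mul_of_nonneg_left hn.1 hs
      have h2 : t * (-e) ≤ t * ψ (x m) := mul_le_mul_of_nonneg_left (by linarith) ht.1
      have h3 : t * e ≤ e := mul_le_of_le_one_left he0 ht.2
      have h4 : 2 * e ≤ (1 - t) * d := by
        have : d = 5 * (e * C) := by linarith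
        rw [this]
        nlinarith
      linarith
    · have h1 : ‖t • x m‖ - ‖(1 - t) • x n‖ ≤ ‖(1 - t) • x n + t • x m‖ := by
        rw [add_comm]; exact norm_sub_le_norm_add _ _
      rw [norm_smul, norm_smul, Real.norm_of_nonneg ht.1, Real.norm_of_nonneg hs] at h1
      have h2 : t * d ≤ t * ‖x m‖ := mul_le_mul_of_nonneg_left hm.1 ht.1
      have h3 : (1 - t) * ‖x n‖ ≤ (1 - t) * (C * d) := mul_le_mul_of_nonneg_left hn.2 hs
      have h4 : (1 - t) * C * d ≤ 2 / 5 * d := mul_le_mul_of_nonneg_right (by linarith) hd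
      have h5 : 1 - t ≤ (1 - t) * C := le_mul_of_one_le_right hs hC
      have h6 : (1 - t) * d ≤ 2 / 5 * d := mul_le_mul_of_nonneg_right (by linarith) hd
      have h7 : e ≤ e * C := le_mul_of_one_le_right he0 hC
      linarith

/-- Relations that hold eventually in both arguments can be satisfied along a sequence. -/
theorem exists_seq_of_eventually_eventually {α : Type*} {F : Filter α} [F.NeBot]
    {P : ℕ → α → α → Prop} (h : ∀ k, ∀ᶠ a in F, ∀ᶠ b in F, P k a b) :
    ∃ s : ℕ → α, ∀ k, P k (s k) (s (k + 1)) := by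
  have step : ∀ k (a : {a // ∀ᶠ b in F, P k a b}),
      ∃ b : {b // ∀ᶠ c in F, P (k + 1) b c}, P k a b := fun k a => by
    obtain ⟨b, hb, hb'⟩ := (a.2.and (h (k + 1))).exists
    exact ⟨⟨b, hb'⟩, hb⟩
  choose next hnext using step
  obtain ⟨a₀, ha₀⟩ := (h 0).exists
  let s : ∀ k, {a // ∀ᶠ b in F, P k a b} := fun k =>
    Nat.rec (motive := fun k => {a // ∀ᶠ b in F, P k a b}) ⟨a₀, ha₀⟩ next k
  exact ⟨fun k => (s k).1, fun k => hnext k (s k)⟩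

/-- Piecewise linear interpolation of a sequence of vectors. -/
def linearInterpolation {X : Type*} [AddCommGroup X] [Module ℝ X] (a : ℕ → X) (t : ℝ) : X :=
  (1 - (t - ⌊t⌋₊)) • a ⌊t⌋₊ + (t - ⌊t⌋₊) • a (⌊t⌋₊ + 1)

theorem norm_sub_le_mul_of_norm_succ_sub_le {X : Type*} [NormedAddCommGroup X] {a : ℕ → X}
    {M : ℝ} (ha : ∀ k, ‖a (k + 1) - a k‖ ≤ M) (p j : ℕ) : ‖a (p + j) - a p‖ ≤ M * j := by
  induction j with
  | zero => simp
  | succ j ih =>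
    have h := norm_add_le (a (p + (j + 1)) - a (p + j)) (a (p + j) - a p)
    rw [sub_add_sub_cancel] at h
    have := ha (p + j)
    push_cast
    rw [← add_assoc] at h ⊢
    linarith

theorem norm_linearInterpolation_sub_le {X : Type*} [NormedAddCommGroup X] [NormedSpace ℝ X]
    {a : ℕ → X} {M : ℝ} (ha : ∀ k, ‖a (k + 1) - a k‖ ≤ M) {s t : ℝ} (hs : 0 ≤ s)
    (hst : s ≤ t) :
    ‖linearInterpolation a t - linearInterpolation a s‖ ≤ M * (t - s) := by
  have ht : 0 ≤ t := hs.trans hst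
  have hs1 := Nat.floor_le hs
  have hs2 := (Nat.lt_floor_add_one s).le
  have ht1 := Nat.floor_le ht
  have hfl : ⌊s⌋₊ ≤ ⌊t⌋₊ := Nat.floor_mono hst
  unfold linearInterpolation
  generalize ⌊s⌋₊ = p at *
  generalize ⌊t⌋₊ = q at *
  rcases hfl.eq_or_lt with rfl | hlt
  · have : (1 - (t - p)) • a p + (t - p) • a (p + 1)
        - ((1 - (s - p)) • a p + (s - p) • a (p + 1)) = (t - s) • (a (p + 1) - a p) := by
      module
    rw [this, norm_smul, Real.norm_of_nonneg (sub_nonneg.2 hst), mul_comm]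
    exact mul_le_mul_of_nonneg_right (ha p) (sub_nonneg.2 hst)
  · obtain ⟨j, rfl⟩ := Nat.exists_eq_add_of_le (Nat.succ_le_of_lt hlt)
    rw [Nat.succ_eq_add_one] at *
    have : (1 - (t - (p + 1 + j : ℕ))) • a (p + 1 + j) + (t - (p + 1 + j : ℕ)) • a (p + 1 + j + 1)
        - ((1 - (s - p)) • a p + (s - p) • a (p + 1))
        = (t - (p + 1 + j : ℕ)) • (a (p + 1 + j + 1) - a (p + 1 + j))
          + (a (p + 1 + j) - a (p + 1)) + (p + 1 - s) • (a (p + 1) - a p) := by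
      module
    rw [this]
    refine (norm_add₃_le).trans ?_
    rw [norm_smul, norm_smul, Real.norm_of_nonneg (sub_nonneg.2 ht1),
      Real.norm_of_nonneg (sub_nonneg.2 hs2)]
    have h1 := mul_le_mul_of_nonneg_left (ha (p + 1 + j)) (sub_nonneg.2 ht1)
    have h2 := mul_le_mul_of_nonneg_left (ha p) (sub_nonneg.2 hs2)
    have h3 := norm_sub_le_mul_of_norm_succ_sub_le ha (p + 1) j
    push_cast at h1 ⊢
    linarith

theorem mul_log_one_add_sub_log_one_add_le {a b : ℝ} (ha : 0 ≤ a) (hab : a ≤ b) :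
    a * (Real.log (1 + b) - Real.log (1 + a)) ≤ b - a := by
  have ha1 : 0 < 1 + a := by linarith
  have hlog : Real.log (1 + b) - Real.log (1 + a) ≤ (b - a) / (1 + a) := by
    rw [← Real.log_div (by linarith) ha1.ne']
    refine (Real.log_le_sub_one_of_pos (div_pos (by linarith) ha1)).trans_eq ?_
    field_simp
    ring
  refine (mul_le_mul_of_nonneg_left hlog ha).trans ?_
  rw [mul_div_assoc', div_le_iff₀ ha1]
  nlinarith

/-- Normalized embeddings of a ball, fixed at the centre and extended by zero. -/
theorem exists_normalized_embedding_of_finite {A X : Type*} [MetricSpace A]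
    [NormedAddCommGroup X] [NormedSpace ℝ X] {C : ℝ} (hC : 1 ≤ C) {S : Set A} {o : A}
    (ho : o ∈ S)
    (h : ∃ r : ℝ, 0 < r ∧ ∃ f : S → X,
        ∀ u v : S, r * dist (u : A) (v : A) ≤ ‖f u - f v‖ ∧
          ‖f u - f v‖ ≤ r * C * dist (u : A) (v : A)) :
    ∃ F : A → X, (∀ u, ‖F u‖ ≤ C * dist u o) ∧
      ∀ u ∈ S, ∀ v ∈ S, dist u v ≤ ‖F u - F v‖ ∧ ‖F u - F v‖ ≤ C * dist u v := by
  classical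
  obtain ⟨r, hr, f, hf⟩ := h
  have key : ∀ u v : S, dist (u : A) v ≤ ‖r⁻¹ • (f u - f v)‖ ∧
      ‖r⁻¹ • (f u - f v)‖ ≤ C * dist (u : A) v := fun u v => by
    rw [norm_smul, Real.norm_of_nonneg (inv_nonneg.2 hr.le), le_inv_mul_iff₀ hr,
      inv_mul_le_iff₀ hr, ← mul_assoc]
    exact hf u v
  refine ⟨fun u => if hu : u ∈ S then r⁻¹ • (f ⟨u, hu⟩ - f ⟨o, ho⟩) else 0, fun u => ?_,
    fun u hu v hv => ?_⟩
  · by_cases hu : u ∈ S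
    · simpa only [hu, dif_pos] using (key ⟨u, hu⟩ ⟨o, ho⟩).2
    · simp only [hu, dif_neg, not_false_eq_true, norm_zero]
      positivity
  · simp only [hu, hv, dif_pos]
    rw [← smul_sub, sub_sub_sub_cancel_right]
    exact key ⟨u, hu⟩ ⟨v, hv⟩

/-- A sequence of embeddings of the balls `closedBall o (R k)` all of whose convex combinations
of consecutive members are embeddings. -/
theorem exists_seq_compatible_embeddings {A X : Type*} [MetricSpace A]
    (hLF : ∀ (x : A) (R : ℝ), (Metric.closedBall x R).Finite)
    [NormedAddCommGroup X] [NormedSpace ℝ X] {C : ℝ} (hC : 1 ≤ C)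
    (hfin : ∀ S : Set A, S.Finite →
      ∃ r : ℝ, 0 < r ∧ ∃ f : S → X,
        ∀ u v : S, r * dist (u : A) (v : A) ≤ ‖f u - f v‖ ∧
          ‖f u - f v‖ ≤ r * C * dist (u : A) (v : A)) (o : A) (R : ℕ → ℝ) :
    ∃ f : ℕ → A → X, (∀ k u, ‖f k u‖ ≤ C * dist u o) ∧
      ∀ k, ∀ u ∈ Metric.closedBall o (R k), ∀ v ∈ Metric.closedBall o (R k),
        ∀ t ∈ Icc (0 : ℝ) 1,
          dist u v / (5 * C) ≤
            ‖(1 - t) • (f k u - f k v) + t • (f (k + 1) u - f (k + 1) v)‖ ∧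
          ‖(1 - t) • (f k u - f k v) + t • (f (k + 1) u - f (k + 1) v)‖ ≤ C * dist u v := by
  have hF : ∀ n : ℕ, ∃ F : A → X, (∀ u, ‖F u‖ ≤ C * dist u o) ∧
      ∀ u ∈ Metric.closedBall o n, ∀ v ∈ Metric.closedBall o n,
        dist u v ≤ ‖F u - F v‖ ∧ ‖F u - F v‖ ≤ C * dist u v := fun n =>
    exists_normalized_embedding_of_finite hC (Metric.mem_closedBall_self n.cast_nonneg)
      (hfin _ (hLF o n))
  choose F hFo hFd using hF
  let U : Ultrafilter ℕ := hyperfilter ℕ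
  have hmem : ∀ u, ∀ᶠ n : ℕ in (U : Filter ℕ), u ∈ Metric.closedBall o (n : ℝ) := fun u => by
    filter_upwards [Nat.hyperfilter_le_atTop
      (tendsto_natCast_atTop_atTop.eventually_ge_atTop (dist u o))] with n hn using hn
  have hpair : ∀ u v, ∀ᶠ n in (U : Filter ℕ),
      dist u v ≤ ‖F n u - F n v‖ ∧ ‖F n u - F n v‖ ≤ C * dist u v := fun u v => by
    filter_upwards [hmem u, hmem v] with n hu hv using hFd n u hu v hv
  have hev : ∀ k, ∀ᶠ n in (U : Filter ℕ), ∀ᶠ m in (U : Filter ℕ),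
      ∀ u ∈ Metric.closedBall o (R k), ∀ v ∈ Metric.closedBall o (R k),
        ∀ t ∈ Icc (0 : ℝ) 1,
          dist u v / (5 * C) ≤ ‖(1 - t) • (F n u - F n v) + t • (F m u - F m v)‖ ∧
          ‖(1 - t) • (F n u - F n v) + t • (F m u - F m v)‖ ≤ C * dist u v := by
    intro k
    have h : ∀ u v, ∀ᶠ n in (U : Filter ℕ), ∀ᶠ m in (U : Filter ℕ), ∀ t ∈ Icc (0 : ℝ) 1,
          dist u v / (5 * C) ≤ ‖(1 - t) • (F n u - F n v) + t • (F m u - F m v)‖ ∧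
          ‖(1 - t) • (F n u - F n v) + t • (F m u - F m v)‖ ≤ C * dist u v := by
      intro u v
      filter_upwards [hpair u v, eventually_eventually_le_norm_convex_combination U hC
        dist_nonneg (hpair u v)] with n hn hn'
      filter_upwards [hpair u v, hn'] with m hm hm' t ht
      refine ⟨hm' t ht, mem_closedBall_zero_iff.1 ?_⟩
      exact (convex_closedBall (0 : X) (C * dist u v)) (mem_closedBall_zero_iff.2 hn.2)
        (mem_closedBall_zero_iff.2 hm.2) (sub_nonneg.2 ht.2) ht.1 (sub_add_cancel 1 t)
    simp only [(hLF o (R k)).eventually_all, h, implies_true]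
  obtain ⟨s, hs⟩ := exists_seq_of_eventually_eventually hev
  exact ⟨fun k => F (s k), fun k => hFo (s k), hs⟩

/-- Finite determination of embeddability: if all finite subsets of a locally finite
metric space `A` admit bilipschitz embeddings into a Banach space `X` with uniformly
bounded distortions, then `A` admits a bilipschitz embedding into `X`. -/
theorem finite_determination
    (A : Type) [MetricSpace A]
    -- `A` is locally finite: every ball of finite radius is finite:
    (hLF : ∀ (x : A) (R : ℝ), (Metric.closedBall x R).Finite)
    (X : Type) [NormedAddCommGroup X] [NormedSpace ℝ X] [CompleteSpace X]
    (hInf : ¬ FiniteDimensional ℝ X)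
    (C : ℝ) (hC : 1 ≤ C)
    (hfin : ∀ S : Set A, S.Finite →
      ∃ r : ℝ, 0 < r ∧ ∃ f : S → X,
        ∀ u v : S, r * dist (u : A) (v : A) ≤ ‖f u - f v‖ ∧
          ‖f u - f v‖ ≤ r * C * dist (u : A) (v : A)) :
    ∃ (r C' : ℝ) (g : A → X), 0 < r ∧ 1 ≤ C' ∧
      ∀ u v : A, r * dist u v ≤ ‖g u - g v‖ ∧ ‖g u - g v‖ ≤ r * C' * dist u v := by
  rcases isEmpty_or_nonempty A with hA | ⟨⟨o⟩⟩
  · exact ⟨1, 1, fun u => hA.elim u, one_pos, le_rfl, fun u => hA.elim u⟩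
  have hC0 : 0 < C := by linarith
  set ε : ℝ := 1 / (20 * C ^ 2) with hε
  have hε0 : 0 < ε := by positivity
  obtain ⟨f, hfo, hf⟩ := exists_seq_compatible_embeddings hLF hC hfin o
    fun k => Real.exp ((k + 1) / ε)
  let ρ : A → ℝ := fun u => ε * Real.log (1 + dist u o)
  have hρ0 : ∀ u, 0 ≤ ρ u := fun u =>
    mul_nonneg hε0.le (Real.log_nonneg (by linarith [dist_nonneg (x := u) (y := o)]))
  have hmem : ∀ u v, dist v o ≤ dist u o →
      v ∈ Metric.closedBall o (Real.exp ((⌊ρ u⌋₊ + 1) / ε)) := fun u v hvu => by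
    have h1 : Real.log (1 + dist u o) ≤ (⌊ρ u⌋₊ + 1) / ε := by
      rw [le_div_iff₀' hε0]
      exact (Nat.lt_floor_add_one (ρ u)).le
    have h2 := (Real.log_le_iff_le_exp (by positivity)).1 h1
    rw [Metric.mem_closedBall]
    linarith
  let g : A → X := fun u => linearInterpolation (fun k => f k u) (ρ u)
  have key : ∀ u v, dist v o ≤ dist u o →
      1 / (10 * C) * dist u v ≤ ‖g u - g v‖ ∧ ‖g u - g v‖ ≤ 2 * C * dist u v := by
    intro u v hvu
    have hmain := hf ⌊ρ u⌋₊ u (hmem u u le_rfl) v (hmem u v hvu) (ρ u - ⌊ρ u⌋₊)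
      ⟨sub_nonneg.2 (Nat.floor_le (hρ0 u)), by linarith [Nat.lt_floor_add_one (ρ u)]⟩
    have hρ : ρ v ≤ ρ u := mul_le_mul_of_nonneg_left
      (Real.log_le_log (by positivity) (by linarith)) hε0.le
    have herr := norm_linearInterpolation_sub_le (a := fun k => f k v)
      (M := 2 * C * dist v o) (fun k => (norm_sub_le _ _).trans
        (by linarith [hfo k v, hfo (k + 1) v])) (hρ0 v) hρ
    have hsmall : 2 * C * dist v o * (ρ u - ρ v) ≤ 1 / (10 * C) * dist u v := by
      have h1 := mul_log_one_add_sub_log_one_add_le dist_nonneg hvu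
      have h2 : dist u o - dist v o ≤ dist u v := by linarith [dist_triangle u v o]
      calc 2 * C * dist v o * (ρ u - ρ v)
          = 1 / (10 * C) *
            (dist v o * (Real.log (1 + dist u o) - Real.log (1 + dist v o))) := by
              simp only [ρ, hε]; field_simp; ring
        _ ≤ 1 / (10 * C) * dist u v :=
            mul_le_mul_of_nonneg_left (h1.trans h2) (by positivity)
    have hg : g u - g v =
        ((1 - (ρ u - ⌊ρ u⌋₊)) • (f ⌊ρ u⌋₊ u - f ⌊ρ u⌋₊ v)
          + (ρ u - ⌊ρ u⌋₊) • (f (⌊ρ u⌋₊ + 1) u - f (⌊ρ u⌋₊ + 1) v))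
        + (linearInterpolation (fun k => f k v) (ρ u)
          - linearInterpolation (fun k => f k v) (ρ v)) := by
      simp only [g, linearInterpolation]
      module
    rw [hg]
    have hhalf : dist u v / (5 * C) = 2 * (1 / (10 * C) * dist u v) := by field_simp; ring
    have hle : 1 / (10 * C) * dist u v ≤ C * dist u v := by
      refine mul_le_mul_of_nonneg_right ?_ dist_nonneg
      rw [div_le_iff₀ (by positivity)]
      nlinarith
    constructor
    · refine le_trans ?_ (norm_sub_le_norm_add _ _)
      linarith [hmain.1]
    · refine (norm_add_le _ _).trans ?_
      linarith [hmain.2]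
  refine ⟨1 / (10 * C), 20 * C ^ 2, g, by positivity, by nlinarith, fun u v => ?_⟩
  have hconst : 1 / (10 * C) * (20 * C ^ 2) = 2 * C := by field_simp; norm_num
  rw [hconst]
  rcases le_total (dist v o) (dist u o) with h | h
  · exact key u v h
  · rw [dist_comm u v, norm_sub_rev]
    exact key v u h
end
end

section
/- Let (M,d) be a metric space containing a thick family of uv-geodesics for some points u, v ∈ M, and suppose M admits a bilipschitz embedding into a Banach space X. Then there exist a filtration on the probability space ((0,1], Borel sets, Lebesgue measure) and an X-valued martingale (M_k)_{k∈ℕ} with sup_{k,t} ‖M_k(t)‖ ≤ 1 which does not converge in L¹((0,1]; X). -/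
noncomputable section

open Set MeasureTheory

/-- `g : ℝ → M` is a `uv`-geodesic: a distance preserving map of `[0, d(u,v)]` onto a
path from `u` to `v` (extended to all of `ℝ` by the constant values `u`, `v`). -/
structure IsUVGeodesic {M : Type} [MetricSpace M] (u v : M) (g : ℝ → M) : Prop where
  left : ∀ t : ℝ, t ≤ 0 → g t = u
  right : ∀ t : ℝ, dist u v ≤ t → g t = v
  isom : ∀ s ∈ Icc (0 : ℝ) (dist u v), ∀ t ∈ Icc (0 : ℝ) (dist u v),
    dist (g s) (g t) = |s - t|

/-- `T` is a thick family of `uv`-geodesics. -/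
def IsThickFamily {M : Type} [MetricSpace M] (u v : M) (T : Set (ℝ → M)) : Prop :=
  T.Nonempty ∧ (∀ g ∈ T, IsUVGeodesic u v g) ∧
  ∃ α : ℝ, 0 < α ∧
    ∀ g ∈ T, ∀ (n : ℕ) (r : Fin n → ℝ), (∀ i, r i ∈ Icc (0 : ℝ) (dist u v)) →
      ∃ g' ∈ T, ∃ (m : ℕ) (q : Fin (m + 1) → ℝ) (s : Fin m → ℝ),
        StrictMono q ∧ q 0 = 0 ∧ q (Fin.last m) = dist u v ∧
        (∀ i : Fin m, q i.castSucc < s i ∧ s i < q i.succ) ∧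
        (∀ i : Fin (m + 1), g (q i) = g' (q i)) ∧
        (∀ i : Fin n, ∃ j : Fin (m + 1), g (r i) = g (q j)) ∧
        α ≤ ∑ i : Fin m, dist (g (s i)) (g' (s i)) ∧
        (∀ h : ℝ → M, IsUVGeodesic u v h →
          (∀ i : Fin m,
            (∀ t ∈ Icc (q i.castSucc) (q i.succ), h t = g t) ∨
            (∀ t ∈ Icc (q i.castSucc) (q i.succ), h t = g' t)) →
          h ∈ T)

/-- Lebesgue measure on `(0,1]`. -/
def lebOnIoc : Measure (↥(Set.Ioc (0 : ℝ) 1)) :=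
  (volume : Measure ℝ).comap Subtype.val

open Filter

/-- The derivative of the piecewise linear interpolation of `φ` at the nodes `q 0, …, q n`. -/
def stepSlope {X : Type} [NormedAddCommGroup X] [NormedSpace ℝ X]
    (q : ℕ → ℝ) (n : ℕ) (φ : ℝ → X) (x : ℝ) : X :=
  ∑ i ∈ Finset.range n, (Ioc (q i) (q (i + 1))).indicator
    (fun _ => (q (i + 1) - q i)⁻¹ • (φ (q (i + 1)) - φ (q i))) x

section StepSlope

variable {X : Type} [NormedAddCommGroup X] [NormedSpace ℝ X]

theorem stepSlope_of_mem {q : ℕ → ℝ} (hq : StrictMono q) {n i : ℕ} (hi : i < n) (φ : ℝ → X)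
    {x : ℝ} (hx : x ∈ Ioc (q i) (q (i + 1))) :
    stepSlope q n φ x = (q (i + 1) - q i)⁻¹ • (φ (q (i + 1)) - φ (q i)) := by
  unfold stepSlope
  rw [Finset.sum_eq_single_of_mem i (Finset.mem_range.2 hi), indicator_of_mem hx]
  intro j _ hj
  apply indicator_of_notMem
  rintro ⟨h1, h2⟩
  rcases lt_or_gt_of_ne hj with h | h
  · exact absurd (hx.1.trans_le h2) (not_lt.2 (hq.monotone h))
  · exact absurd (h1.trans_le hx.2) (not_lt.2 (hq.monotone h))

theorem norm_stepSlope_le_one {q : ℕ → ℝ} (hq : StrictMono q) {n : ℕ} {φ : ℝ → X}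
    (hφ : ∀ i < n, ‖φ (q (i + 1)) - φ (q i)‖ ≤ q (i + 1) - q i) (x : ℝ) :
    ‖stepSlope q n φ x‖ ≤ 1 := by
  by_cases h : ∃ i < n, x ∈ Ioc (q i) (q (i + 1))
  · obtain ⟨i, hi, hx⟩ := h
    have hpos : 0 < q (i + 1) - q i := sub_pos.2 (hq (Nat.lt_succ_self i))
    rw [stepSlope_of_mem hq hi φ hx, norm_smul, norm_inv, Real.norm_of_nonneg hpos.le,
      inv_mul_le_one₀ hpos]
    exact hφ i hi
  · push Not at h
    have : stepSlope q n φ x = 0 :=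
      Finset.sum_eq_zero fun i hi => indicator_of_notMem (h i (Finset.mem_range.1 hi)) _
    simp [this]

theorem stronglyMeasurable_stepSlope (q : ℕ → ℝ) (n : ℕ) (φ : ℝ → X) :
    StronglyMeasurable (stepSlope q n φ) :=
  Finset.stronglyMeasurable_fun_sum _ fun _ _ =>
    stronglyMeasurable_const.indicator measurableSet_Ioc

theorem integrable_stepSlope (q : ℕ → ℝ) (n : ℕ) (φ : ℝ → X) :
    Integrable (stepSlope q n φ) :=
  integrable_finsetSum _ fun _ _ =>
    (integrable_indicator_iff measurableSet_Ioc).2 (integrableOn_const (by simp))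

theorem integral_stepSlope_succ [CompleteSpace X] {q : ℕ → ℝ} (hq : StrictMono q) {n i : ℕ}
    (hi : i < n) (φ : ℝ → X) :
    ∫ x in q i..q (i + 1), stepSlope q n φ x = φ (q (i + 1)) - φ (q i) := by
  have hlt : q i < q (i + 1) := hq (Nat.lt_succ_self i)
  rw [intervalIntegral.integral_of_le hlt.le, setIntegral_congr_fun measurableSet_Ioc
    (fun x hx => stepSlope_of_mem hq hi φ hx), ← intervalIntegral.integral_of_le hlt.le,
    intervalIntegral.integral_const, smul_inv_smul₀ (sub_pos.2 hlt).ne']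

theorem integral_stepSlope [CompleteSpace X] {q : ℕ → ℝ} (hq : StrictMono q) {n i : ℕ}
    (hi : i ≤ n) (φ : ℝ → X) :
    ∫ x in q 0..q i, stepSlope q n φ x = φ (q i) - φ (q 0) := by
  rw [← intervalIntegral.sum_integral_adjacent_intervals
    fun _ _ => (integrable_stepSlope q n φ).intervalIntegrable,
    ← Finset.sum_range_sub fun i => φ (q i)]
  exact Finset.sum_congr rfl fun j hj =>
    integral_stepSlope_succ hq ((Finset.mem_range.1 hj).trans_le hi) φ

theorem integral_stepSlope_last [CompleteSpace X] {q : ℕ → ℝ} (hq : StrictMono q) {n i : ℕ}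
    (hi : i ≤ n) (φ : ℝ → X) :
    ∫ x in q i..q n, stepSlope q n φ x = φ (q n) - φ (q i) := by
  have hint := fun a b : ℝ => (integrable_stepSlope q n φ).intervalIntegrable (a := a) (b := b)
  rw [← intervalIntegral.integral_interval_sub_left (hint (q 0) (q n)) (hint (q 0) (q i)),
    integral_stepSlope hq le_rfl, integral_stepSlope hq hi, sub_sub_sub_cancel_right]

end StepSlope

instance isFiniteMeasure_lebOnIoc : IsFiniteMeasure lebOnIoc :=
  ⟨by
    rw [lebOnIoc, comap_subtype_coe_apply measurableSet_Ioc, image_univ, Subtype.range_coe]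
    exact measure_Ioc_lt_top⟩

theorem integral_lebOnIoc {E : Type} [NormedAddCommGroup E] [NormedSpace ℝ E] (F : ℝ → E) :
    ∫ t, F t ∂lebOnIoc = ∫ x in (0 : ℝ)..1, F x := by
  rw [intervalIntegral.integral_of_le zero_le_one, lebOnIoc, integral_subtype_comap measurableSet_Ioc]

theorem setIntegral_lebOnIoc {E : Type} [NormedAddCommGroup E] [NormedSpace ℝ E] (F : ℝ → E)
    {p : ℝ} (hp : p ∈ Icc (0 : ℝ) 1) :
    ∫ t in {t : ↥(Ioc (0 : ℝ) 1) | p < t}, F t ∂lebOnIoc = ∫ x in p..1, F x := by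
  have h := (MeasurableEmbedding.subtype_coe
    (measurableSet_Ioc (a := (0 : ℝ)) (b := 1))).setIntegral_map (μ := lebOnIoc) F (Ioi p)
  rw [lebOnIoc, map_comap_subtype_coe measurableSet_Ioc, Measure.restrict_restrict measurableSet_Ioi,
    inter_comm, Ioc_inter_Ioi, sup_eq_right.2 hp.1] at h
  rw [intervalIntegral.integral_of_le hp.2, h]
  rfl

/-- The `σ`-algebra on `(0,1]` generated by the half-lines `(q i, 1]` for `i ≤ n`. -/
abbrev nodeAlgebra (q : ℕ → ℝ) (n : ℕ) : MeasurableSpace ↥(Ioc (0 : ℝ) 1) :=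
  MeasurableSpace.generateFrom {A | ∃ i ≤ n, A = {t : ↥(Ioc (0 : ℝ) 1) | q i < t}}

theorem measurableSet_nodeAlgebra {q : ℕ → ℝ} {n i : ℕ} (hi : i ≤ n) :
    MeasurableSet[nodeAlgebra q n] {t : ↥(Ioc (0 : ℝ) 1) | q i < t} :=
  MeasurableSpace.measurableSet_generateFrom ⟨i, hi, rfl⟩

theorem nodeAlgebra_le (q : ℕ → ℝ) (n : ℕ) :
    nodeAlgebra q n ≤ (inferInstance : MeasurableSpace ↥(Ioc (0 : ℝ) 1)) := by
  refine MeasurableSpace.generateFrom_le ?_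
  rintro _ ⟨i, _, rfl⟩
  exact measurableSet_lt measurable_const measurable_subtype_coe

theorem nodeAlgebra_mono {q q' : ℕ → ℝ} {n n' : ℕ} (h : ∀ i ≤ n, ∃ j ≤ n', q' j = q i) :
    nodeAlgebra q n ≤ nodeAlgebra q' n' := by
  refine MeasurableSpace.generateFrom_le ?_
  rintro _ ⟨i, hi, rfl⟩
  obtain ⟨j, hj, hji⟩ := h i hi
  rw [← hji]
  exact measurableSet_nodeAlgebra hj

theorem stronglyMeasurable_stepSlope_nodeAlgebra {X : Type} [NormedAddCommGroup X]
    [NormedSpace ℝ X] (q : ℕ → ℝ) (n : ℕ) (φ : ℝ → X) :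
    StronglyMeasurable[nodeAlgebra q n] fun t : ↥(Ioc (0 : ℝ) 1) => stepSlope q n φ t := by
  let _ := nodeAlgebra q n
  refine Finset.stronglyMeasurable_fun_sum _ fun i hi => ?_
  have hi' := Finset.mem_range.1 hi
  have hA : MeasurableSet[nodeAlgebra q n]
      {t : ↥(Ioc (0 : ℝ) 1) | (t : ℝ) ∈ Ioc (q i) (q (i + 1))} := by
    have : {t : ↥(Ioc (0 : ℝ) 1) | (t : ℝ) ∈ Ioc (q i) (q (i + 1))} =
        {t : ↥(Ioc (0 : ℝ) 1) | q i < t} \ {t : ↥(Ioc (0 : ℝ) 1) | q (i + 1) < t} := by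
      ext t; simp
    rw [this]
    exact (measurableSet_nodeAlgebra hi'.le).diff (measurableSet_nodeAlgebra hi')
  exact stronglyMeasurable_const.indicator hA

/-- Slopes of piecewise linear interpolations on successively refined partitions of `[0,1]`
form a bounded martingale; it diverges when the increments stay away from zero in `L¹`. -/
theorem exists_divergent_martingale_of_refining_partitions {X : Type} [NormedAddCommGroup X]
    [NormedSpace ℝ X] [CompleteSpace X] (φ : ℕ → ℝ → X) (q : ℕ → ℕ → ℝ) (n : ℕ → ℕ)
    (hq : ∀ k, StrictMono (q k)) (h0 : ∀ k, q k 0 = 0) (h1 : ∀ k, q k (n k) = 1)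
    (hLip : ∀ k, ∀ x ∈ Icc (0 : ℝ) 1, ∀ y ∈ Icc (0 : ℝ) 1, ‖φ k x - φ k y‖ ≤ |x - y|)
    (href : ∀ k, ∀ i ≤ n k, ∃ j ≤ n (k + 1), q (k + 1) j = q k i)
    (hagree : ∀ k, ∀ i ≤ n k, φ (k + 1) (q k i) = φ k (q k i))
    {c : ℝ} (hc : 0 < c)
    (hdiff : ∀ k, c ≤ ∫ x in (0 : ℝ)..1,
      ‖stepSlope (q (k + 1)) (n (k + 1)) (φ (k + 1)) x - stepSlope (q k) (n k) (φ k) x‖) :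
    ∃ (ℱ : Filtration ℕ (inferInstance : MeasurableSpace (↥(Set.Ioc (0 : ℝ) 1))))
      (Mart : ℕ → ↥(Set.Ioc (0 : ℝ) 1) → X),
      Martingale Mart ℱ lebOnIoc ∧
      (∀ (k : ℕ) (t : ↥(Set.Ioc (0 : ℝ) 1)), ‖Mart k t‖ ≤ 1) ∧
      ¬ ∃ g : ↥(Set.Ioc (0 : ℝ) 1) → X, Integrable g lebOnIoc ∧
          Filter.Tendsto (fun n => ∫ t, ‖Mart n t - g t‖ ∂lebOnIoc)
            Filter.atTop (nhds 0) := by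
  let ℱ : Filtration ℕ (inferInstance : MeasurableSpace (↥(Set.Ioc (0 : ℝ) 1))) :=
    { seq := fun k => nodeAlgebra (q k) (n k)
      mono' := monotone_nat_of_le_succ fun k => nodeAlgebra_mono (href k)
      le' := fun k => nodeAlgebra_le _ _ }
  let S : ℕ → ↥(Ioc (0 : ℝ) 1) → X := fun k t => stepSlope (q k) (n k) (φ k) t
  have hmem : ∀ k, ∀ i ≤ n k, q k i ∈ Icc (0 : ℝ) 1 := fun k i hi =>
    ⟨h0 k ▸ (hq k).monotone (Nat.zero_le i), h1 k ▸ (hq k).monotone hi⟩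
  have hS1 : ∀ k t, ‖S k t‖ ≤ 1 := fun k t =>
    norm_stepSlope_le_one (hq k) (fun i hi => by
      have h := hLip k _ (hmem k (i + 1) hi) _ (hmem k i hi.le)
      rwa [abs_of_pos (sub_pos.2 (hq k (Nat.lt_succ_self i)))] at h) _
  have hadp : StronglyAdapted ℱ S := fun k => stronglyMeasurable_stepSlope_nodeAlgebra _ _ _
  have hint : ∀ k, Integrable (S k) lebOnIoc := fun k =>
    Integrable.of_bound ((hadp k).mono (ℱ.le k)).aestronglyMeasurable 1
      (Eventually.of_forall (hS1 k))
  have hnode : ∀ k, ∀ i ≤ n k,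
      ∫ t in {t : ↥(Ioc (0 : ℝ) 1) | q k i < t}, S k t ∂lebOnIoc =
        ∫ t in {t : ↥(Ioc (0 : ℝ) 1) | q k i < t}, S (k + 1) t ∂lebOnIoc := by
    intro k i hi
    obtain ⟨j, hj, hji⟩ := href k i hi
    have e1 : ∫ x in q k i..1, stepSlope (q k) (n k) (φ k) x = φ k 1 - φ k (q k i) := by
      rw [← h1 k]; exact integral_stepSlope_last (hq k) hi _
    have e2 : ∫ x in q k i..1, stepSlope (q (k + 1)) (n (k + 1)) (φ (k + 1)) x =
        φ (k + 1) 1 - φ (k + 1) (q k i) := by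
      rw [← hji, ← h1 (k + 1)]; exact integral_stepSlope_last (hq (k + 1)) hj _
    have e3 : φ (k + 1) 1 = φ k 1 := by
      have := hagree k (n k) le_rfl
      rwa [h1] at this
    rw [setIntegral_lebOnIoc (stepSlope (q k) (n k) (φ k)) (hmem k i hi),
      setIntegral_lebOnIoc (stepSlope (q (k + 1)) (n (k + 1)) (φ (k + 1))) (hmem k i hi),
      e1, e2, e3, hagree k i hi]
  have huniv : ∀ k, ∫ t, S k t ∂lebOnIoc = ∫ t, S (k + 1) t ∂lebOnIoc := by
    intro k
    have h := hnode k 0 (Nat.zero_le _)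
    have hu : {t : ↥(Ioc (0 : ℝ) 1) | q k 0 < t} = univ := by
      rw [h0]; exact eq_univ_of_forall fun t => t.2.1
    simpa only [hu, Measure.restrict_univ] using h
  refine ⟨ℱ, S, martingale_of_setIntegral_eq_succ hadp hint ?_, hS1, ?_⟩
  · intro k s hs
    have hpi : IsPiSystem {A | ∃ i ≤ n k, A = {t : ↥(Ioc (0 : ℝ) 1) | q k i < t}} := by
      rintro _ ⟨i, hi, rfl⟩ _ ⟨j, hj, rfl⟩ _
      refine ⟨max i j, max_le hi hj, ?_⟩
      ext t
      simp [(hq k).monotone.map_max]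
    refine MeasurableSpace.induction_on_inter (m := nodeAlgebra (q k) (n k))
      (C := fun s _ => ∫ t in s, S k t ∂lebOnIoc = ∫ t in s, S (k + 1) t ∂lebOnIoc)
      rfl hpi (by simp) ?_ ?_ ?_ s hs
    · rintro _ ⟨i, hi, rfl⟩
      exact hnode k i hi
    · intro t ht h
      rw [setIntegral_compl (ℱ.le k t ht) (hint _), setIntegral_compl (ℱ.le k t ht) (hint _),
        h, huniv]
    · intro A hd hA h
      rw [integral_iUnion (fun i => ℱ.le k _ (hA i)) hd (hint _).integrableOn,
        integral_iUnion (fun i => ℱ.le k _ (hA i)) hd (hint _).integrableOn]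
      exact tsum_congr h
  · rintro ⟨g, hg, hlim⟩
    have hle : ∀ k, c ≤ ∫ t, ‖S (k + 1) t - g t‖ ∂lebOnIoc + ∫ t, ‖S k t - g t‖ ∂lebOnIoc := by
      intro k
      have i1 := ((hint (k + 1)).sub hg).norm
      have i2 := ((hint k).sub hg).norm
      calc c ≤ _ := hdiff k
        _ = ∫ t, ‖S (k + 1) t - S k t‖ ∂lebOnIoc := (integral_lebOnIoc _).symm
        _ ≤ ∫ t, (‖S (k + 1) t - g t‖ + ‖S k t - g t‖) ∂lebOnIoc := by
          refine integral_mono ((hint (k + 1)).sub (hint k)).norm (i1.add i2) fun t => ?_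
          have := norm_sub_le (S (k + 1) t - g t) (S k t - g t)
          rwa [sub_sub_sub_cancel_right] at this
        _ = _ := integral_add i1 i2
    have h2 := ge_of_tendsto' ((hlim.comp (tendsto_add_atTop_nat 1)).add hlim) hle
    linarith

theorem sum_norm_le_integral_norm_stepSlope_sub {X : Type} [NormedAddCommGroup X]
    [NormedSpace ℝ X] [CompleteSpace X] {p : ℕ → ℝ} (hp : StrictMono p) (m : ℕ) (ψ : ℝ → X)
    {F : ℝ → X} (hF : Integrable F) :
    ∑ i ∈ Finset.range m,
        ‖ψ (p (2 * i + 1)) - ψ (p (2 * i)) - ∫ x in p (2 * i)..p (2 * i + 1), F x‖ ≤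
      ∫ x in p 0..p (2 * m), ‖stepSlope p (2 * m) ψ x - F x‖ := by
  have hG : Integrable fun x => ‖stepSlope p (2 * m) ψ x - F x‖ :=
    ((integrable_stepSlope p (2 * m) ψ).sub hF).norm
  have hsum := intervalIntegral.sum_integral_adjacent_intervals (a := fun i => p (2 * i)) (n := m)
    fun i _ => hG.intervalIntegrable (a := p (2 * i)) (b := p (2 * (i + 1)))
  rw [mul_zero] at hsum
  rw [← hsum]
  refine Finset.sum_le_sum fun i hi => ?_
  have hi' : 2 * i < 2 * m := by have := Finset.mem_range.1 hi; omega
  have hle : p (2 * i) ≤ p (2 * i + 1) := (hp (Nat.lt_succ_self _)).le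
  have hle' : p (2 * i + 1) ≤ p (2 * (i + 1)) := hp.monotone (by omega)
  rw [← integral_stepSlope_succ hp hi' ψ, ← intervalIntegral.integral_sub
    (integrable_stepSlope p (2 * m) ψ).intervalIntegrable hF.intervalIntegrable]
  exact (intervalIntegral.norm_integral_le_integral_norm hle).trans
    (intervalIntegral.integral_mono_interval le_rfl hle hle'
      (Eventually.of_forall fun x => norm_nonneg _) hG.intervalIntegrable)

theorem exists_strictMono_interleave {m : ℕ} {q : Fin (m + 1) → ℝ} {s : Fin m → ℝ}
    (hs : ∀ i : Fin m, q i.castSucc < s i ∧ s i < q i.succ) :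
    ∃ p : ℕ → ℝ, StrictMono p ∧ (∀ j : Fin (m + 1), p (2 * j) = q j) ∧
      ∀ i : Fin m, p (2 * i + 1) = s i := by
  let Q : ℕ → ℝ := fun i => if h : i < m + 1 then q ⟨i, h⟩ else q (Fin.last m) + (i - m)
  let R : ℕ → ℝ := fun i => if h : i < m then s ⟨i, h⟩ else q (Fin.last m) + (i - m) + 1 / 2
  have hQR : ∀ i, Q i < R i ∧ R i < Q (i + 1) := by
    intro i
    rcases lt_trichotomy i m with h | rfl | h
    · have h1 : i < m + 1 := by omega
      simp only [Q, R, h, h1, Nat.add_lt_add_iff_right, dite_true]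
      exact hs ⟨i, h⟩
    · simp [Q, R, Fin.last]
      norm_num
    · have h1 : ¬ i < m + 1 := by omega
      have h2 : ¬ i < m := by omega
      simp only [Q, R, h1, h2, Nat.add_lt_add_iff_right, dite_false]
      push_cast
      constructor <;> linarith
  refine ⟨fun j => if Even j then Q (j / 2) else R (j / 2), strictMono_nat_of_lt_succ ?_, ?_, ?_⟩
  · intro j
    obtain ⟨i, rfl | rfl⟩ := Nat.even_or_odd' j
    · have h1 : (2 * i + 1) / 2 = i := by omega
      simpa [Nat.even_add_one, h1] using (hQR i).1
    · have h1 : (2 * i + 1) / 2 = i := by omega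
      have h2 : (2 * i + 1 + 1) / 2 = i + 1 := by omega
      simpa [Nat.even_add_one, h1, h2] using (hQR i).2
  · intro j
    have : (2 * (j : ℕ)) / 2 = j := by omega
    simp only [Q, even_two_mul, if_true, this, j.2, dite_true]
  · intro i
    have : (2 * (i : ℕ) + 1) / 2 = i := by omega
    simp [R, this, i.2]

open Classical in
/-- The path that follows `g'` on the intervals `[q i, q (i + 1)]` selected by `P`, and `g`
elsewhere. -/
def gluePath {M : Type} (g g' : ℝ → M) {m : ℕ} (q : Fin (m + 1) → ℝ) (P : Fin m → Prop)
    (t : ℝ) : M :=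
  if ∃ i, P i ∧ t ∈ Icc (q i.castSucc) (q i.succ) then g' t else g t

theorem gluePath_of_mem {M : Type} (g g' : ℝ → M) {m : ℕ} {q : Fin (m + 1) → ℝ} {P : Fin m → Prop}
    {i : Fin m} (hP : P i) {t : ℝ} (ht : t ∈ Icc (q i.castSucc) (q i.succ)) :
    gluePath g g' q P t = g' t :=
  if_pos ⟨i, hP, ht⟩

theorem gluePath_of_not {M : Type} {g g' : ℝ → M} {m : ℕ} {q : Fin (m + 1) → ℝ} (hq : StrictMono q)
    (hgg : ∀ i, g (q i) = g' (q i)) {P : Fin m → Prop}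
    {i : Fin m} (hP : ¬ P i) {t : ℝ} (ht : t ∈ Icc (q i.castSucc) (q i.succ)) :
    gluePath g g' q P t = g t := by
  unfold gluePath
  split_ifs with h
  · obtain ⟨j, hj, htj⟩ := h
    rcases lt_trichotomy i j with hij | rfl | hij
    · have : q i.succ ≤ q j.castSucc := hq.monotone (Fin.succ_le_castSucc_iff.2 hij)
      have : t = q i.succ := le_antisymm ht.2 (this.trans htj.1)
      rw [this, hgg]
    · exact absurd hj hP
    · have : q j.succ ≤ q i.castSucc := hq.monotone (Fin.succ_le_castSucc_iff.2 hij)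
      have : t = q i.castSucc := le_antisymm (htj.2.trans this) ht.1
      rw [this, hgg]
  · rfl

theorem gluePath_node {M : Type} {g g' : ℝ → M} {m : ℕ} {q : Fin (m + 1) → ℝ}
    (hgg : ∀ i, g (q i) = g' (q i)) (P : Fin m → Prop) (i : Fin (m + 1)) :
    gluePath g g' q P (q i) = g (q i) := by
  unfold gluePath
  split_ifs
  · exact (hgg i).symm
  · rfl

section Geodesic

variable {M : Type} [MetricSpace M] {u v : M}

theorem IsUVGeodesic.dist_left {g : ℝ → M} (hg : IsUVGeodesic u v g) {t : ℝ}
    (ht : t ∈ Icc 0 (dist u v)) : dist u (g t) = t := by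
  have h := hg.isom 0 ⟨le_rfl, dist_nonneg⟩ t ht
  rwa [hg.left 0 le_rfl, zero_sub, abs_neg, abs_of_nonneg ht.1] at h

theorem IsUVGeodesic.dist_right {g : ℝ → M} (hg : IsUVGeodesic u v g) {t : ℝ}
    (ht : t ∈ Icc 0 (dist u v)) : dist (g t) v = dist u v - t := by
  have h := hg.isom t ht (dist u v) ⟨dist_nonneg, le_rfl⟩
  rwa [hg.right _ le_rfl, abs_sub_comm, abs_of_nonneg (sub_nonneg.2 ht.2)] at h

theorem IsUVGeodesic.injOn {g : ℝ → M} (hg : IsUVGeodesic u v g) :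
    InjOn g (Icc 0 (dist u v)) := by
  intro s hs t ht h
  rw [← hg.dist_left hs, h, hg.dist_left ht]

theorem IsUVGeodesic.gluePath {g g' : ℝ → M} (hg : IsUVGeodesic u v g)
    (hg' : IsUVGeodesic u v g') {m : ℕ} {q : Fin (m + 1) → ℝ} (hq : StrictMono q)
    (h0 : q 0 = 0) (h1 : q (Fin.last m) = dist u v)
    (hgg : ∀ i, g (q i) = g' (q i)) (P : Fin m → Prop) :
    IsUVGeodesic u v (gluePath g g' q P) := by
  have hcases : ∀ t, _root_.gluePath g g' q P t = g t ∨ _root_.gluePath g g' q P t = g' t := by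
    intro t
    unfold _root_.gluePath
    split_ifs
    · exact Or.inr rfl
    · exact Or.inl rfl
  have hmem : ∀ i, q i ∈ Icc 0 (dist u v) := fun i =>
    ⟨h0 ▸ hq.monotone (Fin.zero_le i), h1 ▸ hq.monotone (Fin.le_last i)⟩
  have hleft : ∀ t ∈ Icc 0 (dist u v), dist u (_root_.gluePath g g' q P t) = t := by
    intro t ht
    rcases hcases t with h | h <;> rw [h]
    exacts [hg.dist_left ht, hg'.dist_left ht]
  have hright : ∀ t ∈ Icc 0 (dist u v),
      dist (_root_.gluePath g g' q P t) v = dist u v - t := by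
    intro t ht
    rcases hcases t with h | h <;> rw [h]
    exacts [hg.dist_right ht, hg'.dist_right ht]
  have hvia : ∀ a b : ℝ → M, IsUVGeodesic u v a → IsUVGeodesic u v b →
      ∀ s ∈ Icc 0 (dist u v), ∀ t ∈ Icc 0 (dist u v), ∀ j, a (q j) = b (q j) →
        s ≤ q j → q j ≤ t → dist (a s) (b t) ≤ t - s := by
    intro a b ha hb s hs t ht j hab hsj hjt
    have e1 := ha.isom s hs (q j) (hmem j)
    have e2 := hb.isom (q j) (hmem j) t ht
    rw [abs_of_nonpos (by linarith)] at e1 e2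
    have := dist_triangle (a s) (a (q j)) (b t)
    rw [hab] at this e1
    linarith
  have hle : ∀ s ∈ Icc 0 (dist u v), ∀ t ∈ Icc 0 (dist u v), s ≤ t →
      dist (_root_.gluePath g g' q P s) (_root_.gluePath g g' q P t) ≤ t - s := by
    intro s hs t ht hst
    have habs : |s - t| = t - s := by rw [abs_of_nonpos (by linarith)]; ring
    by_cases hPs : ∃ i, P i ∧ s ∈ Icc (q i.castSucc) (q i.succ) <;>
      by_cases hPt : ∃ i, P i ∧ t ∈ Icc (q i.castSucc) (q i.succ)
    · rw [_root_.gluePath, _root_.gluePath, if_pos hPs, if_pos hPt, hg'.isom s hs t ht, habs]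
    · rw [_root_.gluePath, _root_.gluePath, if_pos hPs, if_neg hPt]
      obtain ⟨i, hi, hsi⟩ := hPs
      have hit : q i.succ ≤ t := by
        by_contra! h
        exact hPt ⟨i, hi, hsi.1.trans hst, h.le⟩
      exact hvia g' g hg' hg s hs t ht _ (hgg _).symm hsi.2 hit
    · rw [_root_.gluePath, _root_.gluePath, if_neg hPs, if_pos hPt]
      obtain ⟨i, hi, hti⟩ := hPt
      have hsi : s ≤ q i.castSucc := by
        by_contra! h
        exact hPs ⟨i, hi, h.le, hst.trans hti.2⟩
      exact hvia g g' hg hg' s hs t ht _ (hgg _) hsi hti.1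
    · rw [_root_.gluePath, _root_.gluePath, if_neg hPs, if_neg hPt, hg.isom s hs t ht, habs]
  have heq : ∀ s ∈ Icc 0 (dist u v), ∀ t ∈ Icc 0 (dist u v), s ≤ t →
      dist (_root_.gluePath g g' q P s) (_root_.gluePath g g' q P t) = t - s := by
    intro s hs t ht hst
    refine le_antisymm (hle s hs t ht hst) ?_
    have := dist_triangle4 u (_root_.gluePath g g' q P s) (_root_.gluePath g g' q P t) v
    rw [hleft s hs, hright t ht] at this
    linarith
  refine ⟨fun t ht => ?_, fun t ht => ?_, fun s hs t ht => ?_⟩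
  · rcases hcases t with h | h <;> rw [h]
    exacts [hg.left t ht, hg'.left t ht]
  · rcases hcases t with h | h <;> rw [h]
    exacts [hg.right t ht, hg'.right t ht]
  · rcases le_total s t with h | h
    · rw [heq s hs t ht h, abs_sub_comm, abs_of_nonneg (sub_nonneg.2 h)]
    · rw [dist_comm, heq t ht s hs h, abs_of_nonneg (sub_nonneg.2 h)]

/-- One refinement step: inside a thick family a geodesic can be rerouted, keeping prescribed
points fixed, so that the slopes of its image are far in `L¹` from a given function. -/
theorem IsThickFamily.exists_step {X : Type} [NormedAddCommGroup X] [NormedSpace ℝ X]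
    [CompleteSpace X] {T : Set (ℝ → M)} (hT : IsThickFamily u v T) (hD : 0 < dist u v)
    {f : M → X} {l : ℝ} (hf : ∀ x y, l * dist x y ≤ ‖f x - f y‖) (hl : 0 < l)
    {K : ℝ} (hK : 0 < K) :
    ∃ c > 0, ∀ g ∈ T, ∀ (q : ℕ → ℝ) (n : ℕ), (∀ i ≤ n, q i ∈ Icc (0 : ℝ) 1) →
      ∀ F : ℝ → X, Integrable F →
      ∃ h ∈ T, ∃ (p : ℕ → ℝ) (N : ℕ), StrictMono p ∧ p 0 = 0 ∧ p N = 1 ∧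
        (∀ i ≤ n, ∃ j ≤ N, p j = q i) ∧
        (∀ i ≤ n, h (dist u v * q i) = g (dist u v * q i)) ∧
        c ≤ ∫ x in (0 : ℝ)..1,
          ‖stepSlope p N (fun x => K • f (h (dist u v * x))) x - F x‖ := by
  obtain ⟨-, hgeo, α, hα, H⟩ := hT
  refine ⟨K * l * α / 2, by positivity, fun g hg q n hq F hF => ?_⟩
  set D := dist u v
  have hr : ∀ i : Fin (n + 1), D * q i ∈ Icc 0 D := fun i =>
    have hi := hq i (Nat.lt_succ_iff.1 i.2)
    ⟨mul_nonneg hD.le hi.1, mul_le_of_le_one_right hD.le hi.2⟩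
  obtain ⟨g', hg', m, Q, s, hQ, hQ0, hQ1, hs, hgg, hrQ, hsum, hmix⟩ :=
    H g hg (n + 1) (fun i => D * q i) hr
  obtain ⟨P, hP, hPQ, hPs⟩ := exists_strictMono_interleave hs
  let δ : Fin m → ℝ := fun i => K * l * dist (g (s i)) (g' (s i))
  let w : ℕ → X := fun i => ∫ x in P (2 * i) / D..P (2 * i + 1) / D, F x
  let C : Fin m → Prop := fun i => ‖K • f (g (s i)) - K • f (g (Q i.castSucc)) - w i‖ < δ i / 2
  let h := gluePath g g' Q C
  have hnode : ∀ i, h (Q i) = g (Q i) := gluePath_node hgg C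
  have hrep : ∀ i ≤ n, ∃ j : Fin (m + 1), D * q i = Q j := by
    intro i hi
    obtain ⟨j, hj⟩ := hrQ ⟨i, Nat.lt_succ_iff.2 hi⟩
    exact ⟨j, (hgeo g hg).injOn (hr ⟨i, Nat.lt_succ_iff.2 hi⟩)
      ⟨hQ0 ▸ hQ.monotone (Fin.zero_le j), (hQ.monotone (Fin.le_last j)).trans hQ1.le⟩ hj⟩
  have hp : StrictMono fun i => P i / D := fun i j hij => div_lt_div_of_pos_right (hP hij) hD
  have hp0 : P 0 / D = 0 := by
    have := hPQ 0
    simp only [Fin.val_zero, mul_zero] at this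
    rw [this, hQ0, zero_div]
  have hp1 : P (2 * m) / D = 1 := by
    have := hPQ (Fin.last m)
    simp only [Fin.val_last] at this
    rw [this, hQ1, div_self hD.ne']
  have hfar : ∀ i : Fin m, δ i / 2 ≤ ‖K • f (h (s i)) - K • f (h (Q i.castSucc)) - w i‖ := by
    intro i
    have hsi : s i ∈ Icc (Q i.castSucc) (Q i.succ) := ⟨(hs i).1.le, (hs i).2.le⟩
    rw [hnode]
    by_cases hC : C i
    · have e : h (s i) = g' (s i) := gluePath_of_mem g g' hC hsi
      rw [e]
      have h1 : δ i ≤ ‖K • f (g (s i)) - K • f (g' (s i))‖ := by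
        rw [← smul_sub, norm_smul, Real.norm_of_nonneg hK.le]
        simpa only [δ, mul_assoc] using mul_le_mul_of_nonneg_left (hf (g (s i)) (g' (s i))) hK.le
      have h2 := norm_sub_le (K • f (g (s i)) - K • f (g (Q i.castSucc)) - w i)
        (K • f (g' (s i)) - K • f (g (Q i.castSucc)) - w i)
      rw [sub_sub_sub_cancel_right, sub_sub_sub_cancel_right] at h2
      have h3 : ‖K • f (g (s i)) - K • f (g (Q i.castSucc)) - w i‖ < δ i / 2 := hC
      linarith
    · have e : h (s i) = g (s i) := gluePath_of_not hQ hgg hC hsi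
      rw [e]
      exact not_lt.1 hC
  refine ⟨h, hmix h ((hgeo g hg).gluePath (hgeo g' hg') hQ hQ0 hQ1 hgg C) fun i => ?_,
    fun i => P i / D, 2 * m, hp, hp0, hp1, fun i hi => ?_, fun i hi => ?_, ?_⟩
  · by_cases hC : C i
    · exact Or.inr fun t ht => gluePath_of_mem g g' hC ht
    · exact Or.inl fun t ht => gluePath_of_not hQ hgg hC ht
  · obtain ⟨j, hj⟩ := hrep i hi
    exact ⟨2 * j, by have := j.2; omega, by
      simp only [hPQ, ← hj, mul_div_cancel_left₀ _ hD.ne']⟩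
  · obtain ⟨j, hj⟩ := hrep i hi
    rw [hj, hnode]
  · have hbound := sum_norm_le_integral_norm_stepSlope_sub hp m
      (fun x => K • f (h (D * x))) hF
    simp only [hp0, hp1, mul_div_cancel₀ _ hD.ne'] at hbound
    refine le_trans ?_ hbound
    rw [Finset.sum_range]
    calc K * l * α / 2 ≤ ∑ i, δ i / 2 := by
          rw [← Finset.sum_div, ← Finset.mul_sum]
          gcongr
      _ ≤ _ := Finset.sum_le_sum fun i _ => by
          have h1 := hPQ i.castSucc
          have h2 := hPs i
          have h3 := hfar i
          simp only [Fin.val_castSucc] at h1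
          simpa only [w, h1, h2] using h3

theorem IsThickFamily.dist_pos {T : Set (ℝ → M)} (hT : IsThickFamily u v T) :
    0 < dist u v := by
  obtain ⟨⟨g, hg⟩, -, α, hα, H⟩ := hT
  obtain ⟨g', -, m, Q, s, hQ, hQ0, hQ1, -, -, -, hsum, -⟩ :=
    H g hg 0 Fin.elim0 fun i => i.elim0
  rw [← hQ1, ← hQ0]
  refine hQ (Fin.lt_def.2 (Nat.pos_of_ne_zero ?_))
  intro h
  have hm : m = 0 := by simpa using h
  subst hm
  simp only [Finset.univ_eq_empty, Finset.sum_empty] at hsum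
  linarith

end Geodesic

/-- If a metric space containing a thick family of geodesics admits a bilipschitz
embedding into a Banach space `X`, then there is a bounded divergent `X`-valued
martingale on `((0,1], Borel, Lebesgue)`; in particular `X` fails the Radon–Nikodým
property. -/
theorem thick_family_embedding_gives_divergent_martingale
    (M : Type) [MetricSpace M]
    (X : Type) [NormedAddCommGroup X] [NormedSpace ℝ X] [CompleteSpace X]
    (u v : M) (T : Set (ℝ → M)) (hT : IsThickFamily u v T)
    (f : M → X) (l L : ℝ) (hl : 0 < l) (hlL : l ≤ L)
    (hf : ∀ x y : M, l * dist x y ≤ ‖f x - f y‖ ∧ ‖f x - f y‖ ≤ L * dist x y) :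
    ∃ (ℱ : Filtration ℕ (inferInstance : MeasurableSpace (↥(Set.Ioc (0 : ℝ) 1))))
      (Mart : ℕ → ↥(Set.Ioc (0 : ℝ) 1) → X),
      Martingale Mart ℱ lebOnIoc ∧
      (∀ (k : ℕ) (t : ↥(Set.Ioc (0 : ℝ) 1)), ‖Mart k t‖ ≤ 1) ∧
      ¬ ∃ g : ↥(Set.Ioc (0 : ℝ) 1) → X, Integrable g lebOnIoc ∧
          Filter.Tendsto (fun n => ∫ t, ‖Mart n t - g t‖ ∂lebOnIoc)
            Filter.atTop (nhds 0) := by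
  have hD := hT.dist_pos
  have hL : 0 < L := hl.trans_le hlL
  set D := dist u v
  have hK : 0 < (L * D)⁻¹ := by positivity
  obtain ⟨c, hc, step⟩ := hT.exists_step hD (fun x y => (hf x y).1) hl hK
  obtain ⟨⟨g₀, hg₀⟩, hgeo, -⟩ := hT
  let φ : (ℝ → M) → ℝ → X := fun g x => (L * D)⁻¹ • f (g (D * x))
  let σ := {x : (ℝ → M) × (ℕ → ℝ) × ℕ // x.1 ∈ T ∧ StrictMono x.2.1 ∧ x.2.1 0 = 0 ∧
    x.2.1 x.2.2 = 1}
  have hnext : ∀ x : σ, ∃ y : σ,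
      (∀ i ≤ x.1.2.2, ∃ j ≤ y.1.2.2, y.1.2.1 j = x.1.2.1 i) ∧
      (∀ i ≤ x.1.2.2, φ y.1.1 (x.1.2.1 i) = φ x.1.1 (x.1.2.1 i)) ∧
      c ≤ ∫ t in (0 : ℝ)..1, ‖stepSlope y.1.2.1 y.1.2.2 (φ y.1.1) t -
        stepSlope x.1.2.1 x.1.2.2 (φ x.1.1) t‖ := by
    rintro ⟨⟨g, q, n⟩, hg, hq, h0, h1⟩
    dsimp only at hg hq h0 h1
    obtain ⟨h, hh, p, N, hp, hp0, hp1, href, hagree, hle⟩ := step g hg q n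
      (fun i hi => ⟨h0 ▸ hq.monotone (Nat.zero_le i), h1 ▸ hq.monotone hi⟩)
      (stepSlope q n (φ g)) (integrable_stepSlope _ _ _)
    exact ⟨⟨⟨h, p, N⟩, hh, hp, hp0, hp1⟩, href,
      fun i hi => congrArg (fun z => (L * D)⁻¹ • f z) (hagree i hi), hle⟩
  choose next hnext using hnext
  let x₀ : σ := ⟨⟨g₀, fun i => i, 1⟩, hg₀, Nat.strictMono_cast, Nat.cast_zero, Nat.cast_one⟩
  let x : ℕ → σ := fun k => next^[k] x₀
  have hx : ∀ k, x (k + 1) = next (x k) := fun k => Function.iterate_succ_apply' next k x₀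
  refine exists_divergent_martingale_of_refining_partitions (fun k => φ (x k).1.1)
    (fun k => (x k).1.2.1) (fun k => (x k).1.2.2) (fun k => (x k).2.2.1)
    (fun k => (x k).2.2.2.1) (fun k => (x k).2.2.2.2) ?_ (fun k => ?_) (fun k => ?_) hc
    (fun k => ?_)
  · intro k a ha b hb
    have hmem : ∀ a ∈ Icc (0 : ℝ) 1, D * a ∈ Icc 0 D := fun a ha =>
      ⟨mul_nonneg hD.le ha.1, mul_le_of_le_one_right hD.le ha.2⟩
    have h := (hf ((x k).1.1 (D * a)) ((x k).1.1 (D * b))).2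
    rw [(hgeo _ (x k).2.1).isom _ (hmem a ha) _ (hmem b hb), ← mul_sub, abs_mul,
      abs_of_pos hD, ← mul_assoc] at h
    simp only [φ]
    rw [← smul_sub, norm_smul, Real.norm_of_nonneg hK.le]
    exact (inv_mul_le_iff₀ (by positivity)).2 h
  · rw [hx]; exact (hnext (x k)).1
  · rw [hx]; exact (hnext (x k)).2.1
  · rw [hx]; exact (hnext (x k)).2.2
end
end

section
/- If a Banach space X contains a bounded δ-bush for some δ > 0 (equivalently, X fails the Radon–Nikodým property), then there exist a metric space M, points u, v ∈ M, a thick family of uv-geodesics in M, and a bilipschitz embedding of M into X. -/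
noncomputable section

open Set

/-- `z` is a `δ`-bush in `X`: `m 0 = 1`, and each vector of level `n` is a convex
combination of the vectors of level `n+1` belonging to its cell of the partition, every
member of the cell being at distance at least `δ` from it.  (The partition of level `n+1`
is encoded by the "parent" map `p`, its cells are the fibers of `p`.) -/
def IsDeltaBush (X : Type) [NormedAddCommGroup X] [NormedSpace ℝ X] (δ : ℝ)
    (m : ℕ → ℕ) (z : (n : ℕ) → Fin (m n) → X) : Prop :=
  m 0 = 1 ∧
  ∀ n : ℕ, ∃ (p : Fin (m (n + 1)) → Fin (m n)) (lam : Fin (m (n + 1)) → ℝ),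
    (∀ j, 0 ≤ lam j) ∧
    (∀ j, δ ≤ ‖z (n + 1) j - z n (p j)‖) ∧
    (∀ k : Fin (m n), ∑ j ∈ Finset.univ.filter (fun j => p j = k), lam j = 1) ∧
    (∀ k : Fin (m n), z n k = ∑ j ∈ Finset.univ.filter (fun j => p j = k), lam j • z (n + 1) j)

section Subdivisions

/-- The points of `l`, listed after `a`, form a strictly increasing subdivision of `[a, b]`. -/
def IsSubdivision : List ℝ → ℝ → ℝ → Prop
  | [], a, b => a = b
  | c :: l, a, b => a < c ∧ IsSubdivision l c b

/-- The sum of the norms of the second differences of `h` over the intervals of the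
subdivision which starts at `a` and continues with the points of `l`. -/
def secondDiffSum {V : Type*} [NormedAddCommGroup V] (h : ℝ → V) : List ℝ → ℝ → ℝ
  | [], _ => 0
  | c :: l, a => ‖h ((a + c) / 2) + h ((a + c) / 2) - h a - h c‖ + secondDiffSum h l c

theorem IsSubdivision.le : ∀ {l : List ℝ} {a b : ℝ}, IsSubdivision l a b → a ≤ b
  | [], _, _, h => le_of_eq h
  | _ :: _, _, _, h => h.1.le.trans (IsSubdivision.le h.2)

theorem IsSubdivision.append : ∀ {l₁ l₂ : List ℝ} {a b c : ℝ},
    IsSubdivision l₁ a b → IsSubdivision l₂ b c → IsSubdivision (l₁ ++ l₂) a c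
  | [], _, _, _, _, h₁, h₂ => by
    have h : _ = _ := h₁
    subst h
    exact h₂
  | _ :: _, _, _, _, _, h₁, h₂ => ⟨h₁.1, IsSubdivision.append h₁.2 h₂⟩

theorem isSubdivision_singleton {a b : ℝ} (h : a < b) : IsSubdivision [b] a b := ⟨h, rfl⟩

theorem IsSubdivision.end_mem : ∀ {l : List ℝ} {a b : ℝ}, IsSubdivision l a b → b ∈ a :: l
  | [], _, _, h => by
    have h : _ = _ := h
    simp [h]
  | _ :: _, _, _, h => List.mem_cons_of_mem _ (IsSubdivision.end_mem h.2)

theorem IsSubdivision.mem_Icc : ∀ {l : List ℝ} {a b : ℝ}, IsSubdivision l a b →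
    ∀ x ∈ a :: l, x ∈ Icc a b
  | [], _, _, h, x, hx => by
    have h : _ = _ := h
    simp_all
  | c :: l, a, b, h, x, hx => by
    rcases List.mem_cons.1 hx with rfl | hx
    · exact ⟨le_rfl, IsSubdivision.le h⟩
    · have := IsSubdivision.mem_Icc h.2 x hx
      exact ⟨h.1.le.trans this.1, this.2⟩

theorem IsSubdivision.pairwise : ∀ {l : List ℝ} {a b : ℝ}, IsSubdivision l a b →
    (a :: l).Pairwise (· < ·)
  | [], _, _, _ => by simp
  | c :: l, a, b, h => by
    refine List.pairwise_cons.2 ⟨fun x hx => ?_, IsSubdivision.pairwise h.2⟩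
    exact h.1.trans_le (IsSubdivision.mem_Icc h.2 x hx).1

theorem IsSubdivision.getElem_length : ∀ {l : List ℝ} {a b : ℝ}, IsSubdivision l a b →
    (a :: l)[l.length]'(by simp) = b
  | [], _, _, h => h
  | _ :: _, _, _, h => by
    simpa using IsSubdivision.getElem_length h.2

variable {V : Type*} [NormedAddCommGroup V]

theorem secondDiffSum_nonneg (h : ℝ → V) : ∀ (l : List ℝ) (a : ℝ), 0 ≤ secondDiffSum h l a
  | [], _ => le_rfl
  | _ :: l, _ => add_nonneg (norm_nonneg _) (secondDiffSum_nonneg h l _)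

theorem secondDiffSum_append (h : ℝ → V) : ∀ {l₁ l₂ : List ℝ} {a b : ℝ}, IsSubdivision l₁ a b →
    secondDiffSum h (l₁ ++ l₂) a = secondDiffSum h l₁ a + secondDiffSum h l₂ b
  | [], _, _, _, h₁ => by
    have h : _ = _ := h₁
    simp [secondDiffSum, h]
  | _ :: _, _, _, _, h₁ => by
    simp only [List.cons_append, secondDiffSum, secondDiffSum_append h h₁.2, add_assoc]

theorem secondDiffSum_congr {g h : ℝ → V} (v : V) : ∀ {l : List ℝ} {a b : ℝ},
    IsSubdivision l a b → (∀ t ∈ Icc a b, g t = h t + v) →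
      secondDiffSum g l a = secondDiffSum h l a
  | [], _, _, _, _ => rfl
  | c :: l, a, b, hl, hgh => by
    have hc := IsSubdivision.le hl.2
    have hac := hl.1
    simp only [secondDiffSum]
    rw [secondDiffSum_congr v hl.2 fun t ht => hgh t ⟨hl.1.le.trans ht.1, ht.2⟩,
      hgh a ⟨le_rfl, by linarith⟩, hgh c ⟨hac.le, hc⟩, hgh _ ⟨by linarith, by linarith⟩]
    congr 2
    abel

/-- Subdividing the reflected interval, one recovers the second differences of a curve from
those of the curve traversed backwards. -/
theorem exists_secondDiffSum_reverse (g : ℝ → V) (v : V) (σ : ℝ) : ∀ {l : List ℝ} {a b : ℝ},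
    IsSubdivision l a b → ∃ l', IsSubdivision l' (σ - b) (σ - a) ∧
      secondDiffSum (fun t => v - g (σ - t)) l' (σ - b) = secondDiffSum g l a
  | [], a, b, hl => by
    have h : a = b := hl
    exact ⟨[], by rw [h]; rfl, rfl⟩
  | c :: l, a, b, hl => by
    obtain ⟨l', hl', hs⟩ := exists_secondDiffSum_reverse g v σ hl.2
    have hlast : IsSubdivision [σ - a] (σ - c) (σ - a) :=
      isSubdivision_singleton (by linarith [hl.1])
    refine ⟨l' ++ [σ - a], hl'.append hlast, ?_⟩
    rw [secondDiffSum_append _ hl', hs]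
    simp only [secondDiffSum, add_zero]
    rw [add_comm, ← norm_neg]
    have h₁ : σ - (σ - c + (σ - a)) / 2 = (a + c) / 2 := by ring
    rw [h₁, sub_sub_cancel, sub_sub_cancel]
    congr 2
    abel

/-- A property of pairs `s ≤ t` which can be chained passes from two adjacent intervals to
their union. -/
theorem forall_subinterval_union {Q : ℝ → ℝ → Prop}
    (hQ : ∀ r s t, r ≤ s → s ≤ t → Q r s → Q s t → Q r t) {a b c : ℝ}
    (h₁ : ∀ s t, a ≤ s → s ≤ t → t ≤ b → Q s t) (h₂ : ∀ s t, b ≤ s → s ≤ t → t ≤ c → Q s t) :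
    ∀ s t, a ≤ s → s ≤ t → t ≤ c → Q s t := by
  intro s t hs hst ht
  rcases le_total t b with htb | htb
  · exact h₁ s t hs hst htb
  rcases le_total b s with hbs | hbs
  · exact h₂ s t hbs hst ht
  · exact hQ s b t hbs htb (h₁ s b hs hbs le_rfl) (h₂ b t le_rfl htb ht)

/-- Every subinterval of `[a, b]` has a subdivision over which the second differences of `h`
add up to at least `α` times its length. -/
def IsRough (α : ℝ) (h : ℝ → V) (a b : ℝ) : Prop :=
  ∀ s t, a ≤ s → s ≤ t → t ≤ b →
    ∃ l, IsSubdivision l s t ∧ α * (t - s) ≤ secondDiffSum h l s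

theorem exists_secondDiffSum_trans {α : ℝ} {h : ℝ → V} {r s t : ℝ}
    (h₁ : ∃ l, IsSubdivision l r s ∧ α * (s - r) ≤ secondDiffSum h l r)
    (h₂ : ∃ l, IsSubdivision l s t ∧ α * (t - s) ≤ secondDiffSum h l s) :
    ∃ l, IsSubdivision l r t ∧ α * (t - r) ≤ secondDiffSum h l r := by
  obtain ⟨l₁, hl₁, hs₁⟩ := h₁
  obtain ⟨l₂, hl₂, hs₂⟩ := h₂
  refine ⟨l₁ ++ l₂, hl₁.append hl₂, ?_⟩
  rw [secondDiffSum_append _ hl₁]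
  linarith

theorem IsRough.union {α : ℝ} {h : ℝ → V} {a b c : ℝ} (h₁ : IsRough α h a b)
    (h₂ : IsRough α h b c) : IsRough α h a c :=
  forall_subinterval_union
    (Q := fun s t => ∃ l, IsSubdivision l s t ∧ α * (t - s) ≤ secondDiffSum h l s)
    (fun _ _ _ _ _ => exists_secondDiffSum_trans) h₁ h₂

theorem IsRough.mono {α : ℝ} {h : ℝ → V} {a b a' b' : ℝ} (hh : IsRough α h a b) (ha : a ≤ a')
    (hb : b' ≤ b) : IsRough α h a' b' :=
  fun s t hs hst ht => hh s t (ha.trans hs) hst (ht.trans hb)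

theorem IsRough.congr {α : ℝ} {g h : ℝ → V} {a b : ℝ} (hh : IsRough α h a b)
    (hgh : ∀ t ∈ Icc a b, g t = h t) : IsRough α g a b := by
  intro s t hs hst ht
  obtain ⟨l, hl, hls⟩ := hh s t hs hst ht
  refine ⟨l, hl, ?_⟩
  rwa [secondDiffSum_congr 0 hl fun x hx => ?_]
  rw [add_zero, hgh x ⟨hs.trans hx.1, hx.2.trans ht⟩]

theorem IsRough.reverse {α : ℝ} {g : ℝ → V} {a b : ℝ} (hg : IsRough α g a b) (v : V) :
    IsRough α (fun t => v - g (a + b - t)) a b := by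
  intro s t hs hst ht
  obtain ⟨l, hl, hls⟩ := hg (a + b - t) (a + b - s) (by linarith) (by linarith) (by linarith)
  obtain ⟨l', hl', hs'⟩ := exists_secondDiffSum_reverse g v (a + b) hl
  simp only [sub_sub_cancel] at hl' hs'
  refine ⟨l', hl', ?_⟩
  rw [hs']
  linarith

/-- Subdivisions witnessing roughness can be made to pass through prescribed points. -/
theorem IsRough.exists_subdivision {α : ℝ} {h : ℝ → V} (R : Finset ℝ) : ∀ {a b : ℝ}, a ≤ b →
    IsRough α h a b → ∃ l, IsSubdivision l a b ∧ α * (b - a) ≤ secondDiffSum h l a ∧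
      ∀ r ∈ R, r ∈ Icc a b → r ∈ a :: l := by
  induction R using Finset.induction_on with
  | empty =>
    intro a b hab hh
    obtain ⟨l, hl, hs⟩ := hh a b le_rfl hab le_rfl
    exact ⟨l, hl, hs, by simp⟩
  | insert x R _ ih =>
    intro a b hab hh
    by_cases hx : x ∈ Icc a b
    · obtain ⟨l₁, hl₁, hs₁, hR₁⟩ := ih hx.1 (hh.mono le_rfl hx.2)
      obtain ⟨l₂, hl₂, hs₂, hR₂⟩ := ih hx.2 (hh.mono hx.1 le_rfl)
      refine ⟨l₁ ++ l₂, hl₁.append hl₂, ?_, fun r hr hrab => ?_⟩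
      · rw [secondDiffSum_append _ hl₁]
        linarith
      · have hx₁ := hl₁.end_mem
        have hsub : ∀ y, y ∈ a :: l₁ ∨ y ∈ x :: l₂ → y ∈ a :: (l₁ ++ l₂) := by
          simp only [List.mem_cons, List.mem_append] at hx₁ ⊢
          rintro y ((h | h) | (h | h))
          · exact .inl h
          · exact .inr (.inl h)
          · subst h; tauto
          · exact .inr (.inr h)
        apply hsub
        rcases Finset.mem_insert.1 hr with rfl | hr
        · exact .inl hx₁
        rcases le_total r x with hrx | hrx
        · exact .inl (hR₁ r hr ⟨hrab.1, hrx⟩)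
        · exact .inr (hR₂ r hr ⟨hrx, hrab.2⟩)
    · obtain ⟨l, hl, hs, hR⟩ := ih hab hh
      refine ⟨l, hl, hs, fun r hr hrab => ?_⟩
      rcases Finset.mem_insert.1 hr with rfl | hr
      · exact absurd hrab hx
      · exact hR r hr hrab

/-- The curve `g` with its restriction to each interval of a subdivision traversed backwards. -/
def reversePieces (g : ℝ → V) : List ℝ → ℝ → ℝ → V
  | [], _ => g
  | c :: l, a => fun t => if t ≤ c then g a + g c - g (a + c - t) else reversePieces g l c t

theorem reversePieces_start (g : ℝ → V) : ∀ {l : List ℝ} {a b : ℝ}, IsSubdivision l a b →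
    reversePieces g l a a = g a
  | [], _, _, _ => rfl
  | c :: l, a, b, hl => by simp [reversePieces, hl.1.le]

theorem reversePieces_cons_left (g : ℝ → V) (c : ℝ) (l : List ℝ) (a t : ℝ) (ht : t ≤ c) :
    reversePieces g (c :: l) a t = g a + g c - g (a + c - t) := by
  simp [reversePieces, ht]

theorem reversePieces_cons_right (g : ℝ → V) {c : ℝ} {l : List ℝ} {a b t : ℝ}
    (hl : IsSubdivision (c :: l) a b) (ht : c ≤ t) :
    reversePieces g (c :: l) a t = reversePieces g l c t := by
  rcases ht.eq_or_lt with rfl | ht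
  · rw [reversePieces_cons_left _ _ _ _ _ le_rfl, reversePieces_start g hl.2]
    simp
  · simp [reversePieces, ht]

theorem reversePieces_apply_of_mem (g : ℝ → V) : ∀ {l : List ℝ} {a b : ℝ}, IsSubdivision l a b →
    ∀ x ∈ a :: l, reversePieces g l a x = g x
  | [], _, _, _, _, _ => rfl
  | c :: l, a, b, hl, x, hx => by
    rcases List.mem_cons.1 hx with rfl | hx
    · exact reversePieces_start g hl
    · rw [reversePieces_cons_right g hl (hl.2.mem_Icc x hx).1,
        reversePieces_apply_of_mem g hl.2 x hx]

theorem isRough_reversePieces {α : ℝ} {g : ℝ → V} : ∀ {l : List ℝ} {a b : ℝ}, IsSubdivision l a b →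
    IsRough α g a b → IsRough α (reversePieces g l a) a b
  | [], _, _, _, hg => hg
  | c :: l, a, b, hl, hg => by
    refine IsRough.union (b := c) (((hg.mono le_rfl hl.2.le).reverse (g a + g c)).congr ?_)
      ((isRough_reversePieces hl.2 (hg.mono hl.1.le le_rfl)).congr ?_)
    · intro t ht
      exact reversePieces_cons_left g c l a t ht.2
    · intro t ht
      exact reversePieces_cons_right g hl ht.1

/-- `h` is `1`-Lipschitz on `[a, b]`. -/
def IsShortOn (h : ℝ → V) (a b : ℝ) : Prop :=
  ∀ s t, a ≤ s → s ≤ t → t ≤ b → ‖h t - h s‖ ≤ t - s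

theorem IsShortOn.union {h : ℝ → V} {a b c : ℝ} (h₁ : IsShortOn h a b) (h₂ : IsShortOn h b c) :
    IsShortOn h a c := by
  refine forall_subinterval_union (fun r s t _ _ hrs hst => ?_) h₁ h₂
  rw [← sub_add_sub_cancel (h t) (h s) (h r)]
  exact (norm_add_le _ _).trans (by linarith)

theorem IsShortOn.mono {h : ℝ → V} {a b a' b' : ℝ} (hh : IsShortOn h a b) (ha : a ≤ a')
    (hb : b' ≤ b) : IsShortOn h a' b' :=
  fun s t hs hst ht => hh s t (ha.trans hs) hst (ht.trans hb)

theorem isShortOn_reversePieces {g : ℝ → V} : ∀ {l : List ℝ} {a b : ℝ}, IsSubdivision l a b →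
    IsShortOn g a b → IsShortOn (reversePieces g l a) a b
  | [], _, _, _, hg => hg
  | c :: l, a, b, hl, hg => by
    refine IsShortOn.union (b := c) (fun s t hs hst ht => ?_) (fun s t hs hst ht => ?_)
    · rw [reversePieces_cons_left g c l a t ht, reversePieces_cons_left g c l a s (hst.trans ht)]
      have := hg (a + c - t) (a + c - s) (by linarith) (by linarith) (by linarith [hl.2.le])
      rw [sub_sub_sub_cancel_left]
      linarith
    · rw [reversePieces_cons_right g hl (hs.trans hst), reversePieces_cons_right g hl hs]
      exact isShortOn_reversePieces hl.2 (hg.mono hl.1.le le_rfl) s t hs hst ht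

theorem sum_norm_sub_reversePieces (g : ℝ → V) : ∀ {l : List ℝ} {a b : ℝ}, IsSubdivision l a b →
    ∑ i : Fin l.length, ‖g (((a :: l)[(i : ℕ)] + (a :: l)[(i : ℕ) + 1]) / 2) -
      reversePieces g l a (((a :: l)[(i : ℕ)] + (a :: l)[(i : ℕ) + 1]) / 2)‖ = secondDiffSum g l a
  | [], _, _, _ => by simp [secondDiffSum]
  | c :: l, a, b, hl => by
    have hac := hl.1
    refine (Fin.sum_univ_succ (n := l.length) _).trans ?_
    simp only [secondDiffSum]
    congr 1
    · simp only [Fin.val_zero, List.getElem_cons_zero, zero_add, List.getElem_cons_succ]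
      rw [reversePieces_cons_left g c l a _ (by linarith)]
      have h₁ : a + c - (a + c) / 2 = (a + c) / 2 := by ring
      rw [h₁]
      congr 1
      abel
    · rw [← sum_norm_sub_reversePieces g hl.2]
      refine Finset.sum_congr rfl fun i _ => ?_
      simp only [Fin.val_succ, List.getElem_cons_succ]
      have h₁ := (hl.2.mem_Icc _ (List.getElem_mem (l := c :: l) (n := i) (by simp))).1
      have h₂ := (hl.2.mem_Icc _ (List.getElem_mem (l := c :: l) (n := i + 1)
        (by simp))).1
      rw [List.getElem_cons_succ] at h₂
      rw [reversePieces_cons_right g hl (by linarith)]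

theorem IsRough.of_piecewise {α : ℝ} {g g' h : ℝ → V} : ∀ {l : List ℝ} {a b : ℝ},
    IsSubdivision l a b → IsRough α g a b → IsRough α g' a b →
    (∀ (i : ℕ) (hi : i < l.length),
      (∀ t ∈ Icc ((a :: l)[i]'(by simp; omega)) ((a :: l)[i + 1]'(by simpa)), h t = g t) ∨
      (∀ t ∈ Icc ((a :: l)[i]'(by simp; omega)) ((a :: l)[i + 1]'(by simpa)), h t = g' t)) →
    IsRough α h a b
  | [], a, b, hl, hg, _, _ => by
    have hab : a = b := hl
    intro s t hs hst ht
    exact ⟨[], show s = t by linarith, by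
      have : t - s = 0 := by linarith
      simp [secondDiffSum, this]⟩
  | c :: l, a, b, hl, hg, hg', hh => by
    refine IsRough.union (b := c) ?_ (IsRough.of_piecewise hl.2 (hg.mono hl.1.le le_rfl)
      (hg'.mono hl.1.le le_rfl) fun i hi => ?_)
    · rcases hh 0 (by simp) with h0 | h0
      · exact (hg.mono le_rfl hl.2.le).congr h0
      · exact (hg'.mono le_rfl hl.2.le).congr h0
    · exact hh (i + 1) (by simpa)

end Subdivisions

theorem IsUVGeodesic.of_isShortOn {V : Type} [NormedAddCommGroup V] {u v : V} {h : ℝ → V}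
    (hu : ∀ t ≤ 0, h t = u) (hv : ∀ t, dist u v ≤ t → h t = v)
    (hh : IsShortOn h 0 (dist u v)) : IsUVGeodesic u v h := by
  have key : ∀ s t, 0 ≤ s → s ≤ t → t ≤ dist u v → dist (h s) (h t) = t - s := by
    intro s t hs hst ht
    have h₁ := hh 0 s le_rfl hs (hst.trans ht)
    have h₂ := hh s t hs hst ht
    have h₃ := hh t (dist u v) (hs.trans hst) ht le_rfl
    rw [← dist_eq_norm, dist_comm, hu 0 le_rfl] at h₁
    rw [← dist_eq_norm, dist_comm] at h₂
    rw [← dist_eq_norm, dist_comm, hv _ le_rfl] at h₃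
    have h₄ := dist_triangle4 u (h s) (h t) v
    linarith
  refine ⟨hu, hv, fun s hs t ht => ?_⟩
  rcases le_total s t with hst | hst
  · rw [key s t hs.1 hst ht.2, abs_sub_comm, abs_of_nonneg (by linarith)]
  · rw [dist_comm, key t s ht.1 hst hs.2, abs_of_nonneg (by linarith)]

theorem IsUVGeodesic.isShortOn {V : Type} [NormedAddCommGroup V] {u v : V} {h : ℝ → V}
    (hh : IsUVGeodesic u v h) : IsShortOn h 0 (dist u v) := by
  intro s t hs hst ht
  rw [← dist_eq_norm, hh.isom t ⟨hs.trans hst, ht⟩ s ⟨hs, hst.trans ht⟩,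
    abs_of_nonneg (by linarith)]

/-- The rough geodesics joining two points of a normed space form a thick family. -/
theorem isThickFamily_rough {V : Type} [NormedAddCommGroup V] {u v : V} (huv : u ≠ v) {α : ℝ}
    (hα : 0 < α) {g₀ : ℝ → V} (hg₀ : IsUVGeodesic u v g₀) (hr₀ : IsRough α g₀ 0 (dist u v)) :
    IsThickFamily u v {g : ℝ → V | IsUVGeodesic u v g ∧ IsRough α g 0 (dist u v)} := by
  have hD : 0 < dist u v := dist_pos.2 huv
  refine ⟨⟨g₀, hg₀, hr₀⟩, fun g hg => hg.1, α * dist u v, by positivity, ?_⟩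
  rintro g ⟨hg, hr⟩ n r hrI
  obtain ⟨l, hl, hs, hR⟩ := hr.exists_subdivision (Finset.univ.image r) hD.le
  have hclamp : ∀ t ∈ Icc 0 (dist u v), max 0 (min (dist u v) t) = t := by
    intro t ht
    rw [min_eq_right ht.2, max_eq_right ht.1]
  set g' : ℝ → V := fun t => reversePieces g l 0 (max 0 (min (dist u v) t)) with hg'
  have hg'I : ∀ t ∈ Icc 0 (dist u v), g' t = reversePieces g l 0 t := by
    intro t ht
    rw [hg']
    simp only [hclamp t ht]
  have hg'geo : IsUVGeodesic u v g' := by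
    refine .of_isShortOn (fun t ht => ?_) (fun t ht => ?_) fun s t h₁ h₂ h₃ => ?_
    · have : max 0 (min (dist u v) t) = 0 := max_eq_left (min_le_of_right_le ht)
      simp only [hg', this]
      rw [reversePieces_start g hl, hg.left 0 le_rfl]
    · have : max 0 (min (dist u v) t) = dist u v := by
        rw [min_eq_left ht, max_eq_right hD.le]
      simp only [hg', this]
      rw [reversePieces_apply_of_mem g hl _ hl.end_mem, hg.right _ le_rfl]
    · rw [hg'I s ⟨h₁, h₂.trans h₃⟩, hg'I t ⟨h₁.trans h₂, h₃⟩]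
      exact isShortOn_reversePieces hl hg.isShortOn s t h₁ h₂ h₃
  have hr' : IsRough α g' 0 (dist u v) := (isRough_reversePieces hl hr).congr hg'I
  have hmem : ∀ i : Fin (l.length + 1), (0 :: l)[(i : ℕ)] ∈ (0 :: l) :=
    fun i => List.getElem_mem _
  have hlt : ∀ i : Fin l.length, (0 :: l)[(i : ℕ)] < (0 :: l)[(i : ℕ) + 1] := fun i =>
    List.pairwise_iff_getElem.1 hl.pairwise _ _ _ _ (Nat.lt_succ_self _)
  refine ⟨g', ⟨hg'geo, hr'⟩, l.length, fun i => (0 :: l)[(i : ℕ)],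
    fun i => ((0 :: l)[(i : ℕ)] + (0 :: l)[(i : ℕ) + 1]) / 2, ?_, rfl, hl.getElem_length, ?_, ?_,
    ?_, ?_, ?_⟩
  · exact fun i j hij => List.pairwise_iff_getElem.1 hl.pairwise _ _ _ _ hij
  · intro i
    have := hlt i
    simp only [Fin.val_castSucc, Fin.val_succ]
    constructor <;> linarith
  · intro i
    rw [hg'I _ (hl.mem_Icc _ (hmem i)), reversePieces_apply_of_mem g hl _ (hmem i)]
  · intro i
    obtain ⟨j, hj, hji⟩ := List.mem_iff_getElem.1 (hR (r i) (by simp) (hrI i))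
    exact ⟨⟨j, hj⟩, by simp only [hji]⟩
  · rw [sub_zero, ← sum_norm_sub_reversePieces g hl] at hs
    refine hs.trans_eq (Finset.sum_congr rfl fun i _ => ?_)
    have h₁ := hl.mem_Icc _ (hmem i.castSucc)
    have h₂ := hl.mem_Icc _ (hmem i.succ)
    simp only [Fin.val_castSucc, Fin.val_succ, mem_Icc] at h₁ h₂
    rw [dist_eq_norm, hg'I _ ⟨by linarith, by linarith⟩]
  · intro h hh hpw
    exact ⟨hh, IsRough.of_piecewise hl hr hr' fun i hi => hpw ⟨i, hi⟩⟩

section Curves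

variable {Y : Type*} [NormedAddCommGroup Y]

/-- The curve which follows `G₁` up to time `c`, and a translate of `G₂` afterwards. -/
def glue (c : ℝ) (G₁ G₂ : ℝ → Y) : ℝ → Y :=
  fun t => if t ≤ c then G₁ t else G₂ t + (G₁ c - G₂ c)

theorem glue_of_le {c t : ℝ} (G₁ G₂ : ℝ → Y) (ht : t ≤ c) : glue c G₁ G₂ t = G₁ t := by
  simp [glue, ht]

theorem glue_of_ge {c t : ℝ} (G₁ G₂ : ℝ → Y) (ht : c ≤ t) :
    glue c G₁ G₂ t = G₂ t + (G₁ c - G₂ c) := by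
  rcases ht.eq_or_lt with rfl | ht
  · simp [glue]
  · simp [glue, ht]

theorem secondDiffSum_glue {G₁ G₂ : ℝ → Y} {a b c : ℝ} {l₁ l₂ : List ℝ}
    (h₁ : IsSubdivision l₁ a b) (h₂ : IsSubdivision l₂ b c) :
    secondDiffSum (glue b G₁ G₂) (l₁ ++ l₂) a =
      secondDiffSum G₁ l₁ a + secondDiffSum G₂ l₂ b := by
  rw [secondDiffSum_append _ h₁, secondDiffSum_congr (g := glue b G₁ G₂) (h := G₁) 0 h₁,
    secondDiffSum_congr _ h₂ fun t ht => glue_of_ge G₁ G₂ ht.1]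
  intro t ht
  rw [glue_of_le _ _ ht.2, add_zero]

/-- The extension of a curve on `[0, 1]` to the real line by constants. -/
def extendCurve (F : C(Icc (0 : ℝ) 1, Y)) : ℝ → Y := IccExtend zero_le_one F

theorem continuous_extendCurve_apply (t : ℝ) :
    Continuous fun F : C(Icc (0 : ℝ) 1, Y) => extendCurve F t := by
  unfold extendCurve IccExtend
  simp only [Function.comp_apply]
  fun_prop

theorem continuous_secondDiffSum_extendCurve (Y : Type*) [NormedAddCommGroup Y] :
    ∀ (l : List ℝ) (a : ℝ),
    Continuous fun F : C(Icc (0 : ℝ) 1, Y) => secondDiffSum (extendCurve F) l a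
  | [], _ => continuous_const
  | c :: l, a => by
    have h := continuous_secondDiffSum_extendCurve Y l c
    have h₁ := continuous_extendCurve_apply (Y := Y) a
    have h₂ := continuous_extendCurve_apply (Y := Y) c
    have h₃ := continuous_extendCurve_apply (Y := Y) ((a + c) / 2)
    simp only [secondDiffSum]
    fun_prop

end Curves

section Slopes

open scoped Pointwise

variable {Y : Type*} [NormedAddCommGroup Y] [NormedSpace ℝ Y] {K C : Set Y} {α : ℝ}

/-- The chords of `G` over the subintervals of `[a, b]` have slopes in `K`. -/
def HasSlopesIn (K : Set Y) (G : ℝ → Y) (a b : ℝ) : Prop :=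
  ∀ s t, a ≤ s → s ≤ t → t ≤ b → G t - G s ∈ (t - s) • K

theorem HasSlopesIn.union (hK : Convex ℝ K) {G : ℝ → Y} {a b c : ℝ} (h₁ : HasSlopesIn K G a b)
    (h₂ : HasSlopesIn K G b c) : HasSlopesIn K G a c := by
  refine forall_subinterval_union (Q := fun s t => G t - G s ∈ (t - s) • K)
    (fun r s t hrs hst h h' => ?_) h₁ h₂
  rw [← sub_add_sub_cancel t s r, ← sub_add_sub_cancel (G t) (G s) (G r),
    hK.add_smul (by linarith) (by linarith)]
  exact add_mem_add h' h

theorem HasSlopesIn.mono {G : ℝ → Y} {a b a' b' : ℝ} (hG : HasSlopesIn K G a b) (ha : a ≤ a')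
    (hb : b' ≤ b) : HasSlopesIn K G a' b' :=
  fun s t hs hst ht => hG s t (ha.trans hs) hst (ht.trans hb)

theorem HasSlopesIn.of_eq_add_const {G H : ℝ → Y} {a b : ℝ} (hG : HasSlopesIn K G a b) (v : Y)
    (hH : ∀ t ∈ Icc a b, H t = G t + v) : HasSlopesIn K H a b := by
  intro s t hs hst ht
  rw [hH s ⟨hs, hst.trans ht⟩, hH t ⟨hs.trans hst, ht⟩, add_sub_add_right_eq_sub]
  exact hG s t hs hst ht

theorem hasSlopesIn_linear {w : Y} (hw : w ∈ K) (a b : ℝ) :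
    HasSlopesIn K (fun t => t • w) a b := by
  intro s t _ _ _
  rw [← sub_smul]
  exact smul_mem_smul_set hw

theorem HasSlopesIn.isShortOn (hK : K ⊆ Metric.closedBall 0 1) {G : ℝ → Y} {a b : ℝ}
    (hG : HasSlopesIn K G a b) : IsShortOn G a b := by
  intro s t hs hst ht
  obtain ⟨k, hk, hkG⟩ := hG s t hs hst ht
  have hk₁ : ‖k‖ ≤ 1 := by simpa using hK hk
  simp only at hkG
  rw [← hkG, norm_smul, Real.norm_of_nonneg (by linarith)]
  exact mul_le_of_le_one_right (by linarith) hk₁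

theorem HasSlopesIn.glue (hK : Convex ℝ K) {G₁ G₂ : ℝ → Y} {a b c : ℝ}
    (h₁ : HasSlopesIn K G₁ a b) (h₂ : HasSlopesIn K G₂ b c) :
    HasSlopesIn K (glue b G₁ G₂) a c :=
  (h₁.of_eq_add_const 0 fun _ ht => by rw [glue_of_le _ _ ht.2, add_zero]).union hK
    (h₂.of_eq_add_const _ fun _ ht => glue_of_ge _ _ ht.1)

/-- The pairs `(x, r)` such that on each interval some curve with slopes in `K` has total slope
`x` and second differences adding up to at least `r` times the length of the interval. -/
def roughSlopes (K : Set Y) : Set (Y × ℝ) :=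
  {p | ∀ a b, a < b → ∃ G l, HasSlopesIn K G a b ∧ G b - G a = (b - a) • p.1 ∧
    IsSubdivision l a b ∧ (b - a) * p.2 ≤ secondDiffSum G l a}

theorem roughSlopes_of_le {x : Y} {r r' : ℝ} (h : (x, r) ∈ roughSlopes K) (hr : r' ≤ r) :
    (x, r') ∈ roughSlopes K := by
  intro a b hab
  obtain ⟨G, l, h₁, h₂, h₃, h₄⟩ := h a b hab
  exact ⟨G, l, h₁, h₂, h₃, (mul_le_mul_of_nonneg_left hr (by linarith)).trans h₄⟩

theorem convex_roughSlopes (hK : Convex ℝ K) : Convex ℝ (roughSlopes K) := by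
  rw [convex_iff_forall_pos]
  rintro ⟨x, r⟩ hx ⟨y, s⟩ hy p q hp hq hpq a b hab
  have hac : a < a + p * (b - a) := by
    have := mul_pos hp (sub_pos.2 hab)
    linarith
  have hcb : a + p * (b - a) < b := by
    have := mul_pos hq (sub_pos.2 hab)
    rw [eq_sub_of_add_eq' hpq] at this
    linarith
  have e₁ : a + p * (b - a) - a = (b - a) * p := by ring
  have e₂ : b - (a + p * (b - a)) = (b - a) * q := by
    rw [eq_sub_of_add_eq' hpq]; ring
  obtain ⟨G₁, l₁, h₁, h₂, h₃, h₄⟩ := hx _ _ hac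
  obtain ⟨G₂, l₂, k₁, k₂, k₃, k₄⟩ := hy _ _ hcb
  refine ⟨glue _ G₁ G₂, l₁ ++ l₂, h₁.glue hK k₁, ?_, h₃.append k₃, ?_⟩
  · rw [glue_of_ge _ _ hcb.le, glue_of_le _ _ hac.le]
    rw [e₁] at h₂
    rw [e₂] at k₂
    simp only [Prod.smul_mk, Prod.mk_add_mk] at h₂ k₂ ⊢
    rw [smul_add, smul_smul, smul_smul, ← h₂, ← k₂]
    abel
  · rw [secondDiffSum_glue h₃ k₃]
    rw [e₁] at h₄
    rw [e₂] at k₄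
    simp only [Prod.smul_mk, Prod.mk_add_mk, smul_eq_mul] at h₄ k₄ ⊢
    linarith

theorem midpoint_mem_roughSlopes (hK : Convex ℝ K) {w w' : Y} (hw : w ∈ K) (hw' : w' ∈ K) :
    ((1 / 2 : ℝ) • (w + w'), (1 / 2 : ℝ) * ‖w - w'‖) ∈ roughSlopes K := by
  intro a b hab
  have h₁ : a ≤ (a + b) / 2 := by linarith
  have h₂ : (a + b) / 2 ≤ b := by linarith
  refine ⟨glue ((a + b) / 2) (fun t => t • w) (fun t => t • w'), [b],
    (hasSlopesIn_linear hw _ _).glue hK (hasSlopesIn_linear hw' _ _), ?_,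
    isSubdivision_singleton hab, ?_⟩
  · rw [glue_of_ge _ _ h₂, glue_of_le _ _ h₁]
    module
  · simp only [secondDiffSum]
    rw [glue_of_ge _ _ h₂, glue_of_le _ _ h₁, glue_of_le _ _ le_rfl, add_zero]
    have : ((a + b) / 2) • w + ((a + b) / 2) • w - a • w -
        (b • w' + (((a + b) / 2) • w - ((a + b) / 2) • w')) =
        ((b - a) * (1 / 2)) • (w - w') := by module
    rw [this, norm_smul, Real.norm_of_nonneg (by linarith), mul_assoc]

theorem exists_rough_approx (hC : K ⊆ closure C) (hA : ∀ x ∈ C, (x, α) ∈ roughSlopes K)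
    {η : ℝ} (hη : 0 < η) {F : ℝ → Y} {a b : ℝ} (hab : a < b) (hF : HasSlopesIn K F a b) :
    ∃ G l, HasSlopesIn K G a b ∧ ‖(G b - G a) - (F b - F a)‖ ≤ (b - a) * η ∧
      IsSubdivision l a b ∧ (b - a) * α ≤ secondDiffSum G l a := by
  obtain ⟨k, hk, hkF⟩ := hF a b le_rfl hab.le le_rfl
  obtain ⟨x, hx, hkx⟩ := Metric.mem_closure_iff.1 (hC hk) η hη
  obtain ⟨G, l, h₁, h₂, h₃, h₄⟩ := hA x hx a b hab
  refine ⟨G, l, h₁, ?_, h₃, h₄⟩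
  simp only at hkF
  rw [h₂, ← hkF, ← smul_sub, norm_smul, Real.norm_of_nonneg (by linarith), ← dist_eq_norm,
    dist_comm]
  exact mul_le_mul_of_nonneg_left hkx.le (by linarith)

theorem exists_rough_approx_steps (hK : Convex ℝ K) (hK₁ : K ⊆ Metric.closedBall 0 1)
    (hC : K ⊆ closure C) (hA : ∀ x ∈ C, (x, α) ∈ roughSlopes K) {η h : ℝ} (hη : 0 < η)
    (hh : 0 < h) {F : ℝ → Y} {a₀ a : ℝ} (ha : a₀ ≤ a) (n : ℕ)
    (hF : HasSlopesIn K F a₀ (a + n * h)) :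
    ∃ G l, HasSlopesIn K G a₀ (a + n * h) ∧ IsSubdivision l a (a + n * h) ∧
      (∀ t ∈ Icc a₀ (a + n * h), ‖G t - F t‖ ≤ 2 * h + n * h * η) ∧
      ‖G (a + n * h) - F (a + n * h)‖ ≤ n * h * η ∧ n * h * α ≤ secondDiffSum G l a := by
  induction n with
  | zero =>
    refine ⟨F, [], hF, by simp [IsSubdivision], fun t _ => ?_, by simp, by simp [secondDiffSum]⟩
    simp only [sub_self, norm_zero, Nat.cast_zero, zero_mul, add_zero]
    positivity
  | succ n ih =>
    have hc : a + ((n + 1 : ℕ) : ℝ) * h = a + n * h + h := by push_cast; ring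
    rw [hc] at hF ⊢
    set c := a + n * h with hcdef
    have hac : a ≤ c := by rw [hcdef]; linarith [mul_nonneg n.cast_nonneg hh.le]
    obtain ⟨G₁, l₁, h₁, h₂, h₃, h₄, h₅⟩ := ih (hF.mono le_rfl (by linarith))
    have hFc := hF.mono (ha.trans hac) le_rfl
    obtain ⟨G₂, l₂, k₁, k₂, k₃, k₄⟩ :=
      exists_rough_approx hC hA hη (by linarith : c < c + h) hFc
    have hnη : 0 ≤ n * h * η := by positivity
    have hhη : 0 ≤ h * η := by positivity
    rw [add_sub_cancel_left] at k₂ k₄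
    refine ⟨glue c G₁ G₂, l₁ ++ l₂, h₁.glue hK k₁, h₂.append k₃, fun t ht => ?_, ?_, ?_⟩
    · push_cast
      rcases le_total t c with htc | htc
      · rw [glue_of_le _ _ htc]
        linarith [h₃ t ⟨ht.1, htc⟩]
      · rw [glue_of_ge _ _ htc]
        have e₁ := k₁.isShortOn hK₁ c t le_rfl htc ht.2
        have e₂ := hFc.isShortOn hK₁ c t le_rfl htc ht.2
        have e₃ : G₂ t + (G₁ c - G₂ c) - F t = (G₂ t - G₂ c) + (G₁ c - F c) - (F t - F c) := by
          abel
        rw [e₃]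
        have e₄ := norm_sub_le ((G₂ t - G₂ c) + (G₁ c - F c)) (F t - F c)
        have e₅ := norm_add_le (G₂ t - G₂ c) (G₁ c - F c)
        linarith [ht.2]
    · push_cast
      rw [glue_of_ge _ _ (by linarith)]
      have e₃ : G₂ (c + h) + (G₁ c - G₂ c) - F (c + h) =
          (G₂ (c + h) - G₂ c - (F (c + h) - F c)) + (G₁ c - F c) := by abel
      rw [e₃]
      linarith [norm_add_le (G₂ (c + h) - G₂ c - (F (c + h) - F c)) (G₁ c - F c)]
    · push_cast
      rw [secondDiffSum_glue h₂ k₃]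
      linarith

theorem exists_rough_approx_on_subinterval (hK : Convex ℝ K) (hK₁ : K ⊆ Metric.closedBall 0 1)
    (hC : K ⊆ closure C) (hA : ∀ x ∈ C, (x, α) ∈ roughSlopes K) {ε : ℝ} (hε : 0 < ε)
    {F : ℝ → Y} {a₀ a b b₀ : ℝ} (ha : a₀ ≤ a) (hab : a < b) (hb : b ≤ b₀)
    (hF : HasSlopesIn K F a₀ b₀) :
    ∃ G l, HasSlopesIn K G a₀ b₀ ∧ IsSubdivision l a b ∧
      (∀ t ∈ Icc a₀ b₀, ‖G t - F t‖ ≤ ε) ∧ α * (b - a) ≤ secondDiffSum G l a := by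
  have hba : 0 < b - a := sub_pos.2 hab
  obtain ⟨n, hn⟩ := exists_nat_gt (4 * (b - a) / ε)
  have hn₀ : (0 : ℝ) < n := lt_of_le_of_lt (by positivity) hn
  have hnh : (n : ℝ) * ((b - a) / n) = b - a := by field_simp
  have hh : 2 * ((b - a) / n) ≤ ε / 2 := by
    rw [div_lt_iff₀ hε] at hn
    rw [← mul_div_assoc, div_le_iff₀ hn₀]
    linarith
  have hη : (b - a) * (ε / (2 * (b - a))) = ε / 2 := by field_simp
  have hend : a + n * ((b - a) / n) = b := by rw [hnh]; ring
  obtain ⟨G, l, h₁, h₂, h₃, h₄, h₅⟩ := exists_rough_approx_steps hK hK₁ hC hA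
    (η := ε / (2 * (b - a))) (h := (b - a) / n) (by positivity) (by positivity) ha n
    (hF.mono le_rfl (by rwa [hend]))
  rw [hend] at h₁ h₂ h₃ h₄
  rw [hnh] at h₃ h₄ h₅
  rw [hη] at h₃ h₄
  refine ⟨glue b G F, l, h₁.glue hK (hF.mono (ha.trans hab.le) le_rfl), h₂, fun t ht => ?_, ?_⟩
  · rcases le_total t b with htb | htb
    · rw [glue_of_le _ _ htb]
      linarith [h₃ t ⟨ht.1, htb⟩]
    · rw [glue_of_ge _ _ htb, add_sub_cancel_left]
      linarith
  · rw [secondDiffSum_congr (h := G) 0 h₂ fun t ht => by rw [glue_of_le _ _ ht.2, add_zero]]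
    linarith

/-- The continuous curves on `[0, 1]` whose chords have slopes in `K`. -/
def slopeCurves (K : Set Y) : Set C(Icc (0 : ℝ) 1, Y) :=
  {F | ∀ s t : Icc (0 : ℝ) 1, s ≤ t → F t - F s ∈ ((t : ℝ) - s) • K}

theorem isClosed_slopeCurves (hK : IsClosed K) (hK₀ : K.Nonempty) :
    IsClosed (slopeCurves K) := by
  simp only [slopeCurves, ofPred_forall]
  refine isClosed_iInter fun s => isClosed_iInter fun t => isClosed_iInter fun hst => ?_
  have hcl : IsClosed (((t : ℝ) - s) • K) := by
    rcases eq_or_ne ((t : ℝ) - s) 0 with h | h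
    · rw [h, zero_smul_set hK₀]
      exact isClosed_singleton
    · exact hK.smul_of_ne_zero h
  exact hcl.preimage (by fun_prop : Continuous fun F : C(Icc (0 : ℝ) 1, Y) => F t - F s)

theorem hasSlopesIn_extendCurve {F : C(Icc (0 : ℝ) 1, Y)} (hF : F ∈ slopeCurves K) :
    HasSlopesIn K (extendCurve F) 0 1 := by
  intro s t hs hst ht
  have h₁ : s ∈ Icc (0 : ℝ) 1 := ⟨hs, hst.trans ht⟩
  have h₂ : t ∈ Icc (0 : ℝ) 1 := ⟨hs.trans hst, ht⟩
  have h := hF ⟨s, h₁⟩ ⟨t, h₂⟩ hst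
  rwa [extendCurve, IccExtend_of_mem _ _ h₁, IccExtend_of_mem _ _ h₂]

theorem HasSlopesIn.exists_slopeCurve (hK : K ⊆ Metric.closedBall 0 1) {G : ℝ → Y}
    (hG : HasSlopesIn K G 0 1) :
    ∃ F ∈ slopeCurves K, ∀ t : Icc (0 : ℝ) 1, F t = G t := by
  have hlip : LipschitzWith 1 fun t : Icc (0 : ℝ) 1 => G t := by
    refine LipschitzWith.of_dist_le_mul fun s t => ?_
    rw [NNReal.coe_one, one_mul, Subtype.dist_eq, Real.dist_eq]
    rcases le_total s t with hst | hst
    · rw [dist_comm, dist_eq_norm, abs_sub_comm]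
      exact (hG.isShortOn hK s t s.2.1 hst t.2.2).trans (le_abs_self _)
    · rw [dist_eq_norm]
      exact (hG.isShortOn hK t s t.2.1 hst s.2.2).trans (le_abs_self _)
  exact ⟨⟨_, hlip.continuous⟩, fun s t hst => hG s t s.2.1 hst t.2.2, fun _ => rfl⟩

theorem exists_isRough_curve [CompleteSpace Y] (hK : Convex ℝ K) (hK₀ : K.Nonempty)
    (hKcl : IsClosed K) (hK₁ : K ⊆ Metric.closedBall 0 1) (hC : K ⊆ closure C) (hα : 0 < α)
    (hA : ∀ x ∈ C, (x, α) ∈ roughSlopes K) :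
    ∃ F : ℝ → Y, IsShortOn F 0 1 ∧ IsRough (α / 4) F 0 1 := by
  have : CompleteSpace (slopeCurves K) := (isClosed_slopeCurves hKcl hK₀).completeSpace_coe
  have : Nonempty (slopeCurves K) := by
    obtain ⟨k, hk⟩ := hK₀
    obtain ⟨F, hF, -⟩ := (hasSlopesIn_linear hk 0 1).exists_slopeCurve hK₁
    exact ⟨⟨F, hF⟩⟩
  let U : {p : ℚ × ℚ // 0 ≤ p.1 ∧ p.1 < p.2 ∧ p.2 ≤ 1} → Set (slopeCurves K) := fun p =>
    ⋃ l ∈ {l | IsSubdivision l (p.1.1 : ℝ) (p.1.2 : ℝ)},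
      {F | α / 2 * ((p.1.2 : ℝ) - p.1.1) < secondDiffSum (extendCurve F.1) l p.1.1}
  have hopen : ∀ p, IsOpen (U p) := fun p => isOpen_biUnion fun l _ =>
    isOpen_lt continuous_const
      ((continuous_secondDiffSum_extendCurve Y l _).comp continuous_subtype_val)
  have hdense : ∀ p, Dense (U p) := by
    rintro ⟨⟨a, b⟩, ha, hab, hb⟩
    have ha' : (0 : ℝ) ≤ a := by exact_mod_cast ha
    have hab' : (a : ℝ) < b := by exact_mod_cast hab
    have hb' : (b : ℝ) ≤ 1 := by exact_mod_cast hb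
    rw [Metric.dense_iff]
    rintro ⟨F, hF⟩ ε hε
    obtain ⟨G, l, h₁, h₂, h₃, h₄⟩ := exists_rough_approx_on_subinterval hK hK₁ hC hA
      (half_pos hε) ha' hab' hb' (hasSlopesIn_extendCurve hF)
    obtain ⟨G', hG', hGG'⟩ := h₁.exists_slopeCurve hK₁
    refine ⟨⟨G', hG'⟩, ?_, mem_biUnion (x := l) h₂ ?_⟩
    · rw [Metric.mem_ball, Subtype.dist_eq]
      refine lt_of_le_of_lt ((ContinuousMap.dist_le (half_pos hε).le).2 fun t => ?_)
        (half_lt_self hε)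
      have := h₃ t t.2
      rwa [extendCurve, IccExtend_val, ← hGG' t, ← dist_eq_norm] at this
    · have : secondDiffSum (extendCurve G') l a = secondDiffSum G l a := by
        refine secondDiffSum_congr 0 h₂ fun t ht => ?_
        have htI : t ∈ Icc (0 : ℝ) 1 := ⟨ha'.trans ht.1, ht.2.trans hb'⟩
        rw [extendCurve, IccExtend_of_mem _ _ htI, hGG', add_zero]
      simp only [mem_ofPred_eq, this]
      have := mul_pos hα (sub_pos.2 hab')
      linarith
  obtain ⟨⟨F, hF⟩, hFU⟩ := (dense_iInter_of_isOpen hopen hdense).nonempty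
  refine ⟨extendCurve F, (hasSlopesIn_extendCurve hF).isShortOn hK₁, fun s t hs hst ht => ?_⟩
  rcases hst.eq_or_lt with rfl | hst
  · exact ⟨[], rfl, by simp [secondDiffSum]⟩
  obtain ⟨a, hsa, ha⟩ := exists_rat_btwn (by linarith : s < s + (t - s) / 4)
  obtain ⟨b, hb, hbt⟩ := exists_rat_btwn (by linarith : t - (t - s) / 4 < t)
  have hab : (a : ℝ) < b := by linarith
  have hp := mem_iInter.1 hFU ⟨(a, b), by exact_mod_cast (by linarith : (0 : ℝ) ≤ a),
    by exact_mod_cast hab, by exact_mod_cast (by linarith : (b : ℝ) ≤ 1)⟩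
  simp only [U, mem_iUnion, mem_ofPred_eq, exists_prop] at hp
  obtain ⟨l, hl, hls⟩ := hp
  have hl₁ := (isSubdivision_singleton hsa).append hl
  refine ⟨[(a : ℝ)] ++ l ++ [t], hl₁.append (isSubdivision_singleton hbt), ?_⟩
  rw [secondDiffSum_append _ hl₁, secondDiffSum_append _ (isSubdivision_singleton hsa)]
  have n₁ := secondDiffSum_nonneg (extendCurve F) [(a : ℝ)] s
  have n₂ := secondDiffSum_nonneg (extendCurve F) [t] b
  have n₃ : α * ((t - s) / 2) ≤ α * (b - a) :=
    mul_le_mul_of_nonneg_left (by linarith) hα.le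
  linarith

end Slopes

/-- Suppose that each `z ∈ Z` is a convex combination of points `y ∈ Z` such that `π y` is far from
`π z` or `f y` is far from `f z`, where `f` is bounded on `Z`. Then the image under `π` of each
point of the convex hull of `Z` is an average of midpoints of distant points of the image. -/
theorem mem_of_oscillation {X Y : Type*} [AddCommGroup X] [Module ℝ X] [NormedAddCommGroup Y]
    [NormedSpace ℝ Y] (π : X →ₗ[ℝ] Y) (f : X →ₗ[ℝ] ℝ) {Z : Set X} {β γ M : ℝ} (hβ : 0 < β)
    (hγ : 0 ≤ γ) (hM : ∀ z ∈ Z, f z ^ 2 ≤ M)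
    (hZ : ∀ z ∈ Z, ∃ (ι : Type) (s : Finset ι) (w : ι → ℝ) (y : ι → X), (∀ i ∈ s, 0 ≤ w i) ∧
      ∑ i ∈ s, w i = 1 ∧ ∑ i ∈ s, w i • y i = z ∧ (∀ i ∈ s, y i ∈ Z) ∧
      ∀ i ∈ s, β ≤ ‖π (y i) - π z‖ + γ * (f (y i) - f z) ^ 2)
    {A : Set (Y × ℝ)} (hA : Convex ℝ A) (hle : ∀ x r r', (x, r) ∈ A → r' ≤ r → (x, r') ∈ A)
    (hmid : ∀ y ∈ Z, ∀ z ∈ Z,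
      ((1 / 2 : ℝ) • (π y + π z), (1 / 2 : ℝ) * ‖π y - π z‖) ∈ A) :
    ∀ x ∈ convexHull ℝ Z, (π x, β / 4) ∈ A := by
  set D : Set (X × ℝ) := convexHull ℝ ((fun z => (z, f z ^ 2)) '' Z) with hD
  have hDle : ∀ p ∈ D, p.2 ≤ M := by
    have hconv : Convex ℝ {p : X × ℝ | p.2 ≤ M} :=
      convex_halfSpace_le (LinearMap.snd ℝ X ℝ).isLinear M
    intro p hp
    refine convexHull_min ?_ hconv hp
    rintro _ ⟨z, hz, rfl⟩
    exact hM z hz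
  have hDgain : ∀ p ∈ D, ∃ V : ℝ, (p.1, p.2 + V) ∈ D ∧ (π p.1, β / 2 - γ / 2 * V) ∈ A := by
    have hconv : Convex ℝ
        {p : X × ℝ | ∃ V : ℝ, (p.1, p.2 + V) ∈ D ∧ (π p.1, β / 2 - γ / 2 * V) ∈ A} := by
      rintro ⟨x, r⟩ ⟨V, hV₁, hV₂⟩ ⟨y, s⟩ ⟨W, hW₁, hW₂⟩ p q hp hq hpq
      refine ⟨p * V + q * W, ?_, ?_⟩
      · convert convex_convexHull ℝ _ hV₁ hW₁ hp hq hpq using 1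
        simp only [Prod.smul_mk, Prod.mk_add_mk, smul_eq_mul]
        congr 1
        ring
      · convert hA hV₂ hW₂ hp hq hpq using 1
        simp only [Prod.smul_mk, Prod.mk_add_mk, smul_eq_mul, map_add, map_smul]
        congr 1
        rw [eq_sub_of_add_eq' hpq]
        ring
    intro p hp
    refine convexHull_min ?_ hconv hp
    rintro _ ⟨z, hz, rfl⟩
    obtain ⟨ι, s, w, y, hw, hw₁, hy, hyZ, hyβ⟩ := hZ z hz
    have hfz : ∑ i ∈ s, w i * f (y i) = f z := by
      rw [← hy, map_sum]
      simp
    have hvar : ∑ i ∈ s, w i * (f (y i) - f z) ^ 2 = ∑ i ∈ s, w i * f (y i) ^ 2 - f z ^ 2 := by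
      have : ∀ i, w i * (f (y i) - f z) ^ 2 =
          w i * f (y i) ^ 2 - 2 * f z * (w i * f (y i)) + f z ^ 2 * w i := fun i => by ring
      simp only [this]
      rw [Finset.sum_add_distrib, Finset.sum_sub_distrib, ← Finset.mul_sum, ← Finset.mul_sum,
        hfz, hw₁]
      ring
    refine ⟨∑ i ∈ s, w i * f (y i) ^ 2 - f z ^ 2, ?_, ?_⟩
    · have h := (convex_convexHull ℝ ((fun z => (z, f z ^ 2)) '' Z)).sum_mem hw hw₁
        (z := fun i => (y i, f (y i) ^ 2))
        fun i hi => subset_convexHull ℝ _ ⟨y i, hyZ i hi, rfl⟩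
      convert h using 1
      ext1
      · simp [Prod.fst_sum, hy]
      · simp [Prod.snd_sum]
    · have h := hA.sum_mem hw hw₁ fun i hi => hmid (y i) (hyZ i hi) z hz
      have h₁ : ∑ i ∈ s, w i • ((1 / 2 : ℝ) • (π (y i) + π z), (1 / 2 : ℝ) * ‖π (y i) - π z‖) =
          (π z, ∑ i ∈ s, w i * ((1 / 2 : ℝ) * ‖π (y i) - π z‖)) := by
        ext1
        · have e : ∑ i ∈ s, w i • π (y i) = π z := by
            rw [← hy, map_sum]
            simp
          simp only [Prod.fst_sum, Prod.smul_mk]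
          simp_rw [smul_comm (w _) (1 / 2 : ℝ), smul_add]
          rw [Finset.sum_add_distrib, ← Finset.smul_sum, ← Finset.smul_sum, e,
            ← Finset.sum_smul, hw₁]
          module
        · simp [Prod.snd_sum]
      rw [h₁] at h
      refine hle _ _ _ h ?_
      rw [← hvar, Finset.mul_sum]
      have h₂ : β / 2 = ∑ i ∈ s, w i * (β / 2) := by rw [← Finset.sum_mul, hw₁, one_mul]
      rw [h₂, ← Finset.sum_sub_distrib]
      refine Finset.sum_le_sum fun i hi => ?_
      have := mul_le_mul_of_nonneg_left (hyβ i hi) (hw i hi)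
      linarith
  intro x hx
  have hxD : ∃ r, (x, r) ∈ D := by
    have h : (LinearMap.fst ℝ X ℝ) '' D = convexHull ℝ Z := by
      rw [hD, LinearMap.image_convexHull, image_image]
      simp
    rw [← h] at hx
    obtain ⟨⟨x', r⟩, hp, rfl⟩ := hx
    exact ⟨r, hp⟩
  have hne : {r | (x, r) ∈ D}.Nonempty := hxD
  have hbdd : BddAbove {r | (x, r) ∈ D} := ⟨M, fun r hr => hDle _ hr⟩
  have hε : 0 < β / (2 * (γ + 1)) := by positivity
  obtain ⟨r, hr, hrs⟩ := exists_lt_of_lt_csSup hne (sub_lt_self (sSup {r | (x, r) ∈ D}) hε)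
  obtain ⟨V, hV₁, hV₂⟩ := hDgain (x, r) hr
  have hV : V ≤ β / (2 * (γ + 1)) := by
    have := le_csSup hbdd (show r + V ∈ {r | (x, r) ∈ D} from hV₁)
    linarith
  refine hle _ _ _ hV₂ ?_
  have h₁ : γ * V ≤ γ * (β / (2 * (γ + 1))) := mul_le_mul_of_nonneg_left hV hγ
  have h₂ : γ * (β / (2 * (γ + 1))) ≤ β / 2 := by
    rw [← mul_div_assoc, div_le_div_iff₀ (by positivity) (by positivity)]
    linarith
  linarith

theorem secondDiffSum_graph {Y : Type*} [NormedAddCommGroup Y] (F : ℝ → Y) :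
    ∀ (l : List ℝ) (a : ℝ), secondDiffSum (fun t => (F t, t)) l a = secondDiffSum F l a
  | [], _ => rfl
  | c :: l, a => by
    simp only [secondDiffSum, secondDiffSum_graph F l c, Prod.mk_add_mk, Prod.mk_sub_mk]
    have : (a + c) / 2 + (a + c) / 2 - a - c = 0 := by ring
    rw [this, Prod.norm_mk, norm_zero, max_eq_left (norm_nonneg _)]

/-- If `Y` contains a rough Lipschitz curve, then `Y × ℝ` contains a thick family of
geodesics. -/
theorem exists_isThickFamily_of_isRough {Y : Type} [NormedAddCommGroup Y] {F : ℝ → Y} {α : ℝ}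
    (hα : 0 < α) (hF : IsShortOn F 0 1) (hr : IsRough α F 0 1) :
    ∃ (u v : Y × ℝ) (T : Set (ℝ → Y × ℝ)), IsThickFamily u v T := by
  have hclamp : ∀ t ∈ Icc (0 : ℝ) 1, max 0 (min 1 t) = t := fun t ht => by
    rw [min_eq_right ht.2, max_eq_right ht.1]
  have hduv : dist (F 0, (0 : ℝ)) (F 1, (1 : ℝ)) = 1 := by
    have := hF 0 1 le_rfl zero_le_one le_rfl
    rw [← dist_eq_norm, dist_comm, sub_zero] at this
    rw [Prod.dist_eq]
    simpa using this
  let G : ℝ → Y × ℝ := fun t => (F (max 0 (min 1 t)), max 0 (min 1 t))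
  have hG : ∀ t ∈ Icc (0 : ℝ) 1, G t = (F t, t) := fun t ht => by
    simp only [G, hclamp t ht]
  refine ⟨(F 0, 0), (F 1, 1), _, isThickFamily_rough (g₀ := G) ?_ hα (.of_isShortOn ?_ ?_ ?_) ?_⟩
  · exact fun h => zero_ne_one (congrArg Prod.snd h)
  · intro t ht
    have : max 0 (min 1 t) = 0 := max_eq_left (min_le_of_right_le ht)
    simp only [G, this]
  · intro t ht
    rw [hduv] at ht
    have : max 0 (min 1 t) = 1 := by rw [min_eq_left ht, max_eq_right zero_le_one]
    simp only [G, this]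
  · rw [hduv]
    intro s t hs hst ht
    rw [hG s ⟨hs, hst.trans ht⟩, hG t ⟨hs.trans hst, ht⟩, Prod.mk_sub_mk, Prod.norm_mk]
    exact max_le (hF s t hs hst ht) (by rw [Real.norm_of_nonneg (by linarith)])
  · rw [hduv]
    refine IsRough.congr (fun s t hs hst ht => ?_) hG
    obtain ⟨l, hl, hls⟩ := hr s t hs hst ht
    exact ⟨l, hl, by rwa [secondDiffSum_graph]⟩

/-- The projection onto the kernel of `f` along a vector `e` with `f e = 1`. -/
theorem exists_projection_ker {X : Type*} [NormedAddCommGroup X] [NormedSpace ℝ X]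
    (f : X →L[ℝ] ℝ) {e : X} (he : f e = 1) :
    ∃ P : X →ₗ[ℝ] f.ker, ∀ x, (P x : X) = x - f x • e :=
  ⟨LinearMap.codRestrict _ (LinearMap.id - (f : X →ₗ[ℝ] ℝ).smulRight e) fun x => by simp [he],
    fun _ => rfl⟩

/-- The product of the kernel of `f` with the line is isomorphic to the whole space. -/
theorem bilipschitz_ker_prod {X : Type*} [NormedAddCommGroup X] [NormedSpace ℝ X]
    (f : X →L[ℝ] ℝ) {e : X} (he : f e = 1) :
    ∃ l L : ℝ, 0 < l ∧ l ≤ L ∧ ∀ p q : f.ker × ℝ,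
      l * dist p q ≤ ‖((p.1 : X) + p.2 • e) - (q.1 + q.2 • e)‖ ∧
      ‖((p.1 : X) + p.2 • e) - (q.1 + q.2 • e)‖ ≤ L * dist p q := by
  have hb : 0 < 1 + ‖f‖ * (1 + ‖e‖) := by positivity
  refine ⟨(1 + ‖f‖ * (1 + ‖e‖))⁻¹, 1 + ‖e‖, inv_pos.2 hb, ?_, fun p q => ?_⟩
  · refine (inv_le_one_of_one_le₀ ?_).trans (le_add_of_nonneg_right (norm_nonneg e))
    exact le_add_of_nonneg_right (by positivity)
  have hx : ((p.1 : X) + p.2 • e) - (q.1 + q.2 • e) =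
      ((p - q).1 : X) + (p - q).2 • e := by
    simp only [Prod.fst_sub, Prod.snd_sub, Submodule.coe_sub]
    module
  rw [hx, dist_eq_norm]
  generalize p - q = r
  obtain ⟨y, s⟩ := r
  simp only [Prod.norm_mk]
  have hfx : f (y + s • e) = s := by
    have : f y = 0 := y.2
    simp [he, this]
  have hs : ‖s‖ ≤ ‖f‖ * ‖(y : X) + s • e‖ := by
    conv_lhs => rw [← hfx]
    exact f.le_opNorm _
  have hy : ‖y‖ ≤ ‖(y : X) + s • e‖ + ‖s‖ * ‖e‖ := by
    rw [← norm_smul, ← Submodule.norm_coe]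
    simpa using norm_sub_le ((y : X) + s • e) (s • e)
  have hse := mul_le_mul_of_nonneg_right hs (norm_nonneg e)
  have hfn : 0 ≤ ‖f‖ * ‖(y : X) + s • e‖ := by positivity
  have hfe : 0 ≤ ‖f‖ * ‖(y : X) + s • e‖ * ‖e‖ := by positivity
  constructor
  · rw [inv_mul_le_iff₀ hb]
    refine max_le ?_ ?_
    · linarith
    · linarith [norm_nonneg ((y : X) + s • e)]
  · refine (norm_add_le _ _).trans ?_
    rw [norm_smul, Submodule.norm_coe, add_mul, one_mul, mul_comm ‖e‖]
    exact add_le_add (le_max_left _ _)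
      (mul_le_mul_of_nonneg_right (le_max_right _ _) (norm_nonneg e))

/-- If each point of a bounded set is a convex combination of points of the set at distance at
least `δ` from it, then the kernel of any nonzero functional contains a rough Lipschitz curve. -/
theorem exists_isRough_curve_ker {X : Type*} [NormedAddCommGroup X] [NormedSpace ℝ X]
    [CompleteSpace X] {δ B : ℝ} (hδ : 0 < δ) {Z : Set X} (hZ₀ : Z.Nonempty)
    (hB : ∀ z ∈ Z, ‖z‖ ≤ B)
    (hZ : ∀ z ∈ Z, ∃ (ι : Type) (s : Finset ι) (w : ι → ℝ) (y : ι → X), (∀ i ∈ s, 0 ≤ w i) ∧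
      ∑ i ∈ s, w i = 1 ∧ ∑ i ∈ s, w i • y i = z ∧ (∀ i ∈ s, y i ∈ Z) ∧
      ∀ i ∈ s, δ ≤ ‖y i - z‖)
    (f : X →L[ℝ] ℝ) {e : X} (he : f e = 1) :
    ∃ (F : ℝ → f.ker) (α : ℝ), 0 < α ∧ IsShortOn F 0 1 ∧ IsRough α F 0 1 := by
  have : CompleteSpace f.ker := f.isClosed_ker.completeSpace_coe
  obtain ⟨P, hP⟩ := exists_projection_ker f he
  have hB₀ : 0 ≤ B := (norm_nonneg _).trans (hB _ hZ₀.some_mem)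
  set b : ℝ := B + ‖f‖ * B * ‖e‖ + 1 with hb
  have hb₀ : 0 < b := by positivity
  have hPb : ∀ z ∈ Z, ‖P z‖ ≤ b := by
    intro z hz
    rw [← Submodule.norm_coe, hP]
    refine (norm_sub_le _ _).trans ?_
    rw [norm_smul]
    have h₁ : ‖f z‖ ≤ ‖f‖ * B :=
      (f.le_opNorm z).trans (mul_le_mul_of_nonneg_left (hB z hz) (norm_nonneg f))
    have h₂ := mul_le_mul_of_nonneg_right h₁ (norm_nonneg e)
    linarith [hB z hz]
  have hPδ : ∀ x, δ ≤ ‖x‖ → δ / 2 ≤ ‖P x‖ + ‖e‖ ^ 2 / (2 * δ) * f x ^ 2 := by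
    intro x hx
    rw [← Submodule.norm_coe, hP]
    have h₁ := norm_sub_norm_le x (f x • e)
    have h₂ : ‖f x • e‖ ≤ δ / 2 + ‖e‖ ^ 2 / (2 * δ) * f x ^ 2 := by
      rw [norm_smul, Real.norm_eq_abs, ← sq_abs (f x)]
      have h₃ : δ / 2 + ‖e‖ ^ 2 / (2 * δ) * |f x| ^ 2 - |f x| * ‖e‖ =
          (δ - |f x| * ‖e‖) ^ 2 / (2 * δ) := by
        field_simp
        ring
      have h₄ : 0 ≤ (δ - |f x| * ‖e‖) ^ 2 / (2 * δ) := by positivity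
      linarith
    linarith
  set π : X →ₗ[ℝ] f.ker := b⁻¹ • P with hπ
  have hπn : ∀ x, ‖π x‖ = b⁻¹ * ‖P x‖ := fun x => by
    rw [hπ, LinearMap.smul_apply, norm_smul, Real.norm_of_nonneg (inv_pos.2 hb₀).le]
  set C : Set f.ker := convexHull ℝ (π '' Z) with hC
  have hK₁ : closure C ⊆ Metric.closedBall 0 1 := by
    refine closure_minimal (convexHull_min ?_ (convex_closedBall 0 1)) Metric.isClosed_closedBall
    rintro _ ⟨z, hz, rfl⟩
    rw [mem_closedBall_zero_iff, hπn, inv_mul_le_iff₀ hb₀, mul_one]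
    exact hPb z hz
  have hK : Convex ℝ (closure C) := (convex_convexHull ℝ _).closure
  have hZK : ∀ z ∈ Z, π z ∈ closure C := fun z hz =>
    subset_closure (subset_convexHull ℝ _ (mem_image_of_mem _ hz))
  have hosc := mem_of_oscillation π (f : X →ₗ[ℝ] ℝ) (Z := Z) (β := b⁻¹ * (δ / 2))
    (γ := b⁻¹ * (‖e‖ ^ 2 / (2 * δ))) (M := (‖f‖ * B) ^ 2) (by positivity) (by positivity)
    (fun z hz => ?_) (fun z hz => ?_) (convex_roughSlopes hK)
    (fun x r r' h h' => roughSlopes_of_le h h')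
    (fun y hy z hz => midpoint_mem_roughSlopes hK (hZK y hy) (hZK z hz))
  · obtain ⟨F, hF₁, hF₂⟩ := exists_isRough_curve (C := C) (α := b⁻¹ * (δ / 2) / 4) hK
      ⟨_, hZK _ hZ₀.some_mem⟩ isClosed_closure hK₁ subset_rfl (by positivity) (fun x hx => by
        rw [hC, ← LinearMap.image_convexHull] at hx
        obtain ⟨x, hx, rfl⟩ := hx
        exact hosc x hx)
    exact ⟨F, _, by positivity, hF₁, hF₂⟩
  · refine sq_le_sq.2 ?_
    rw [abs_of_nonneg (by positivity : 0 ≤ ‖f‖ * B)]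
    exact (f.le_opNorm z).trans (mul_le_mul_of_nonneg_left (hB z hz) (norm_nonneg f))
  · obtain ⟨ι, s, w, y, h₁, h₂, h₃, h₄, h₅⟩ := hZ z hz
    refine ⟨ι, s, w, y, h₁, h₂, h₃, h₄, fun i hi => ?_⟩
    have h := mul_le_mul_of_nonneg_left (hPδ _ (h₅ i hi)) (inv_pos.2 hb₀).le
    rw [← map_sub, hπn]
    refine h.trans_eq ?_
    simp only [map_sub, ContinuousLinearMap.coe_coe]
    ring

/-- If a Banach space contains a bounded `δ`-bush (equivalently, fails the Radon–Nikodým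
property), then some metric space containing a thick family of geodesics admits a
 bilipschitz embedding into it. -/
theorem bush_gives_embedded_thick_family
    (X : Type) [NormedAddCommGroup X] [NormedSpace ℝ X] [CompleteSpace X]
    (δ : ℝ) (hδ : 0 < δ) (m : ℕ → ℕ) (z : (n : ℕ) → Fin (m n) → X)
    (hbush : IsDeltaBush X δ m z) (B : ℝ) (hB : ∀ (n : ℕ) (j : Fin (m n)), ‖z n j‖ ≤ B) :
    ∃ (M : Type) (_ : MetricSpace M) (u v : M) (T : Set (ℝ → M)),
      IsThickFamily u v T ∧
      ∃ (f : M → X) (l L : ℝ), 0 < l ∧ l ≤ L ∧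
        ∀ x y : M, l * dist x y ≤ ‖f x - f y‖ ∧ ‖f x - f y‖ ≤ L * dist x y := by
  obtain ⟨hm₀, hbush⟩ := hbush
  set Z : Set X := {x | ∃ n j, x = z n j} with hZ
  have hZ₀ : Z.Nonempty := ⟨_, 0, ⟨0, by omega⟩, rfl⟩
  have hZB : ∀ x ∈ Z, ‖x‖ ≤ B := by
    rintro _ ⟨n, j, rfl⟩
    exact hB n j
  have hZδ : ∀ x ∈ Z, ∃ (ι : Type) (s : Finset ι) (w : ι → ℝ) (y : ι → X),
      (∀ i ∈ s, 0 ≤ w i) ∧ ∑ i ∈ s, w i = 1 ∧ ∑ i ∈ s, w i • y i = x ∧ (∀ i ∈ s, y i ∈ Z) ∧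
      ∀ i ∈ s, δ ≤ ‖y i - x‖ := by
    rintro _ ⟨n, k, rfl⟩
    obtain ⟨p, lam, h₁, h₂, h₃, h₄⟩ := hbush n
    refine ⟨_, Finset.univ.filter fun j => p j = k, lam, z (n + 1), fun i _ => h₁ i, h₃ k,
      (h₄ k).symm, fun i _ => ⟨_, _, rfl⟩, fun i hi => ?_⟩
    rw [← (Finset.mem_filter.1 hi).2]
    exact h₂ i
  obtain ⟨e₀, he₀⟩ : ∃ e₀ : X, e₀ ≠ 0 := by
    obtain ⟨x, hx⟩ := hZ₀
    obtain ⟨ι, s, w, y, -, h₂, -, -, h₅⟩ := hZδ x hx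
    obtain ⟨i, hi⟩ : s.Nonempty := by
      rw [Finset.nonempty_iff_ne_empty]
      rintro rfl
      simp at h₂
    exact ⟨y i - x, norm_pos_iff.1 (hδ.trans_le (h₅ i hi))⟩
  obtain ⟨f, hf⟩ := SeparatingDual.exists_eq_one (R := ℝ) he₀
  obtain ⟨F, α, hα, hF, hr⟩ := exists_isRough_curve_ker hδ hZ₀ hZB hZδ f hf
  obtain ⟨u, v, T, hT⟩ := exists_isThickFamily_of_isRough hα hF hr
  obtain ⟨l, L, hl, hlL, hlip⟩ := bilipschitz_ker_prod f hf
  exact ⟨f.ker × ℝ, inferInstance, u, v, T, hT, fun p => (p.1 : X) + p.2 • e₀,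
    l, L, hl, hlL, hlip⟩
end
end
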